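/- Let a ∈ (0,2] be a Misiurewicz–Thurston parameter for the quadratic map T_a(x) = 1 − a x² on [−1,1], with ergodic absolutely continuous invariant probability measure μ. Let ζ ∈ [1−a, 1] be a point that is not periodic under T_a, and let (B_n) be open balls centred at ζ with radii tending to 0 such that n·μ(B_n) → τ for some τ > 0. Then the rescaled interarrival process μ(B_n)·Φ_{B_n} converges in distribution under μ to ν_1, the law of an i.i.d. sequence of rate-1 exponential random variables (equivalently, the rare events point process of visits to B_n converges to a standard homogeneous Poisson process of intensity 1). -/

import Mathlib

open MeasureTheory Filter Set ProbabilityTheory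
open scoped ENNReal Topology ENat

noncomputable section

variable {X : Type*}

/-- The instant of the `i`-th visit (after time `0`) of the orbit of `x` under `T` to `B`,
with the convention that `hitInstant T B x 0 = 0` and the value is `⊤` if there is no
such visit. -/
def hitInstant (T : X → X) (B : Set X) (x : X) : ℕ → ℕ∞
  | 0 => 0
  | (i+1) => sInf {m : ℕ∞ | ∃ n : ℕ, hitInstant T B x i < (n : ℕ∞) ∧ T^[n] x ∈ B ∧ m = (n : ℕ∞)}

/-- The first hitting time `r_B(x) = inf {k ≥ 1 : T^k x ∈ B}` (with value `⊤` if the orbit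
never enters `B`). -/
def hitTime (T : X → X) (B : Set X) (x : X) : ℕ∞ := hitInstant T B x 1

/-- The `i`-th interarrival time (gap between the `i`-th and `(i+1)`-st visits);
`interGap T B 0 x` is the first hitting time `r_B^{(1)}(x)`, and once some
visit fails to occur, all subsequent gaps are `⊤`. -/
def interGap (T : X → X) (B : Set X) (i : ℕ) (x : X) : ℝ≥0∞ :=
  if hitInstant T B x i = ⊤ then ⊤
  else ((hitInstant T B x (i+1) - hitInstant T B x i : ℕ∞) : ℝ≥0∞)

/-- The shadow set `E'_A = ⋃_{k ≥ 0} (A ∩ {r_A > k} ∩ T^{-k} E)` of `E` in `A`. -/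
def shadow (T : X → X) (A E : Set X) : Set X :=
  ⋃ k : ℕ, A ∩ {x | (k : ℕ∞) < hitTime T A x} ∩ (T^[k]) ⁻¹' E

/-- The induced (first-return) map `T_A(x) = T^{r_A(x)}(x)` (junk value `x` if the orbit of
`x` never returns to `A`). -/
def inducedMap (T : X → X) (A : Set X) (x : X) : X :=
  T^[sInf {n : ℕ | 1 ≤ n ∧ T^[n] x ∈ A}] x

/-- The rescaled interarrival process `c · Φ_B : x ↦ (c · r_B^{(i)}(x))_{i ≥ 1}`,
as a random element of `ℕ → ℝ≥0∞`. -/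
def rescaledProcess (T : X → X) (B : Set X) (c : ℝ≥0∞) (x : X) : ℕ → ℝ≥0∞ :=
  fun i => c * interGap T B i x

/-- Convergence in distribution: the laws of the random elements `f n : X → (ℕ → ℝ≥0∞)`
under the measures `P n` converge weakly to `ν` (tested against bounded continuous
real functions, with `ℕ → ℝ≥0∞` carrying the product topology). -/
def ConvInDist [MeasurableSpace X] (P : ℕ → Measure X)
    (f : ℕ → X → (ℕ → ℝ≥0∞)) (ν : Measure (ℕ → ℝ≥0∞)) : Prop :=
  ∀ g : BoundedContinuousFunction (ℕ → ℝ≥0∞) ℝ,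
    Tendsto (fun n => ∫ x, g (f n x) ∂(P n)) atTop (𝓝 (∫ y, g y ∂ν))

end

/-- The quadratic map `T_a(x) = 1 - a x²`. -/
def Ta (a : ℝ) : ℝ → ℝ := fun x => 1 - a * x ^ 2

/-- The exponential law of rate `θ`, pushed forward to `ℝ≥0∞`. -/
noncomputable def expLawENN (θ : ℝ) : Measure ℝ≥0∞ :=
  (ProbabilityTheory.expMeasure θ).map ENNReal.ofReal

/-- The law of the `i`-th coordinate of the interarrival process of a compound Poisson
process of intensity `θ` with Geometric(θ) multiplicity distribution: the first coordinate
is `Exp(θ)` and the following ones are `(1-θ)·δ₀ + θ·Exp(θ)`. -/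
noncomputable def coordLaw (θ : ℝ) : ℕ → Measure ℝ≥0∞ :=
  fun i => if i = 0 then expLawENN θ
    else ENNReal.ofReal (1 - θ) • Measure.dirac 0 + ENNReal.ofReal θ • expLawENN θ

/-- `ν` is the law `ν_θ` on `[0,∞]^ℕ` of the sequence `(G_i)` of independent random
variables with `G_1 ∼ Exp(θ)` and `G_i ∼ (1-θ)δ₀ + θ Exp(θ)` for `i ≥ 2`: a probability
measure all of whose finite-dimensional marginals are the corresponding product laws
(this determines `ν` uniquely). -/
def IsNuTheta (θ : ℝ) (ν : Measure (ℕ → ℝ≥0∞)) : Prop :=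
  IsProbabilityMeasure ν ∧
    ∀ m : ℕ, ν.map (fun ω : ℕ → ℝ≥0∞ => fun i : Fin m => ω (i : ℕ)) =
      Measure.pi (fun i : Fin m => coordLaw θ (i : ℕ))

section HittingTimes

variable {X : Type*} {T : X → X} {B : Set X}

theorem sInf_enat_shift (x : X) (t : ℕ∞) :
    sInf {m : ℕ∞ | ∃ n : ℕ, 1 + t < (n : ℕ∞) ∧ T^[n] x ∈ B ∧ m = (n : ℕ∞)} =
      1 + sInf {m : ℕ∞ | ∃ n : ℕ, t < (n : ℕ∞) ∧ T^[n] (T x) ∈ B ∧ m = (n : ℕ∞)} := by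
  apply le_antisymm
  · by_cases hne : {m : ℕ∞ | ∃ n : ℕ, t < (n : ℕ∞) ∧ T^[n] (T x) ∈ B ∧ m = (n : ℕ∞)}.Nonempty
    · obtain ⟨n, h1, h2, h3⟩ := csInf_mem hne
      rw [h3]
      apply sInf_le
      refine ⟨n + 1, ?_, h2, by push_cast; rw [add_comm]⟩
      push_cast
      rw [add_comm (n : ℕ∞) 1]
      exact (ENat.add_lt_add_iff_left (by simp)).2 h1
    · rw [Set.not_nonempty_iff_eq_empty] at hne
      rw [hne]; simp
  · apply le_sInf
    rintro m ⟨n, h1, h2, rfl⟩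
    rcases n with _ | n
    · simp at h1
    · push_cast at h1 ⊢
      rw [add_comm (n : ℕ∞) 1] at h1 ⊢
      gcongr
      exact sInf_le ⟨n, (ENat.add_lt_add_iff_left (by simp)).1 h1, h2, rfl⟩

theorem hitInstant_one_of_mem {x : X} (h : T x ∈ B) : hitInstant T B x 1 = 1 := by
  apply le_antisymm
  · exact sInf_le ⟨1, by simp [hitInstant], by simpa using h, by simp⟩
  · apply le_sInf
    rintro m ⟨n, h1, h2, rfl⟩
    simp only [hitInstant] at h1
    exact_mod_cast Nat.one_le_iff_ne_zero.2 (by rintro rfl; simp at h1)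

theorem hitInstant_succ_of_mem {x : X} (h : T x ∈ B) (i : ℕ) :
    hitInstant T B x (i + 1) = 1 + hitInstant T B (T x) i := by
  induction i with
  | zero => rw [hitInstant_one_of_mem h]; simp [hitInstant]
  | succ i ih =>
    rw [hitInstant, ih, sInf_enat_shift]
    rfl

theorem hitInstant_succ_of_notMem {x : X} (h : T x ∉ B) (i : ℕ) :
    hitInstant T B x (i + 1) = 1 + hitInstant T B (T x) (i + 1) := by
  induction i with
  | zero =>
    simp only [hitInstant]
    rw [← sInf_enat_shift]
    congr 1
    ext m
    constructor
    · rintro ⟨n, h1, h2, rfl⟩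
      refine ⟨n, ?_, h2, rfl⟩
      rcases n with _ | _ | n
      · simp at h1
      · exact absurd (by simpa using h2) h
      · norm_cast; omega
    · rintro ⟨n, h1, h2, rfl⟩
      exact ⟨n, lt_of_le_of_lt (by simp) h1, h2, rfl⟩
  | succ i ih =>
    rw [hitInstant, ih, sInf_enat_shift]
    rfl

theorem enat_one_add_sub_one_add (s t : ℕ∞) : (1 + s) - (1 + t) = s - t := by
  rw [← tsub_tsub, (ENat.addLECancellable_of_ne_top ENat.one_ne_top).add_tsub_cancel_left]

theorem interGap_zero_of_mem {x : X} (h : T x ∈ B) : interGap T B 0 x = 1 := by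
  unfold interGap
  rw [zero_add, hitInstant_one_of_mem h]
  simp [hitInstant]

theorem interGap_succ_of_mem {x : X} (h : T x ∈ B) (i : ℕ) :
    interGap T B (i + 1) x = interGap T B i (T x) := by
  unfold interGap
  rw [hitInstant_succ_of_mem h, hitInstant_succ_of_mem h, enat_one_add_sub_one_add]
  congr 1
  simp

theorem interGap_zero_of_notMem {x : X} (h : T x ∉ B) :
    interGap T B 0 x = 1 + interGap T B 0 (T x) := by
  unfold interGap
  simp only [zero_add]
  rw [hitInstant_succ_of_notMem h 0]
  simp [hitInstant]

theorem interGap_succ_of_notMem {x : X} (h : T x ∉ B) (i : ℕ) :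
    interGap T B (i + 1) x = interGap T B (i + 1) (T x) := by
  unfold interGap
  rw [hitInstant_succ_of_notMem h, hitInstant_succ_of_notMem h, enat_one_add_sub_one_add]
  congr 1
  simp

theorem measurable_hitInstant [MeasurableSpace X] (hT : Measurable T) (hB : MeasurableSet B) (i : ℕ) :
    Measurable fun x => hitInstant T B x i := by
  classical
  induction i with
  | zero => exact measurable_const
  | succ i ih =>
    have : (fun x => hitInstant T B x (i + 1)) =
        fun x => ⨅ n : ℕ, if hitInstant T B x i < (n : ℕ∞) ∧ T^[n] x ∈ B then (n : ℕ∞) else ⊤ := by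
      ext1 x
      rw [hitInstant]
      apply le_antisymm
      · refine le_iInf fun n => ?_
        split_ifs with hn
        · exact sInf_le ⟨n, hn.1, hn.2, rfl⟩
        · exact le_top
      · refine le_sInf ?_
        rintro m ⟨n, h1, h2, rfl⟩
        refine (iInf_le _ n).trans ?_
        rw [if_pos ⟨h1, h2⟩]
    rw [this]
    have : BorelSpace ℕ∞ := ⟨borel_eq_top_of_countable.symm⟩
    refine Measurable.iInf fun n => Measurable.ite ?_ measurable_const measurable_const
    exact (measurableSet_lt ih measurable_const).inter (hT.iterate n hB)

theorem measurable_interGap [MeasurableSpace X] (hT : Measurable T) (hB : MeasurableSet B) (i : ℕ) :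
    Measurable (interGap T B i) := by
  classical
  unfold interGap
  refine Measurable.ite (measurable_hitInstant hT hB i (measurableSet_singleton _)) measurable_const ?_
  have h : Measurable fun p : ℕ∞ × ℕ∞ => ((p.1 - p.2 : ℕ∞) : ℝ≥0∞) := measurable_from_prod_countable_right
    fun _ => measurable_from_top
  exact h.comp ((measurable_hitInstant hT hB (i + 1)).prodMk (measurable_hitInstant hT hB i))

end HittingTimes

/-- The function `x ↦ exp (-x)` on `[0,∞]`, with value `0` at `∞`. -/
noncomputable def negExp (x : ℝ≥0∞) : ℝ := (EReal.exp (-(x : EReal))).toReal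

theorem negExp_aux_le (x : ℝ≥0∞) : EReal.exp (-(x : EReal)) ≤ 1 := by
  rw [EReal.exp_le_one_iff, EReal.neg_le, neg_zero]
  exact EReal.coe_ennreal_nonneg x

theorem negExp_aux_ne_top (x : ℝ≥0∞) : EReal.exp (-(x : EReal)) ≠ ⊤ :=
  ((negExp_aux_le x).trans_lt ENNReal.one_lt_top).ne

theorem negExp_nonneg (x : ℝ≥0∞) : 0 ≤ negExp x := ENNReal.toReal_nonneg

theorem negExp_le_one (x : ℝ≥0∞) : negExp x ≤ 1 :=
  ENNReal.toReal_le_of_le_ofReal zero_le_one (by simpa using negExp_aux_le x)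

theorem continuous_negExp : Continuous negExp := by
  have h : Continuous fun x : ℝ≥0∞ => EReal.exp (-(x : EReal)) :=
    ENNReal.continuous_exp.comp (continuous_neg.comp continuous_coe_ennreal_ereal)
  exact ENNReal.continuousOn_toReal.comp_continuous h negExp_aux_ne_top

theorem negExp_add (x y : ℝ≥0∞) : negExp (x + y) = negExp x * negExp y := by
  unfold negExp
  rw [← ENNReal.toReal_mul, ← EReal.exp_add, EReal.coe_ennreal_add, EReal.neg_add]
  · rfl
  · left; exact EReal.coe_ennreal_ne_bot x
  · right; exact EReal.coe_ennreal_ne_bot y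

theorem negExp_ofReal {x : ℝ} (hx : 0 ≤ x) : negExp (ENNReal.ofReal x) = Real.exp (-x) := by
  unfold negExp
  rw [EReal.coe_ennreal_ofReal, max_eq_left hx, ← EReal.coe_neg, EReal.exp_coe,
    ENNReal.toReal_ofReal (Real.exp_pos _).le]

theorem negExp_of_ne_top {x : ℝ≥0∞} (hx : x ≠ ⊤) : negExp x = Real.exp (-x.toReal) := by
  rw [← negExp_ofReal ENNReal.toReal_nonneg, ENNReal.ofReal_toReal hx]

theorem negExp_injective : Function.Injective negExp := by
  intro x y h
  unfold negExp at h
  have := (ENNReal.toReal_eq_toReal_iff' (negExp_aux_ne_top x) (negExp_aux_ne_top y)).1 h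
  have h2 := EReal.exp_strictMono.injective this
  simpa using h2

/-- Exponential monomials on `[0,∞]^ℕ`. -/
noncomputable def expMonomial (p : ℕ → ℕ) (m : ℕ) (y : ℕ → ℝ≥0∞) : ℝ :=
  ∏ i ∈ Finset.range m, negExp (y i) ^ p i

theorem continuous_expMonomial (p : ℕ → ℕ) (m : ℕ) : Continuous (expMonomial p m) :=
  continuous_finsetProd _ fun i _ => (continuous_negExp.comp (continuous_apply i)).pow _

theorem expMonomial_nonneg (p : ℕ → ℕ) (m : ℕ) (y : ℕ → ℝ≥0∞) : 0 ≤ expMonomial p m y :=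
  Finset.prod_nonneg fun _ _ => pow_nonneg (negExp_nonneg _) _

theorem expMonomial_le_one (p : ℕ → ℕ) (m : ℕ) (y : ℕ → ℝ≥0∞) : expMonomial p m y ≤ 1 :=
  Finset.prod_le_one (fun _ _ => pow_nonneg (negExp_nonneg _) _)
    fun _ _ => pow_le_one₀ (negExp_nonneg _) (negExp_le_one _)

theorem expMonomial_extend (p : ℕ → ℕ) {m m' : ℕ} (h : m ≤ m') :
    expMonomial p m = expMonomial (fun i => if i < m then p i else 0) m' := by
  funext y
  unfold expMonomial
  rw [← Finset.prod_subset (Finset.range_subset_range.2 h)]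
  · refine Finset.prod_congr rfl fun i hi => ?_
    simp only [if_pos (Finset.mem_range.1 hi)]
  · intro i _ hi
    have h' : ¬ i < m := by simpa using hi
    simp only [if_neg h', pow_zero]

theorem expMonomial_mul (p q : ℕ → ℕ) (m m' : ℕ) : ∃ p' m'', ∀ y,
    expMonomial p m y * expMonomial q m' y = expMonomial p' m'' y := by
  refine ⟨fun i => (if i < m then p i else 0) + (if i < m' then q i else 0), max m m', fun y => ?_⟩
  rw [expMonomial_extend p (le_max_left m m'), expMonomial_extend q (le_max_right m m')]
  simp only [expMonomial, pow_add, Finset.prod_mul_distrib]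

/-- Convergence in distribution in `[0,∞]^ℕ` follows from convergence of exponential moments. -/
theorem convInDist_of_expMonomial {X : Type*} [MeasurableSpace X] {P : ℕ → Measure X}
    [∀ n, IsProbabilityMeasure (P n)] {f : ℕ → X → (ℕ → ℝ≥0∞)} (hf : ∀ n, Measurable (f n))
    {ν : Measure (ℕ → ℝ≥0∞)} [IsProbabilityMeasure ν]
    (h : ∀ p m, Tendsto (fun n => ∫ x, expMonomial p m (f n x) ∂(P n)) atTop
      (𝓝 (∫ y, expMonomial p m y ∂ν))) : ConvInDist P f ν := by
  have hInt : ∀ (g : C(ℕ → ℝ≥0∞, ℝ)) n, Integrable (fun x => g (f n x)) (P n) := fun g n =>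
    Integrable.of_bound ((g.continuous.measurable.comp (hf n)).aestronglyMeasurable) ‖g‖
      (Eventually.of_forall fun x => g.norm_coe_le_norm _)
  have hintν : ∀ (g : C(ℕ → ℝ≥0∞, ℝ)), Integrable (fun x => g x) ν := fun g =>
    Integrable.of_bound (g.continuous.measurable.aestronglyMeasurable) ‖g‖
      (Eventually.of_forall fun x => g.norm_coe_le_norm _)
  let s : Set C(ℕ → ℝ≥0∞, ℝ) := range fun i : ℕ => ⟨fun y => negExp (y i), by
    exact continuous_negExp.comp (continuous_apply i)⟩
  have hclos : ∀ g ∈ Submonoid.closure s, ∃ p m, ∀ y, g y = expMonomial p m y := by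
    intro g hg
    induction hg using Submonoid.closure_induction with
    | mem x hx =>
      obtain ⟨i, rfl⟩ := hx
      refine ⟨fun j => if j = i then 1 else 0, i + 1, fun y => ?_⟩
      simp only [expMonomial]
      rw [Finset.prod_eq_single i]
      · simp
      · intro b _ hb; simp [hb]
      · simp
    | one => exact ⟨0, 0, fun y => by simp [expMonomial]⟩
    | mul x y _ _ hx hy =>
      obtain ⟨p, m, hp⟩ := hx
      obtain ⟨q, m', hq⟩ := hy
      obtain ⟨p', m'', h'⟩ := expMonomial_mul p q m m'
      exact ⟨p', m'', fun z => by rw [ContinuousMap.mul_apply, hp, hq, h']⟩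
  have hspan : ∀ g ∈ Algebra.adjoin ℝ s,
      Tendsto (fun n => ∫ x, g (f n x) ∂(P n)) atTop (𝓝 (∫ y, g y ∂ν)) := by
    intro g hg
    rw [← Subalgebra.mem_toSubmodule, Algebra.adjoin_eq_span] at hg
    induction hg using Submodule.span_induction with
    | mem x hx =>
      obtain ⟨p, m, hp⟩ := hclos x hx
      simp only [hp]
      exact h p m
    | zero => simp
    | add x y _ _ hx hy =>
      simp only [ContinuousMap.add_apply]
      rw [integral_add (hintν x) (hintν y)]
      refine (hx.add hy).congr fun n => ?_
      rw [integral_add (hInt x n) (hInt y n)]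
    | smul c x _ hx =>
      simp only [ContinuousMap.smul_apply, smul_eq_mul]
      rw [integral_const_mul]
      refine (hx.const_mul c).congr fun n => ?_
      rw [integral_const_mul]
  have hsep : (Algebra.adjoin ℝ s).SeparatesPoints := by
    intro x y hxy
    obtain ⟨i, hi⟩ := Function.ne_iff.1 hxy
    refine ⟨_, ⟨_, Algebra.subset_adjoin ⟨i, rfl⟩, rfl⟩, ?_⟩
    exact fun h => hi (negExp_injective h)
  intro g
  rw [Metric.tendsto_atTop]
  intro ε hε
  obtain ⟨⟨u, huA⟩, hu⟩ := ContinuousMap.exists_mem_subalgebra_near_continuousMap_of_separatesPoints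
    _ hsep g.toContinuousMap (ε / 3) (by positivity)
  obtain ⟨N, hN⟩ := Metric.tendsto_atTop.1 (hspan u huA) (ε / 3) (by positivity)
  refine ⟨N, fun n hn => ?_⟩
  have hpt : ∀ y, ‖g y - u y‖ ≤ ε / 3 := fun y => by
    have := (ContinuousMap.norm_coe_le_norm (u - g.toContinuousMap) y).trans hu.le
    rw [← norm_neg]
    simpa using this
  have h1 : ‖∫ x, g (f n x) ∂(P n) - ∫ x, u (f n x) ∂(P n)‖ ≤ ε / 3 := by
    have e := integral_sub (hInt g.toContinuousMap n) (hInt u n)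
    simp only [BoundedContinuousFunction.coe_toContinuousMap] at e
    rw [← e]
    simpa using norm_integral_le_of_norm_le_const (μ := P n)
      (f := fun x => g (f n x) - u (f n x)) (Eventually.of_forall fun x => hpt (f n x))
  have h2 : ‖∫ x, g x ∂ν - ∫ x, u x ∂ν‖ ≤ ε / 3 := by
    have e := integral_sub (hintν g.toContinuousMap) (hintν u)
    simp only [BoundedContinuousFunction.coe_toContinuousMap] at e
    rw [← e]
    simpa using norm_integral_le_of_norm_le_const (μ := ν)
      (f := fun x => g x - u x) (Eventually.of_forall fun x => hpt x)
  have h3 := hN n hn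
  rw [Real.dist_eq] at h3 ⊢
  rw [Real.norm_eq_abs] at h1 h2
  rw [abs_lt] at *
  rw [abs_le] at *
  constructor <;> linarith

theorem integral_negExp_pow_expLawENN (k : ℕ) :
    ∫ x, negExp x ^ k ∂(expLawENN 1) = 1 / (1 + k) := by
  unfold expLawENN expMeasure gammaMeasure
  rw [integral_map (f := fun x => negExp x ^ k) (by fun_prop) ((continuous_negExp.pow k).aestronglyMeasurable),
    integral_withDensity_eq_integral_toReal_smul]
  · have : ∀ x : ℝ, (gammaPDF 1 1 x).toReal • negExp (ENNReal.ofReal x) ^ k =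
        (Ici (0 : ℝ)).indicator (fun x => Real.exp (-(1 + k) * x)) x := by
      intro x
      have h1 : gammaPDF 1 1 x = exponentialPDF 1 x := rfl
      rw [h1, exponentialPDF_eq]
      by_cases hx : 0 ≤ x
      · rw [if_pos hx, negExp_ofReal hx, indicator_of_mem (mem_Ici.2 hx),
          ENNReal.toReal_ofReal (by positivity), smul_eq_mul, ← Real.exp_nat_mul, one_mul,
          ← Real.exp_add]
        congr 1; ring
      · rw [if_neg hx, indicator_of_notMem (by simpa using hx)]; simp
    simp only [this]
    rw [integral_indicator measurableSet_Ici, integral_Ici_eq_integral_Ioi,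
      integral_exp_mul_Ioi (neg_lt_zero.2 (by positivity : 0 < 1 + (k : ℝ))) 0]
    rw [mul_zero, Real.exp_zero, neg_div_neg_eq]
  · exact (measurable_gammaPDFReal 1 1).ennreal_ofReal
  · exact Eventually.of_forall fun x => ENNReal.ofReal_lt_top

theorem integral_expMonomial_isNuTheta {ν : Measure (ℕ → ℝ≥0∞)} (hν : IsNuTheta 1 ν)
    (p : ℕ → ℕ) (m : ℕ) :
    ∫ y, expMonomial p m y ∂ν = ∏ i ∈ Finset.range m, (1 / (1 + (p i : ℝ))) := by
  have hlaw : ∀ i, coordLaw 1 i = expLawENN 1 := by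
    intro i
    unfold coordLaw
    split_ifs <;> simp
  have : IsProbabilityMeasure (expMeasure 1) := isProbabilityMeasure_expMeasure one_pos
  have : IsProbabilityMeasure (expLawENN 1) := Measure.isProbabilityMeasure_map (by fun_prop)
  have h := hν.2 m
  simp only [hlaw] at h
  have h2 : ∫ y, expMonomial p m y ∂ν = ∫ z, ∏ i : Fin m, negExp (z i) ^ p i
      ∂(ν.map (fun ω : ℕ → ℝ≥0∞ => fun i : Fin m => ω (i : ℕ))) := by
    rw [integral_map (by exact (measurable_pi_lambda _ fun i => measurable_pi_apply _).aemeasurable)]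
    · simp only [expMonomial, Finset.prod_range]
    · refine Continuous.aestronglyMeasurable ?_
      exact continuous_finsetProd _ fun i _ => (continuous_negExp.comp (continuous_apply i)).pow _
  rw [h2, h, integral_fintype_prod_eq_prod (fun (i : Fin m) (x : ℝ≥0∞) => negExp x ^ p i)]
  simp only [integral_negExp_pow_expLawENN, Finset.prod_range]

section AbstractPoisson

variable {X : Type*} {T : X → X} {B : Set X}

theorem measurable_rescaledProcess [MeasurableSpace X] (hT : Measurable T) (hB : MeasurableSet B)
    (c : ℝ≥0∞) : Measurable (rescaledProcess T B c) :=
  measurable_pi_lambda _ fun i => (measurable_interGap hT hB i).const_mul c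

theorem expMonomial_rescaled_of_notMem (c : ℝ≥0∞) (p : ℕ → ℕ) (m : ℕ) {x : X} (h : T x ∉ B) :
    expMonomial p (m + 1) (rescaledProcess T B c x) =
      negExp c ^ p 0 * expMonomial p (m + 1) (rescaledProcess T B c (T x)) := by
  simp only [expMonomial, rescaledProcess, Finset.prod_range_succ', interGap_zero_of_notMem h,
    interGap_succ_of_notMem h, mul_add, negExp_add, mul_pow, mul_one]
  ring

theorem expMonomial_rescaled_of_mem (c : ℝ≥0∞) (p : ℕ → ℕ) (m : ℕ) {x : X} (h : T x ∈ B) :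
    expMonomial p (m + 1) (rescaledProcess T B c x) =
      negExp c ^ p 0 * expMonomial (fun i => p (i + 1)) m (rescaledProcess T B c (T x)) := by
  simp only [expMonomial, rescaledProcess, Finset.prod_range_succ', interGap_zero_of_mem h,
    interGap_succ_of_mem h, mul_one]
  ring

theorem expMonomial_rescaled_iterate (c : ℝ≥0∞) (p : ℕ → ℕ) (m k : ℕ) {x : X}
    (h : ∀ j, 1 ≤ j → j ≤ k → T^[j] x ∉ B) :
    expMonomial p (m + 1) (rescaledProcess T B c x) =
      negExp c ^ (p 0 * k) * expMonomial p (m + 1) (rescaledProcess T B c (T^[k] x)) := by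
  induction k with
  | zero => simp
  | succ k ih =>
    rw [ih fun j h1 h2 => h j h1 (h2.trans k.le_succ), expMonomial_rescaled_of_notMem, mul_add,
      pow_add, Function.iterate_succ_apply', mul_one]
    · ring
    · rw [← Function.iterate_succ_apply' T]
      exact h (k + 1) (by omega) le_rfl

variable [MeasurableSpace X] {μ : Measure X} [IsProbabilityMeasure μ]

theorem integrable_of_abs_le_one {κ : Measure X} [IsFiniteMeasure κ] {f : X → ℝ} (hf : Measurable f)
    {C : ℝ} (h : ∀ x, |f x| ≤ C) : Integrable f κ :=
  Integrable.of_bound hf.aestronglyMeasurable C (Eventually.of_forall h)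

theorem measurable_expMonomial_rescaled (hT : Measurable T) (hB : MeasurableSet B) (c : ℝ≥0∞)
    (p : ℕ → ℕ) (m : ℕ) : Measurable fun x => expMonomial p m (rescaledProcess T B c x) :=
  (continuous_expMonomial p m).measurable.comp (measurable_rescaledProcess hT hB c)

theorem abs_expMonomial_le (p : ℕ → ℕ) (m : ℕ) (y) : |expMonomial p m y| ≤ 1 := by
  rw [abs_of_nonneg (expMonomial_nonneg _ _ _)]
  exact expMonomial_le_one _ _ _

/-- Kac-type recursion for exponential moments of the interarrival process. -/
theorem integral_expMonomial_recursion (hT : MeasurePreserving T μ μ) (hB : MeasurableSet B)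
    (c : ℝ≥0∞) (p : ℕ → ℕ) (m : ℕ) :
    (1 - negExp c ^ p 0) * ∫ x, expMonomial p (m + 1) (rescaledProcess T B c x) ∂μ =
      negExp c ^ p 0 * (∫ x in B, expMonomial (fun i => p (i + 1)) m (rescaledProcess T B c x) ∂μ -
        ∫ x in B, expMonomial p (m + 1) (rescaledProcess T B c x) ∂μ) := by
  set H := fun x => expMonomial p (m + 1) (rescaledProcess T B c x) with hH
  set H' := fun x => expMonomial (fun i => p (i + 1)) m (rescaledProcess T B c x) with hH'
  have mH : Measurable H := measurable_expMonomial_rescaled hT.measurable hB c p (m + 1)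
  have mH' : Measurable H' := measurable_expMonomial_rescaled hT.measurable hB c _ m
  have iH : ∀ κ : Measure X, IsFiniteMeasure κ → Integrable H κ := fun κ _ =>
    integrable_of_abs_le_one mH fun x => abs_expMonomial_le _ _ _
  have iH' : ∀ κ : Measure X, IsFiniteMeasure κ → Integrable H' κ := fun κ _ =>
    integrable_of_abs_le_one mH' fun x => abs_expMonomial_le _ _ _
  set G : X → ℝ := fun x => H x + B.indicator (fun x => H' x - H x) x with hG
  have e1 : ∀ x, H x = negExp c ^ p 0 * G (T x) := by
    intro x
    by_cases h : T x ∈ B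
    · simp only [hG, indicator_of_mem h, hH]
      rw [expMonomial_rescaled_of_mem c p m h]
      simp [hH']
    · simp only [hG, indicator_of_notMem h, hH]
      rw [expMonomial_rescaled_of_notMem c p m h]
      simp
  have mG : Measurable G := mH.add ((mH'.sub mH).indicator hB)
  have e2 : ∫ x, H x ∂μ = negExp c ^ p 0 * ∫ x, G x ∂μ := by
    rw [integral_congr_ae (Eventually.of_forall e1), integral_const_mul]
    congr 1
    conv_rhs => rw [← hT.map_eq]
    rw [integral_map hT.measurable.aemeasurable mG.aestronglyMeasurable]
  have e3 : ∫ x, G x ∂μ = ∫ x, H x ∂μ + (∫ x in B, H' x ∂μ - ∫ x in B, H x ∂μ) := by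
    have h1 : Integrable (B.indicator fun x => H' x - H x) μ :=
      ((iH' μ inferInstance).sub (iH μ inferInstance)).indicator hB
    simp only [hG]
    rw [integral_add (iH μ inferInstance) h1, integral_indicator hB, integral_sub (iH' _ inferInstance) (iH _ inferInstance)]
  rw [sub_mul, one_mul]
  nth_rewrite 1 [e2]
  rw [e3]; ring

theorem convInDist_of_conditional (hT : MeasurePreserving T μ μ) {B : ℕ → Set X}
    (hB : ∀ n, MeasurableSet (B n)) (hpos : ∀ᶠ n in atTop, 0 < μ.real (B n))
    (h0 : Tendsto (fun n => μ.real (B n)) atTop (𝓝 0))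
    (hmix : ∀ p m, Tendsto (fun n =>
      (∫ x in B n, expMonomial p (m + 1) (rescaledProcess T (B n) (μ (B n)) x) ∂μ) / μ.real (B n) -
        ∫ x, expMonomial p (m + 1) (rescaledProcess T (B n) (μ (B n)) x) ∂μ) atTop (𝓝 0))
    {ν : Measure (ℕ → ℝ≥0∞)} (hν : IsNuTheta 1 ν) :
    ConvInDist (fun _ => μ) (fun n x => rescaledProcess T (B n) (μ (B n)) x) ν := by
  have := hν.1
  refine convInDist_of_expMonomial (fun n => measurable_rescaledProcess hT.measurable (hB n) _) ?_
  intro p m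
  rw [integral_expMonomial_isNuTheta hν]
  induction m generalizing p with
  | zero => simp [expMonomial]
  | succ m ih =>
    set c : ℕ → ℝ := fun n => μ.real (B n) with hc
    have hneg : ∀ n, negExp (μ (B n)) ^ p 0 = Real.exp (-(p 0 * c n)) := fun n => by
      rw [negExp_of_ne_top (measure_ne_top _ _), ← Real.exp_nat_mul]
      simp [hc, Measure.real]
    have hq1 : Tendsto (fun n => negExp (μ (B n)) ^ p 0) atTop (𝓝 1) := by
      simp only [hneg]
      have : Tendsto (fun n => Real.exp (-(p 0 * c n))) atTop (𝓝 (Real.exp (-(p 0 * 0)))) :=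
        (Real.continuous_exp.tendsto _).comp ((h0.const_mul _).neg)
      simpa using this
    have hq2 : Tendsto (fun n => (1 - negExp (μ (B n)) ^ p 0) / c n) atTop (𝓝 (p 0)) := by
      simp only [hneg]
      have hd : HasDerivAt (fun t : ℝ => Real.exp (-(p 0 * t))) (-(p 0 : ℝ)) 0 := by
        have := ((hasDerivAt_id (0 : ℝ)).const_mul (p 0 : ℝ)).neg.exp
        simpa using this
      have h1 := hd.tendsto_slope
      have h2 : Tendsto c atTop (𝓝[≠] 0) :=
        tendsto_nhdsWithin_iff.2 ⟨h0, hpos.mono fun n hn => hn.ne'⟩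
      have h3 := (h1.comp h2).neg
      rw [neg_neg] at h3
      refine h3.congr fun n => ?_
      simp only [Function.comp, slope_def_field, sub_zero, mul_zero, neg_zero, Real.exp_zero]
      rw [← neg_div, neg_sub]
    have hm' : Tendsto (fun n =>
      (∫ x in B n, expMonomial (fun i => p (i+1)) m (rescaledProcess T (B n) (μ (B n)) x) ∂μ) / c n)
        atTop (𝓝 (∏ i ∈ Finset.range m, (1 / (1 + (p (i + 1) : ℝ))))) := by
      rcases m with _ | m
      · simp only [expMonomial, Finset.range_zero, Finset.prod_empty, integral_const, smul_eq_mul,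
          mul_one]
        refine tendsto_const_nhds.congr' ?_
        filter_upwards [hpos] with n hn
        simp [hc, hn.ne']
      · have := (hmix (fun i => p (i + 1)) m).add (ih (fun i => p (i + 1)))
        simpa using this
    set a : ℕ → ℝ := fun n => ∫ x, expMonomial p (m + 1) (rescaledProcess T (B n) (μ (B n)) x) ∂μ
      with ha
    set d : ℕ → ℝ := fun n => (∫ x in B n, expMonomial p (m + 1)
      (rescaledProcess T (B n) (μ (B n)) x) ∂μ) / c n with hd
    set d' : ℕ → ℝ := fun n => (∫ x in B n, expMonomial (fun i => p (i+1)) m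
      (rescaledProcess T (B n) (μ (B n)) x) ∂μ) / c n with hd'
    set q : ℕ → ℝ := fun n => negExp (μ (B n)) ^ p 0
    set s : ℕ → ℝ := fun n => (1 - q n) / c n
    have hrel : ∀ᶠ n in atTop, s n * a n = q n * (d' n - d n) := by
      filter_upwards [hpos] with n hn
      have := integral_expMonomial_recursion hT (hB n) (μ (B n)) p m
      simp only [s, hd', hd, ← sub_div, ha, q]
      rw [div_mul_eq_mul_div, this, mul_div_assoc]
    have hda : Tendsto (fun n => d n - a n) atTop (𝓝 0) := hmix p m
    have hden : Tendsto (fun n => s n + q n) atTop (𝓝 (p 0 + 1)) := hq2.add hq1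
    have hp0 : (0 : ℝ) < p 0 + 1 := by positivity
    have hnum : Tendsto (fun n => q n * (d' n - (d n - a n))) atTop
        (𝓝 (1 * (∏ i ∈ Finset.range m, (1 / (1 + (p (i + 1) : ℝ))) - 0))) := hq1.mul (hm'.sub hda)
    have := hnum.div hden hp0.ne'
    have hval : (1 * (∏ i ∈ Finset.range m, (1 / (1 + (p (i + 1) : ℝ))) - 0)) / ((p 0 : ℝ) + 1) =
        ∏ i ∈ Finset.range (m + 1), (1 / (1 + (p i : ℝ))) := by
      rw [Finset.prod_range_succ', one_mul, sub_zero, add_comm (p 0 : ℝ), mul_one_div]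
    rw [← hval]
    refine this.congr' ?_
    filter_upwards [hrel, hden.eventually (lt_mem_nhds hp0)] with n hn hn'
    rw [Pi.div_apply, div_eq_iff hn'.ne']
    linear_combination -hn

/-- Poisson limit for interarrival processes from absence of short returns and asymptotic
decorrelation of the laws `(T^{k n})_* μ(· | B n)` from almost invariant functions. -/
theorem convInDist_of_decorrelation (hT : MeasurePreserving T μ μ) {B : ℕ → Set X}
    (hB : ∀ n, MeasurableSet (B n)) (hpos : ∀ᶠ n in atTop, 0 < μ.real (B n))
    (k : ℕ → ℕ) (h0 : Tendsto (fun n => μ.real (B n)) atTop (𝓝 0))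
    (hk : Tendsto (fun n => k n * μ.real (B n)) atTop (𝓝 0))
    (hret : Tendsto (fun n =>
      μ.real (B n ∩ {x | ∃ j, 1 ≤ j ∧ j ≤ k n ∧ T^[j] x ∈ B n}) / μ.real (B n)) atTop (𝓝 0))
    (hdec : ∀ R : ℕ → X → ℝ, (∀ n, Measurable (R n)) → (∀ n x, |R n x| ≤ 1) →
      Tendsto (fun n => ∫ x, |R n (T x) - R n x| ∂μ) atTop (𝓝 0) →
      Tendsto (fun n => (∫ x in B n, R n (T^[k n] x) ∂μ) / μ.real (B n) - ∫ x, R n x ∂μ)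
        atTop (𝓝 0))
    {ν : Measure (ℕ → ℝ≥0∞)} (hν : IsNuTheta 1 ν) :
    ConvInDist (fun _ => μ) (fun n x => rescaledProcess T (B n) (μ (B n)) x) ν := by
  refine convInDist_of_conditional hT hB hpos h0 ?_ hν
  intro p m
  set c : ℕ → ℝ := fun n => μ.real (B n) with hc
  set R : ℕ → X → ℝ := fun n x => expMonomial p (m + 1) (rescaledProcess T (B n) (μ (B n)) x) with hR
  have mR : ∀ n, Measurable (R n) := fun n =>
    measurable_expMonomial_rescaled hT.measurable (hB n) _ p (m + 1)
  have bR : ∀ n x, |R n x| ≤ 1 := fun n x => abs_expMonomial_le _ _ _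
  have nR : ∀ n x, 0 ≤ R n x := fun n x => expMonomial_nonneg _ _ _
  have bR' : ∀ n x, R n x ≤ 1 := fun n x => expMonomial_le_one _ _ _
  have iR : ∀ n, ∀ κ : Measure X, IsFiniteMeasure κ → Integrable (R n) κ := fun n κ _ =>
    integrable_of_abs_le_one (mR n) (bR n)
  have hneg : ∀ n (j : ℕ), negExp (μ (B n)) ^ j = Real.exp (-(j * c n)) := fun n j => by
    rw [negExp_of_ne_top (measure_ne_top _ _), ← Real.exp_nat_mul]
    simp [hc, Measure.real]
  have qle : ∀ n j, negExp (μ (B n)) ^ j ≤ 1 := fun n j => pow_le_one₀ (negExp_nonneg _) (negExp_le_one _)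
  have q0 : ∀ n j, 0 ≤ negExp (μ (B n)) ^ j := fun n j => pow_nonneg (negExp_nonneg _) _
  have hinv : Tendsto (fun n => ∫ x, |R n (T x) - R n x| ∂μ) atTop (𝓝 0) := by
    have hb : ∀ n, ∫ x, |R n (T x) - R n x| ∂μ ≤ c n + (1 - Real.exp (-(p 0 * c n))) := by
      intro n
      have hpt : ∀ x, |R n (T x) - R n x| ≤
          (T ⁻¹' B n).indicator (fun _ => (1 : ℝ)) x + (1 - Real.exp (-(p 0 * c n))) := by
        intro x
        have hq := qle n (p 0)
        rw [hneg] at hq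
        by_cases h : T x ∈ B n
        · rw [indicator_of_mem (by exact h)]
          have := nR n (T x); have := nR n x; have := bR' n x; have := bR' n (T x)
          rw [abs_le]; constructor <;> linarith
        · rw [indicator_of_notMem (by exact h)]
          have e := expMonomial_rescaled_of_notMem (μ (B n)) p m h
          have e' : R n x = Real.exp (-(p 0 * c n)) * R n (T x) := by rw [← hneg]; exact e
          rw [e', abs_of_nonneg]
          · nlinarith [nR n (T x), bR' n (T x)]
          · nlinarith [nR n (T x), bR' n (T x)]
      have mi : MeasurableSet (T ⁻¹' B n) := hT.measurable (hB n)
      calc ∫ x, |R n (T x) - R n x| ∂μ ≤ ∫ x, ((T ⁻¹' B n).indicator (fun _ => (1 : ℝ)) x +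
            (1 - Real.exp (-(p 0 * c n)))) ∂μ := by
            refine integral_mono ?_ ?_ hpt
            · refine integrable_of_abs_le_one (C := 2)
                (((mR n).comp hT.measurable).sub (mR n)).abs fun x => ?_
              rw [abs_abs]
              have := nR n (T x); have := nR n x; have := bR' n x; have := bR' n (T x)
              rw [abs_le]; constructor <;> linarith
            · exact ((integrable_const _).indicator mi).add (integrable_const _)
        _ = c n + (1 - Real.exp (-(p 0 * c n))) := by
            rw [integral_add ((integrable_const _).indicator mi) (integrable_const _),
              integral_indicator mi]
            simp [hc, Measure.real, hT.measure_preimage (hB n).nullMeasurableSet]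
    have hl : Tendsto (fun n => c n + (1 - Real.exp (-(p 0 * c n)))) atTop
        (𝓝 (0 + (1 - Real.exp (-(p 0 * 0))))) :=
      h0.add (tendsto_const_nhds.sub ((Real.continuous_exp.tendsto _).comp ((h0.const_mul _).neg)))
    refine squeeze_zero (fun n => integral_nonneg fun x => abs_nonneg _) hb ?_
    simpa using hl
  have hd := hdec R mR bR hinv
  -- difference between `R` and `R ∘ T^k` on `B`
  have hdiff : Tendsto (fun n => (∫ x in B n, R n x ∂μ) / c n - (∫ x in B n, R n (T^[k n] x) ∂μ) / c n)
      atTop (𝓝 0) := by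
    have hb : ∀ᶠ n in atTop, |(∫ x in B n, R n x ∂μ) / c n - (∫ x in B n, R n (T^[k n] x) ∂μ) / c n| ≤
        μ.real (B n ∩ {x | ∃ j, 1 ≤ j ∧ j ≤ k n ∧ T^[j] x ∈ B n}) / c n +
          (1 - Real.exp (-(p 0 * (k n * c n)))) := by
      filter_upwards [hpos] with n hn
      set S := {x | ∃ j, 1 ≤ j ∧ j ≤ k n ∧ T^[j] x ∈ B n} with hS
      have mS : MeasurableSet S := by
        have : S = ⋃ j, ⋃ (_ : 1 ≤ j), ⋃ (_ : j ≤ k n), T^[j] ⁻¹' B n := by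
          ext x; simp only [hS, mem_ofPred_eq, mem_iUnion, mem_preimage, exists_prop]
        rw [this]
        exact MeasurableSet.iUnion fun j => MeasurableSet.iUnion fun _ => MeasurableSet.iUnion fun _ =>
          (hT.measurable.iterate j) (hB n)
      set q := Real.exp (-(p 0 * (k n * c n))) with hq
      have hq1 : q ≤ 1 := by
        have := qle n (p 0 * k n); rw [hneg] at this; push_cast at this; rwa [mul_assoc] at this
      have hpt : ∀ x, |R n x - R n (T^[k n] x)| ≤ S.indicator (fun _ => (1 : ℝ)) x + (1 - q) := by
        intro x
        by_cases h : x ∈ S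
        · rw [indicator_of_mem h]
          have := nR n (T^[k n] x); have := nR n x; have := bR' n x; have := bR' n (T^[k n] x)
          rw [abs_le]; constructor <;> linarith
        · rw [indicator_of_notMem h]
          have e := expMonomial_rescaled_iterate (T := T) (B := B n) (μ (B n)) p m (k n) (x := x)
            fun j h1 h2 h3 => h ⟨j, h1, h2, h3⟩
          have e' : R n x = q * R n (T^[k n] x) := by
            rw [hq, ← mul_assoc, ← Nat.cast_mul, ← hneg]; exact e
          have hq0 : 0 < q := Real.exp_pos _
          rw [e', abs_sub_comm, abs_of_nonneg]
          · nlinarith [nR n (T^[k n] x), bR' n (T^[k n] x)]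
          · nlinarith [nR n (T^[k n] x), bR' n (T^[k n] x)]
      have iRk : Integrable (fun x => R n (T^[k n] x)) (μ.restrict (B n)) :=
        integrable_of_abs_le_one ((mR n).comp (hT.measurable.iterate _)) fun x => bR n _
      rw [← sub_div, abs_div, abs_of_pos (show 0 < c n from hn), div_le_iff₀ hn, add_mul,
        div_mul_cancel₀ _ (show c n ≠ 0 from hn.ne'), ← integral_sub (iR n _ inferInstance) iRk]
      calc |∫ x in B n, (R n x - R n (T^[k n] x)) ∂μ| ≤ ∫ x in B n, |R n x - R n (T^[k n] x)| ∂μ :=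
            abs_integral_le_integral_abs
        _ ≤ ∫ x in B n, (S.indicator (fun _ => (1 : ℝ)) x + (1 - q)) ∂μ := by
            refine integral_mono ?_ ?_ hpt
            · exact ((iR n _ inferInstance).sub iRk).abs
            · exact ((integrable_const _).indicator mS).add (integrable_const _)
        _ = _ := by
            rw [integral_add ((integrable_const _).indicator mS) (integrable_const _),
              integral_indicator mS]
            simp [Measure.real, Measure.restrict_apply mS, inter_comm S, mul_comm]
    have hl : Tendsto (fun n => μ.real (B n ∩ {x | ∃ j, 1 ≤ j ∧ j ≤ k n ∧ T^[j] x ∈ B n}) / c n +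
          (1 - Real.exp (-(p 0 * (k n * c n))))) atTop (𝓝 (0 + (1 - Real.exp (-(p 0 * 0))))) :=
      hret.add (tendsto_const_nhds.sub ((Real.continuous_exp.tendsto _).comp ((hk.const_mul _).neg)))
    refine squeeze_zero_norm' hb ?_
    simpa using hl
  have := hdiff.add hd
  rw [add_zero] at this
  exact this.congr fun n => sub_add_sub_cancel _ _ _

end AbstractPoisson

section AlmostInvariant

theorem tendsto_inner_sub_proj_of_almost_invariant {E : Type*} [NormedAddCommGroup E]
    [InnerProductSpace ℝ E] [CompleteSpace E] (U : E →ₗᵢ[ℝ] E) (ρ : ℕ → E) {C : ℝ}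
    (hρ : ∀ n, ‖ρ n‖ ≤ C) (hinv : Tendsto (fun n => U (ρ n) - ρ n) atTop (𝓝 0)) (u : E) :
    Tendsto (fun n => inner ℝ (ρ n) (u - ((U.toContinuousLinearMap.eqLocus
      (1 : E →L[ℝ] E)).orthogonalProjectionOnto u : E))) atTop (𝓝 0) := by
  set Pu := ((U.toContinuousLinearMap.eqLocus (1 : E →L[ℝ] E)).orthogonalProjectionOnto u : E)
  have hit : ∀ j : ℕ, Tendsto (fun n => inner ℝ (ρ n) (u - U^[j] u)) atTop (𝓝 0) := by
    intro j
    induction j with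
    | zero => simp
    | succ j ih =>
      have h1 : ∀ n, inner ℝ (ρ n) (u - U^[j + 1] u) = inner ℝ (ρ n) (u - U^[j] u) +
          inner ℝ (U (ρ n) - ρ n) (U^[j + 1] u) := by
        intro n
        rw [inner_sub_left, Function.iterate_succ_apply', U.inner_map_map, inner_sub_right,
          inner_sub_right]
        ring
      simp only [h1]
      have := ih.add (hinv.inner (tendsto_const_nhds (x := U^[j + 1] u)))
      simpa using this
  have havg : ∀ N : ℕ, 0 < N → Tendsto (fun n => inner ℝ (ρ n)
      (u - birkhoffAverage ℝ U.toContinuousLinearMap _root_.id N u)) atTop (𝓝 0) := by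
    intro N hN
    have h1 : u - birkhoffAverage ℝ U.toContinuousLinearMap _root_.id N u =
        (N : ℝ)⁻¹ • ∑ j ∈ Finset.range N, (u - U^[j] u) := by
      rw [Finset.sum_sub_distrib, smul_sub, Finset.sum_const, Finset.card_range,
        ← Nat.cast_smul_eq_nsmul ℝ, smul_smul, inv_mul_cancel₀ (by positivity), one_smul]
      rfl
    rw [h1]
    simp only [inner_smul_right, inner_sum]
    have := (tendsto_finsetSum (Finset.range N) fun j _ => hit j).const_mul ((N : ℝ)⁻¹)
    simpa using this
  have hvN := U.toContinuousLinearMap.tendsto_birkhoffAverage_orthogonalProjection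
    U.norm_toContinuousLinearMap_le u
  rw [Metric.tendsto_atTop]
  intro ε hε
  have hC : 0 ≤ C := (norm_nonneg _).trans (hρ 0)
  have h2 := (Metric.tendsto_atTop.1 hvN) (ε / 2 / (C + 1)) (by positivity)
  obtain ⟨N0, hN0⟩ := h2
  set N := max N0 1
  have h3 := hN0 N (le_max_left _ _)
  obtain ⟨n0, hn0⟩ := Metric.tendsto_atTop.1 (havg N (lt_of_lt_of_le one_pos (le_max_right _ _))) (ε / 2) (by positivity)
  refine ⟨n0, fun n hn => ?_⟩
  have h4 := hn0 n hn
  rw [dist_zero_right] at h4 ⊢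
  set A := birkhoffAverage ℝ U.toContinuousLinearMap _root_.id N u
  have h5 : inner ℝ (ρ n) (u - Pu) = inner ℝ (ρ n) (u - A) + inner ℝ (ρ n) (A - Pu) := by
    rw [← inner_add_right]; congr 1; abel
  have h6 : ‖inner ℝ (ρ n) (A - Pu)‖ ≤ ε / 2 := by
    refine (norm_inner_le_norm _ _).trans ?_
    rw [dist_eq_norm] at h3
    calc ‖ρ n‖ * ‖A - Pu‖ ≤ (C + 1) * (ε / 2 / (C + 1)) := by
          gcongr
          · linarith [hρ n]
      _ = ε / 2 := by field_simp
  rw [h5]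
  calc _ ≤ ‖inner ℝ (ρ n) (u - A)‖ + ‖inner ℝ (ρ n) (A - Pu)‖ := norm_add_le _ _
    _ < ε := by linarith

variable {X : Type*} [MeasurableSpace X] {μ : Measure X} [IsProbabilityMeasure μ] {T : X → X}

theorem tendsto_setIntegral_of_almost_invariant (hT : Ergodic T μ) (R : ℕ → X → ℝ)
    (mR : ∀ n, Measurable (R n)) {C : ℝ} (bR : ∀ n x, |R n x| ≤ C)
    (hinv : Tendsto (fun n => ∫ x, |R n (T x) - R n x| ∂μ) atTop (𝓝 0))
    {s : Set X} (hs : MeasurableSet s) :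
    Tendsto (fun n => ∫ x in s, R n x ∂μ - μ.real s * ∫ x, R n x ∂μ) atTop (𝓝 0) := by
  have hC : 0 ≤ C := by
    obtain ⟨x⟩ : Nonempty X := by
      by_contra h
      rw [not_nonempty_iff] at h
      have : μ univ = 0 := by simp [Set.eq_empty_of_isEmpty]
      simp at this
    exact (abs_nonneg _).trans (bR 0 x)
  have mLp : ∀ n, MemLp (R n) 2 μ := fun n =>
    MemLp.of_bound (mR n).aestronglyMeasurable C (Eventually.of_forall (bR n))
  set ρ : ℕ → Lp ℝ 2 μ := fun n => (mLp n).toLp (R n) with hρ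
  set U : Lp ℝ 2 μ →ₗᵢ[ℝ] Lp ℝ 2 μ := Lp.compMeasurePreservingₗᵢ ℝ T hT.toMeasurePreserving with hU
  have hnorm : ∀ n, ‖ρ n‖ ≤ C := by
    intro n
    refine (Lp.norm_le_of_ae_bound hC ((mLp n).coeFn_toLp.mono fun x hx => ?_)).trans ?_
    · rw [hx]; exact bR n x
    · have : measureUnivNNReal μ = 1 := by simp [measureUnivNNReal]
      simp [this]
  have hUρ : ∀ n, U (ρ n) =ᵐ[μ] fun x => R n (T x) := fun n => by
    have h1 : U (ρ n) =ᵐ[μ] ρ n ∘ T := Lp.coeFn_compMeasurePreserving (ρ n) hT.toMeasurePreserving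
    have h2 := hT.toMeasurePreserving.quasiMeasurePreserving.ae_eq_comp (mLp n).coeFn_toLp
    exact h1.trans h2
  have hinv2 : Tendsto (fun n => U (ρ n) - ρ n) atTop (𝓝 0) := by
    rw [tendsto_zero_iff_norm_tendsto_zero]
    have hb : ∀ n, ‖U (ρ n) - ρ n‖ ^ 2 ≤ 2 * C * ∫ x, |R n (T x) - R n x| ∂μ := by
      intro n
      rw [← real_inner_self_eq_norm_sq, L2.inner_def, ← integral_const_mul]
      have hae : (fun x => inner ℝ ((U (ρ n) - ρ n : Lp ℝ 2 μ) x) ((U (ρ n) - ρ n : Lp ℝ 2 μ) x))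
          =ᵐ[μ] fun x => (R n (T x) - R n x) ^ 2 := by
        filter_upwards [Lp.coeFn_sub (U (ρ n)) (ρ n), hUρ n, (mLp n).coeFn_toLp] with x h1 h2 h3
        rw [h1, Pi.sub_apply, h2, h3]
        simp [sq]
      have hd : ∀ x, |R n (T x) - R n x| ≤ 2 * C := fun x => by
        have h1 := abs_le.1 (bR n x); have h2 := abs_le.1 (bR n (T x))
        rw [abs_le]; constructor <;> linarith
      have hm : Measurable fun x => R n (T x) - R n x := ((mR n).comp hT.measurable).sub (mR n)
      rw [integral_congr_ae hae]
      refine integral_mono ?_ ?_ fun x => ?_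
      · refine integrable_of_abs_le_one (C := (2 * C) ^ 2) (hm.pow_const 2) fun x => ?_
        rw [abs_pow]
        exact pow_le_pow_left₀ (abs_nonneg _) (hd x) 2
      · exact ((integrable_of_abs_le_one hm hd).abs).const_mul _
      · simp only
        rw [← sq_abs, sq]
        exact mul_le_mul_of_nonneg_right (hd x) (abs_nonneg _)
    have h2 : Tendsto (fun n => ‖U (ρ n) - ρ n‖ ^ 2) atTop (𝓝 0) := by
      refine squeeze_zero (fun n => by positivity) hb ?_
      simpa using hinv.const_mul (2 * C)
    have h3 := (Real.continuous_sqrt.tendsto 0).comp h2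
    simpa [Function.comp_def, Real.sqrt_sq (norm_nonneg _)] using h3
  set u : Lp ℝ 2 μ := indicatorConstLp 2 hs (measure_ne_top μ s) (1 : ℝ) with hu
  have key := tendsto_inner_sub_proj_of_almost_invariant U ρ hnorm hinv2 u
  set Pm := U.toContinuousLinearMap.eqLocus (1 : Lp ℝ 2 μ →L[ℝ] Lp ℝ 2 μ) with hPm
  set Pu : Lp ℝ 2 μ := (Pm.orthogonalProjectionOnto u : Lp ℝ 2 μ) with hPu
  have hfix : U Pu = Pu := (Pm.orthogonalProjectionOnto u).2
  obtain ⟨c, hc⟩ : ∃ c : ℝ, Pu =ᵐ[μ] fun _ => c := by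
    have h1 : U Pu =ᵐ[μ] Pu ∘ T := Lp.coeFn_compMeasurePreserving Pu hT.toMeasurePreserving
    rw [hfix] at h1
    exact hT.ae_eq_const_of_ae_eq_comp_ae (Lp.aestronglyMeasurable Pu) h1.symm
  set one : Lp ℝ 2 μ := indicatorConstLp 2 MeasurableSet.univ (measure_ne_top μ univ) (1 : ℝ)
  have hone : U one = one := by
    have : U one = indicatorConstLp 2 (hT.measurable MeasurableSet.univ)
        (measure_ne_top μ _) (1 : ℝ) :=
      Lp.indicatorConstLp_compMeasurePreserving MeasurableSet.univ (measure_ne_top μ _) (1 : ℝ)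
        hT.toMeasurePreserving
    rw [this]; rfl
  have hin : inner ℝ one (u - Pu) = 0 := by
    have h1 : u - Pu ∈ Pmᗮ := Submodule.sub_starProjection_mem_orthogonal u
    exact Submodule.inner_right_of_mem_orthogonal (show one ∈ Pm from hone) h1
  have hcval : c = μ.real s := by
    rw [inner_sub_right, L2.inner_indicatorConstLp_one, L2.inner_indicatorConstLp_one,
      Measure.restrict_univ, integral_congr_ae hc, integral_congr_ae indicatorConstLp_coeFn,
      integral_indicator hs] at hin
    simp at hin
    linarith
  refine key.congr fun n => ?_
  rw [inner_sub_right, real_inner_comm, L2.inner_indicatorConstLp_one, L2.inner_def]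
  congr 1
  · exact setIntegral_congr_ae hs ((mLp n).coeFn_toLp.mono fun x hx _ => hx)
  · rw [← hcval, ← integral_const_mul]
    refine integral_congr_ae ?_
    filter_upwards [hc, (mLp n).coeFn_toLp] with x h1 h2
    rw [h1, h2]
    simp

/-- Bounded almost invariant functions become asymptotically constant against any absolutely
continuous finite measure. -/
theorem tendsto_integral_of_almost_invariant (hT : Ergodic T μ) (R : ℕ → X → ℝ)
    (mR : ∀ n, Measurable (R n)) {C : ℝ} (bR : ∀ n x, |R n x| ≤ C)
    (hinv : Tendsto (fun n => ∫ x, |R n (T x) - R n x| ∂μ) atTop (𝓝 0))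
    (κ : Measure X) [IsFiniteMeasure κ] (hκ : κ ≪ μ) :
    Tendsto (fun n => ∫ x, R n x ∂κ - κ.real univ * ∫ x, R n x ∂μ) atTop (𝓝 0) := by
  have hmul : ∀ {f : X → ℝ}, Integrable f μ → ∀ n, Integrable (fun x => f x * R n x) μ :=
    fun hf n => hf.mul_bdd (c := C) (mR n).aestronglyMeasurable (Eventually.of_forall (bR n))
  have hRb : ∀ n, |∫ x, R n x ∂μ| ≤ C := fun n => by
    have := norm_integral_le_of_norm_le_const (μ := μ) (f := R n) (Eventually.of_forall (bR n))
    simpa using this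
  have main : ∀ ⦃f : X → ℝ⦄, Integrable f μ →
      Tendsto (fun n => ∫ x, f x * R n x ∂μ - (∫ x, f x ∂μ) * ∫ x, R n x ∂μ) atTop (𝓝 0) := by
    intro f hf
    refine Integrable.induction (μ := μ) (fun f : X → ℝ => Tendsto (fun n =>
      ∫ x, f x * R n x ∂μ - (∫ x, f x ∂μ) * ∫ x, R n x ∂μ) atTop (𝓝 0)) ?_ ?_ ?_ ?_ hf
    · intro c s hs _
      have := (tendsto_setIntegral_of_almost_invariant hT R mR bR hinv hs).const_mul c
      rw [mul_zero] at this
      refine this.congr fun n => ?_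
      have h1 : ∀ x, s.indicator (fun _ => c) x * R n x = s.indicator (fun x => c * R n x) x := by
        intro x
        by_cases h : x ∈ s <;> simp [h]
      simp only [h1]
      rw [integral_indicator hs, integral_indicator hs, integral_const_mul]
      simp
      ring
    · intro f g _ hf hg h1 h2
      have := h1.add h2
      rw [add_zero] at this
      refine this.congr fun n => ?_
      simp only [Pi.add_apply, add_mul]
      rw [integral_add (hmul hf n) (hmul hg n), integral_add hf hg]
      ring
    · refine isClosed_of_closure_subset fun f hf => ?_
      rw [mem_ofPred_eq, Metric.tendsto_atTop]
      intro ε hε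
      have hC : 0 ≤ C := (abs_nonneg _).trans (hRb 0)
      obtain ⟨g, hg, hfg⟩ := Metric.mem_closure_iff.1 hf (ε / (4 * (C + 1))) (by positivity)
      obtain ⟨N, hN⟩ := Metric.tendsto_atTop.1 hg (ε / 2) (by positivity)
      refine ⟨N, fun n hn => ?_⟩
      have h1 := hN n hn
      rw [dist_zero_right, Real.norm_eq_abs] at h1 ⊢
      have if' := L1.integrable_coeFn f
      have ig := L1.integrable_coeFn g
      have hd : ∫ x, |f x - g x| ∂μ ≤ ε / (4 * (C + 1)) := by
        rw [dist_eq_norm, L1.norm_eq_integral_norm] at hfg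
        refine le_trans (le_of_eq (integral_congr_ae ?_)) hfg.le
        filter_upwards [Lp.coeFn_sub f g] with x hx
        rw [hx]; simp
      have e1 : |∫ x, f x * R n x ∂μ - ∫ x, g x * R n x ∂μ| ≤ C * (ε / (4 * (C + 1))) := by
        rw [← integral_sub (hmul if' n) (hmul ig n)]
        calc |∫ x, (f x * R n x - g x * R n x) ∂μ| ≤ ∫ x, |f x * R n x - g x * R n x| ∂μ :=
              abs_integral_le_integral_abs
          _ ≤ ∫ x, C * |f x - g x| ∂μ := by
              refine integral_mono ((hmul if' n).sub (hmul ig n)).abs ((if'.sub ig).abs.const_mul C)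
                fun x => ?_
              simp only [← sub_mul, abs_mul]
              rw [mul_comm]
              exact mul_le_mul_of_nonneg_right (bR n x) (abs_nonneg _)
          _ ≤ _ := by
              rw [integral_const_mul]
              exact mul_le_mul_of_nonneg_left hd hC
      have e2 : |(∫ x, f x ∂μ) * ∫ x, R n x ∂μ - (∫ x, g x ∂μ) * ∫ x, R n x ∂μ| ≤
          C * (ε / (4 * (C + 1))) := by
        rw [← sub_mul, ← integral_sub if' ig, abs_mul, mul_comm]
        refine mul_le_mul (hRb n) (le_trans abs_integral_le_integral_abs hd) (abs_nonneg _) hC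
      have e3 : C * (ε / (4 * (C + 1))) ≤ ε / 4 := by
        rw [mul_div_assoc', div_le_div_iff₀ (by positivity) (by positivity)]
        nlinarith
      rw [abs_lt] at *
      rw [abs_le] at e1 e2
      constructor <;> linarith [e1.1, e1.2, e2.1, e2.2]
    · intro f g hfg _ h
      refine h.congr fun n => ?_
      have h2 : ∫ x, f x * R n x ∂μ = ∫ x, g x * R n x ∂μ :=
        integral_congr_ae (hfg.mul (ae_eq_refl (R n)))
      rw [integral_congr_ae hfg, h2]
  have h1 := main (Measure.integrable_toReal_rnDeriv (μ := κ) (ν := μ))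
  refine h1.congr fun n => ?_
  have h2 := integral_rnDeriv_smul hκ (f := R n)
  simp only [smul_eq_mul] at h2
  rw [h2, Measure.integral_toReal_rnDeriv hκ]

end AlmostInvariant

/-- A finite measure preserving map which is monotone on a forward invariant set is the identity
there, almost everywhere. -/
theorem ae_eq_self_of_monotoneOn {μ : Measure ℝ} [IsFiniteMeasure μ] {F : ℝ → ℝ}
    (hF : MeasurePreserving F μ μ) {D : Set ℝ} (hD : MeasurableSet D) (hDF : MapsTo F D D)
    (hmono : MonotoneOn F D) : ∀ᵐ x ∂μ, x ∈ D → F x = x := by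
  have hit : ∀ n : ℕ, ∀ x ∈ D, F^[n] x ∈ D := fun n x hx => hDF.iterate n hx
  have key : ∀ q : ℚ, μ {x | x ∈ D ∧ x < q ∧ (q : ℝ) < F x} = 0 := by
    intro q
    by_contra h
    have hm : MeasurableSet {x | x ∈ D ∧ x < q ∧ (q : ℝ) < F x} :=
      hD.inter ((measurableSet_lt measurable_id measurable_const).inter
        (measurableSet_lt measurable_const hF.measurable))
    obtain ⟨x, hx, n, hn, hxn⟩ := hF.conservative.exists_mem_iterate_mem hm.nullMeasurableSet h
    have : ∀ m : ℕ, (q : ℝ) < F^[m + 1] x := by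
      intro m
      have hmon : ∀ m : ℕ, F x ≤ F^[m + 1] x := by
        intro m
        induction m with
        | zero => simp
        | succ m ih =>
          rw [Function.iterate_succ_apply']
          refine hmono hx.1 (hit _ x hx.1) ?_
          linarith [hx.2.1, hx.2.2]
      exact hx.2.2.trans_le (hmon m)
    obtain ⟨m, rfl⟩ := Nat.exists_eq_succ_of_ne_zero hn
    exact absurd hxn.2.1 (not_lt.2 (this m).le)
  have key' : ∀ q : ℚ, μ {x | x ∈ D ∧ (q : ℝ) < x ∧ F x < q} = 0 := by
    intro q
    by_contra h
    have hm : MeasurableSet {x | x ∈ D ∧ (q : ℝ) < x ∧ F x < q} :=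
      hD.inter ((measurableSet_lt measurable_const measurable_id).inter
        (measurableSet_lt hF.measurable measurable_const))
    obtain ⟨x, hx, n, hn, hxn⟩ := hF.conservative.exists_mem_iterate_mem hm.nullMeasurableSet h
    have : ∀ m : ℕ, F^[m + 1] x < (q : ℝ) := by
      intro m
      have hmon : ∀ m : ℕ, F^[m + 1] x ≤ F x := by
        intro m
        induction m with
        | zero => simp
        | succ m ih =>
          rw [Function.iterate_succ_apply']
          refine hmono (hit _ x hx.1) hx.1 ?_
          linarith [hx.2.1, hx.2.2]
      exact (hmon m).trans_lt hx.2.2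
    obtain ⟨m, rfl⟩ := Nat.exists_eq_succ_of_ne_zero hn
    exact absurd hxn.2.1 (not_lt.2 (this m).le)
  have h1 : ∀ᵐ x ∂μ, ∀ q : ℚ, ¬ (x ∈ D ∧ x < q ∧ (q : ℝ) < F x) :=
    ae_all_iff.2 fun q => by rw [ae_iff]; simpa using key q
  have h2 : ∀ᵐ x ∂μ, ∀ q : ℚ, ¬ (x ∈ D ∧ (q : ℝ) < x ∧ F x < q) :=
    ae_all_iff.2 fun q => by rw [ae_iff]; simpa using key' q
  filter_upwards [h1, h2] with x h1 h2 hx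
  rcases lt_trichotomy x (F x) with h | h | h
  · obtain ⟨q, hq⟩ := exists_rat_btwn h
    exact absurd ⟨hx, hq⟩ (h1 q)
  · exact h.symm
  · obtain ⟨q, hq⟩ := exists_rat_btwn h
    exact absurd ⟨hx, hq.2, hq.1⟩ (h2 q)

/-- Standing assumptions: a Misiurewicz–Thurston parameter with an ergodic absolutely continuous
invariant measure. -/
structure MTSetting (a : ℝ) (μ : Measure ℝ) : Prop where
  ha : a ∈ Set.Ioc (0 : ℝ) 2
  mis : ∃ k, 1 ≤ k ∧ ∃ p, 1 ≤ p ∧ (Ta a)^[k + p] 0 = (Ta a)^[k] 0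
  notper : ∀ m, 1 ≤ m → (Ta a)^[m] 0 ≠ 0
  prob : IsProbabilityMeasure μ
  erg : Ergodic (Ta a) μ
  ac : μ ≪ volume

/-- The postcritical set. -/
def postCrit (a : ℝ) : Set ℝ := {y | ∃ j, 1 ≤ j ∧ (Ta a)^[j] 0 = y}

/-- The derivative of the `n`-th iterate of the quadratic map. -/
def derivIter (a : ℝ) (n : ℕ) (x : ℝ) : ℝ := ∏ j ∈ Finset.range n, (-2 * a * (Ta a)^[j] x)

section Basic

variable {a : ℝ}

theorem continuous_Ta : Continuous (Ta a) := by unfold Ta; fun_prop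

theorem Ta_zero : Ta a 0 = 1 := by simp [Ta]

theorem Ta_sub (x y : ℝ) : Ta a x - Ta a y = -a * (x - y) * (x + y) := by unfold Ta; ring

theorem hasDerivAt_Ta (x : ℝ) : HasDerivAt (Ta a) (-2 * a * x) x := by
  have := ((hasDerivAt_pow 2 x).const_mul a).const_sub 1
  convert! this using 1
  simp; ring

theorem derivIter_succ (n : ℕ) (x : ℝ) :
    derivIter a (n + 1) x = derivIter a n x * (-2 * a * (Ta a)^[n] x) :=
  Finset.prod_range_succ _ _

theorem derivIter_succ' (n : ℕ) (x : ℝ) :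
    derivIter a (n + 1) x = (-2 * a * x) * derivIter a n (Ta a x) := by
  unfold derivIter
  rw [Finset.prod_range_succ', mul_comm]
  simp

theorem derivIter_add (m n : ℕ) (x : ℝ) :
    derivIter a (m + n) x = derivIter a m x * derivIter a n ((Ta a)^[m] x) := by
  unfold derivIter
  rw [Finset.prod_range_add]
  congr 1
  refine Finset.prod_congr rfl fun j _ => ?_
  rw [← Function.iterate_add_apply, add_comm]

theorem hasDerivAt_iterate_Ta (n : ℕ) (x : ℝ) :
    HasDerivAt ((Ta a)^[n]) (derivIter a n x) x := by
  induction n with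
  | zero => simpa [derivIter] using hasDerivAt_id x
  | succ n ih =>
    rw [Function.iterate_succ', derivIter_succ, mul_comm]
    exact (hasDerivAt_Ta _).comp x ih

theorem continuous_iterate_Ta (n : ℕ) : Continuous ((Ta a)^[n]) := continuous_Ta.iterate n

theorem continuous_derivIter (n : ℕ) : Continuous (derivIter a n) :=
  continuous_finsetProd _ fun j _ => continuous_const.mul (continuous_iterate_Ta j)

theorem derivIter_ne_zero_iff (ha : 0 < a) {n : ℕ} {x : ℝ} :
    derivIter a n x ≠ 0 ↔ ∀ j < n, (Ta a)^[j] x ≠ 0 := by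
  unfold derivIter
  rw [Finset.prod_ne_zero_iff]
  simp [ha.ne']

theorem mapsTo_Ta_Icc (ha : a ∈ Ioc (0 : ℝ) 2) : MapsTo (Ta a) (Icc (-1) 1) (Icc (-1) 1) := by
  intro x hx
  have h1 : x ^ 2 ≤ 1 := by nlinarith [hx.1, hx.2]
  have h2 := sq_nonneg x
  constructor <;> unfold Ta <;> nlinarith [ha.1, ha.2]

theorem iterate_Ta_mem_Icc (ha : a ∈ Ioc (0 : ℝ) 2) (n : ℕ) {x : ℝ} (hx : x ∈ Icc (-1 : ℝ) 1) :
    (Ta a)^[n] x ∈ Icc (-1 : ℝ) 1 := (mapsTo_Ta_Icc ha).iterate n hx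

theorem Ta_lipschitz_Icc (ha : a ∈ Ioc (0 : ℝ) 2) {x y : ℝ} (hx : x ∈ Icc (-1 : ℝ) 1)
    (hy : y ∈ Icc (-1 : ℝ) 1) : |Ta a x - Ta a y| ≤ 4 * |x - y| := by
  rw [Ta_sub, abs_mul, abs_mul, abs_neg, abs_of_pos ha.1, mul_right_comm]
  have h1 : |x + y| ≤ 2 := abs_le.2 ⟨by linarith [hx.1, hy.1], by linarith [hx.2, hy.2]⟩
  have h2 : a * |x + y| ≤ 4 := by nlinarith [ha.1, ha.2, abs_nonneg (x + y)]
  exact mul_le_mul_of_nonneg_right h2 (abs_nonneg _)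

/-- The iterates of the quadratic map as polynomials. -/
noncomputable def iterPoly (a : ℝ) : ℕ → Polynomial ℝ
  | 0 => Polynomial.X
  | n + 1 => 1 - Polynomial.C a * iterPoly a n ^ 2

theorem iterPoly_eval (n : ℕ) (x : ℝ) : (iterPoly a n).eval x = (Ta a)^[n] x := by
  induction n with
  | zero => simp [iterPoly]
  | succ n ih => rw [Function.iterate_succ_apply', ← ih]; simp [iterPoly, Ta]

theorem iterPoly_natDegree (ha : a ≠ 0) (n : ℕ) : (iterPoly a n).natDegree = 2 ^ n := by
  induction n with
  | zero => simp [iterPoly]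
  | succ n ih =>
    have h1 : (Polynomial.C a * iterPoly a n ^ 2).natDegree = 2 ^ (n + 1) := by
      rw [Polynomial.natDegree_C_mul ha, Polynomial.natDegree_pow, ih]; ring
    rw [iterPoly, Polynomial.natDegree_sub_eq_right_of_natDegree_lt, h1]
    rw [h1]; simp

theorem finite_iterate_Ta_eq (ha : a ≠ 0) (n : ℕ) (c : ℝ) : {x | (Ta a)^[n] x = c}.Finite := by
  have hne : iterPoly a n - Polynomial.C c ≠ 0 := by
    intro h
    have h1 : (iterPoly a n - Polynomial.C c).natDegree = 2 ^ n := by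
      rw [Polynomial.natDegree_sub_C, iterPoly_natDegree ha]
    rw [h, Polynomial.natDegree_zero] at h1
    exact absurd h1.symm (by positivity)
  refine ((iterPoly a n - Polynomial.C c).rootSet_finite ℝ).subset fun x hx => ?_
  rw [Polynomial.mem_rootSet]
  refine ⟨hne, ?_⟩
  have hx' : (Ta a)^[n] x = c := hx
  simp [iterPoly_eval, hx']

theorem finite_iterate_Ta_fixed (ha : a ≠ 0) {n : ℕ} (hn : 1 ≤ n) :
    {x | (Ta a)^[n] x = x}.Finite := by
  have hne : iterPoly a n - Polynomial.X ≠ 0 := by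
    intro h
    have h1 := iterPoly_natDegree ha n
    rw [sub_eq_zero.1 h, Polynomial.natDegree_X] at h1
    have := Nat.one_lt_two_pow (n := n) (by omega)
    omega
  refine ((iterPoly a n - Polynomial.X).rootSet_finite ℝ).subset fun x hx => ?_
  rw [Polynomial.mem_rootSet]
  refine ⟨hne, ?_⟩
  have hx' : (Ta a)^[n] x = x := hx
  simp [iterPoly_eval, hx']

/-- Expansion of the cross ratio (Koebe principle) along a monotone branch. -/
theorem koebe_iterate (ha : 0 < a) (n : ℕ) {p x q : ℝ} (h1 : (p < x ∧ x < q) ∨ (q < x ∧ x < p))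
    (h2 : ∀ j < n, 0 ≤ (Ta a)^[j] p * (Ta a)^[j] q) :
    1 / |x - p| + 1 / |q - x| ≤ |derivIter a n x| *
      (1 / |(Ta a)^[n] x - (Ta a)^[n] p| + 1 / |(Ta a)^[n] q - (Ta a)^[n] x|) := by
  have one : ∀ {p x q : ℝ}, 0 ≤ p → p < x → x < q →
      1 / |x - p| + 1 / |q - x| ≤ |-2 * a * x| * (1 / |Ta a x - Ta a p| + 1 / |Ta a q - Ta a x|) := by
    intro p x q hp hpx hxq
    have hx : 0 < x := hp.trans_lt hpx
    have e1 : |Ta a x - Ta a p| = a * (x - p) * (x + p) := by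
      rw [Ta_sub, abs_mul, abs_mul, abs_neg, abs_of_pos ha, abs_of_pos (by linarith),
        abs_of_pos (by linarith)]
    have e2 : |Ta a q - Ta a x| = a * (q - x) * (q + x) := by
      rw [Ta_sub, abs_mul, abs_mul, abs_neg, abs_of_pos ha, abs_of_pos (by linarith),
        abs_of_pos (by linarith)]
    have e3 : |-2 * a * x| = 2 * a * x := by
      rw [abs_mul, abs_mul, abs_neg, abs_two, abs_of_pos ha, abs_of_pos hx]
    rw [e1, e2, e3, abs_of_pos (by linarith), abs_of_pos (by linarith)]
    have k1 : 0 < x - p := by linarith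
    have k2 : 0 < q - x := by linarith
    have k3 : 0 < x + p := by linarith
    have k4 : 0 < q + x := by linarith
    have : 2 * a * x * (1 / (a * (x - p) * (x + p)) + 1 / (a * (q - x) * (q + x))) -
        (1 / (x - p) + 1 / (q - x)) = (q - p) / ((x + p) * (q + x)) := by
      field_simp; ring
    have h5 : 0 ≤ (q - p) / ((x + p) * (q + x)) := by
      apply div_nonneg <;> [linarith; positivity]
    linarith
  have even : ∀ y, Ta a (-y) = Ta a y := fun y => by simp [Ta]
  -- all sign configurations
  have step : ∀ {p x q : ℝ}, ((p < x ∧ x < q) ∨ (q < x ∧ x < p)) → 0 ≤ p * q →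
      1 / |x - p| + 1 / |q - x| ≤ |-2 * a * x| * (1 / |Ta a x - Ta a p| + 1 / |Ta a q - Ta a x|) ∧
      ((Ta a p < Ta a x ∧ Ta a x < Ta a q) ∨ (Ta a q < Ta a x ∧ Ta a x < Ta a p)) := by
    intro p x q h hpq
    have lt_of : ∀ {u v : ℝ}, 0 ≤ u → u < v → Ta a v < Ta a u := by
      intro u v hu huv
      have := Ta_sub (a := a) v u
      have : 0 < a * (v - u) * (v + u) := by
        have := sub_pos.2 huv
        have : 0 < v + u := by linarith
        positivity
      linarith
    have main : ∀ {p x q : ℝ}, p < x → x < q → 0 ≤ p * q →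
      1 / |x - p| + 1 / |q - x| ≤ |-2 * a * x| * (1 / |Ta a x - Ta a p| + 1 / |Ta a q - Ta a x|) ∧
      ((Ta a p < Ta a x ∧ Ta a x < Ta a q) ∨ (Ta a q < Ta a x ∧ Ta a x < Ta a p)) := by
      intro p x q hp hq hpq
      rcases le_or_gt 0 p with h0 | h0
      · exact ⟨one h0 hp hq, Or.inr ⟨lt_of (h0.trans hp.le) hq, lt_of h0 hp⟩⟩
      · have hq0 : q ≤ 0 := by nlinarith
        have hx0 : x < 0 := by linarith
        have := one (p := -q) (x := -x) (q := -p) (by linarith) (by linarith) (by linarith)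
        rw [even, even, even] at this
        refine ⟨?_, Or.inl ⟨?_, ?_⟩⟩
        · have e1 : |-x - -q| = |q - x| := by ring_nf
          have e2 : |-p - -x| = |x - p| := by ring_nf
          have e3 : |-2 * a * -x| = |-2 * a * x| := by rw [mul_neg, abs_neg]
          rw [e1, e2, e3, abs_sub_comm (Ta a x) (Ta a q), abs_sub_comm (Ta a p) (Ta a x)] at this
          linarith
        · rw [← even p, ← even x]; exact lt_of (by linarith) (by linarith)
        · rw [← even q, ← even x]; exact lt_of (by linarith) (by linarith)
    rcases h with ⟨hp, hq⟩ | ⟨hq, hp⟩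
    · exact main hp hq hpq
    · have := main hq hp (by linarith)
      refine ⟨?_, this.2.symm⟩
      have t := this.1
      rw [abs_sub_comm x q, abs_sub_comm p x, abs_sub_comm (Ta a x) (Ta a q),
        abs_sub_comm (Ta a p) (Ta a x)] at t
      linarith
  induction n generalizing p x q with
  | zero => simp [derivIter]
  | succ n ih =>
    have s := step h1 (by simpa using h2 0 (by omega))
    have i := ih s.2 fun j hj => by simpa using h2 (j + 1) (by omega)
    refine s.1.trans ?_
    rw [derivIter_succ', abs_mul (-2 * a * x), mul_assoc |-2 * a * x|]
    simp only [Function.iterate_succ_apply]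
    exact mul_le_mul_of_nonneg_left i (abs_nonneg _)

end Basic

namespace MTSetting

variable {a : ℝ} {μ : Measure ℝ}

theorem pos (S : MTSetting a μ) : 0 < a := S.ha.1

theorem mp (S : MTSetting a μ) : MeasurePreserving (Ta a) μ μ := S.erg.toMeasurePreserving

theorem null_of_finite (S : MTSetting a μ) {s : Set ℝ} (hs : s.Finite) : μ s = 0 :=
  S.ac (hs.measure_zero volume)

theorem postCrit_finite (S : MTSetting a μ) : (postCrit a).Finite := by
  obtain ⟨k, hk, p, hp, h⟩ := S.mis
  refine (((Finset.range (k + p)).image fun j => (Ta a)^[j] 0).finite_toSet).subset ?_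
  have : ∀ j, ∃ i < k + p, (Ta a)^[i] 0 = (Ta a)^[j] 0 := by
    intro j
    induction j using Nat.strong_induction_on with
    | _ j ih =>
      by_cases hj : j < k + p
      · exact ⟨j, hj, rfl⟩
      · obtain ⟨i, hi, e⟩ := ih (j - p) (by omega)
        refine ⟨i, hi, e.trans ?_⟩
        have e1 : j - p = (j - p - k) + k := by omega
        have e2 : j = (j - p - k) + (k + p) := by omega
        conv_rhs => rw [e2, Function.iterate_add_apply, h]
        rw [e1, Function.iterate_add_apply]
        congr 2
  rintro y ⟨j, _, rfl⟩
  obtain ⟨i, hi, e⟩ := this j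
  simp only [Finset.coe_image, mem_image, Finset.coe_range, mem_Iio]
  exact ⟨i, hi, e⟩

theorem mapsTo_postCrit : MapsTo (Ta a) (postCrit a) (postCrit a) := by
  rintro y ⟨j, hj, rfl⟩
  exact ⟨j + 1, by omega, Function.iterate_succ_apply' _ _ _⟩

theorem iterate_mem_postCrit {y : ℝ} (hy : y ∈ postCrit a) (n : ℕ) :
    (Ta a)^[n] y ∈ postCrit a := mapsTo_postCrit.iterate n hy

theorem iterate_mem_postCrit_of_le {y : ℝ} {m n : ℕ} (hmn : m ≤ n)
    (h : (Ta a)^[m] y ∈ postCrit a) : (Ta a)^[n] y ∈ postCrit a := by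
  obtain ⟨k, rfl⟩ := Nat.exists_eq_add_of_le hmn
  rw [add_comm, Function.iterate_add_apply]
  exact iterate_mem_postCrit h k

theorem zero_notMem_postCrit (S : MTSetting a μ) : (0 : ℝ) ∉ postCrit a := by
  rintro ⟨j, hj, h⟩
  exact S.notper j hj h

theorem one_mem_postCrit : (1 : ℝ) ∈ postCrit a := ⟨1, le_rfl, by simp [Ta]⟩

theorem iterate_mem_postCrit_of_eq_zero {y : ℝ} {m n : ℕ} (hmn : m < n)
    (h : (Ta a)^[m] y = 0) : (Ta a)^[n] y ∈ postCrit a := by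
  apply iterate_mem_postCrit_of_le (Nat.succ_le_of_lt hmn)
  rw [Function.iterate_succ_apply', h, Ta_zero]
  exact one_mem_postCrit

theorem iterate_ne_zero_of_mem_postCrit (S : MTSetting a μ) {y : ℝ} (hy : y ∈ postCrit a) (n : ℕ) :
    (Ta a)^[n] y ≠ 0 := fun h => S.zero_notMem_postCrit (h ▸ iterate_mem_postCrit hy n)

theorem postCrit_subset (S : MTSetting a μ) : postCrit a ⊆ Icc (-1) 1 := by
  rintro y ⟨j, _, rfl⟩
  exact iterate_Ta_mem_Icc S.ha j ⟨by norm_num, by norm_num⟩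

theorem ae_mem_Icc (S : MTSetting a μ) : ∀ᵐ x ∂μ, x ∈ Icc (-1 : ℝ) 1 := by
  have := S.prob
  have ha := S.pos
  have h1 : ∀ᵐ x ∂μ, x ≤ 1 := by
    have h : μ (Ioi 1) = 0 := by
      rw [← S.mp.measure_preimage measurableSet_Ioi.nullMeasurableSet]
      have : Ta a ⁻¹' Ioi 1 = ∅ := by
        ext x
        simp only [Ta, mem_preimage, mem_Ioi, mem_empty_iff_false, iff_false, not_lt]
        nlinarith [sq_nonneg x]
      rw [this]; simp
    rw [ae_iff]
    simpa [Ioi] using h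
  set D : Set ℝ := {x | ∀ n : ℕ, (Ta a)^[n] x < -1} with hD
  have mD : MeasurableSet D := by
    have : D = ⋂ n : ℕ, (Ta a)^[n] ⁻¹' Iio (-1) := by ext x; simp [hD]
    rw [this]
    exact MeasurableSet.iInter fun n => (continuous_iterate_Ta n).measurable measurableSet_Iio
  have h2 : ∀ᵐ x ∂μ, x ∈ D → Ta a x = x := by
    refine ae_eq_self_of_monotoneOn S.mp mD (fun x hx n => ?_) ?_
    · have := hx (n + 1)
      rwa [Function.iterate_succ_apply] at this
    · intro x hx y hy hxy
      have h1 : x < -1 := hx 0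
      have h2 : y < -1 := hy 0
      unfold Ta
      have : y ^ 2 ≤ x ^ 2 := by nlinarith
      nlinarith
  have h3 : ∀ᵐ x ∂μ, Ta a x ≠ x := by
    rw [ae_iff]
    simp only [not_not]
    exact S.null_of_finite (by simpa using finite_iterate_Ta_fixed S.pos.ne' (le_refl 1))
  have h4 := S.mp.conservative.ae_mem_imp_frequently_image_mem
    (measurableSet_Iio (a := (-1 : ℝ))).nullMeasurableSet
  have h5 : ∀ᵐ x ∂μ, ∀ n, Ta a ((Ta a)^[n] x) ≤ 1 := by
    refine Eventually.of_forall fun x n => ?_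
    have := mul_nonneg ha.le (sq_nonneg ((Ta a)^[n] x))
    show 1 - a * ((Ta a)^[n] x) ^ 2 ≤ 1
    linarith
  filter_upwards [h1, h2, h3, h4, h5] with x h1 h2 h3 h4 h5
  refine ⟨?_, h1⟩
  by_contra hx
  rw [not_le] at hx
  have hxD : x ∉ D := fun h => h3 (h2 h)
  simp only [hD, mem_ofPred_eq, not_forall, not_lt] at hxD
  obtain ⟨n, hn⟩ := hxD
  rcases n with _ | n
  · simp at hn; linarith
  · have hmem : (Ta a)^[n + 1] x ∈ Icc (-1 : ℝ) 1 := ⟨hn, by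
      rw [Function.iterate_succ_apply']; exact h5 n⟩
    have := h4 hx
    rw [frequently_atTop] at this
    obtain ⟨m, hm, hm2⟩ := this (n + 1)
    obtain ⟨k, rfl⟩ := Nat.exists_eq_add_of_le hm
    rw [add_comm, Function.iterate_add_apply] at hm2
    have := (iterate_Ta_mem_Icc S.ha k hmem).1
    exact absurd (mem_Iio.1 hm2) (not_lt.2 this)

end MTSetting

/-- The postcritical set as a finset (junk value `∅` if it is infinite). -/
noncomputable def postCritFinset (a : ℝ) : Finset ℝ :=
  open Classical in if h : (postCrit a).Finite then h.toFinset else ∅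

/-- The monic polynomial vanishing exactly on the postcritical set. -/
noncomputable def postCritPoly (a : ℝ) : Polynomial ℝ :=
  ∏ c ∈ postCritFinset a, (Polynomial.X - Polynomial.C c)

/-- The quotient of `W ∘ T` by `X² W`, where `W` is the postcritical polynomial. -/
noncomputable def quotPoly (a : ℝ) : Polynomial ℝ :=
  (postCritPoly a).comp (iterPoly a 1) /ₘ (Polynomial.X ^ 2 * postCritPoly a)

/-- The reciprocal of the derivative of `T^n` in the metric `|W|^{-1/2} dx`. -/
noncomputable def invExpansion (a : ℝ) (n : ℕ) (x : ℝ) : ℝ :=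
  ∏ j ∈ Finset.range n, (√|(quotPoly a).eval ((Ta a)^[j] x)| / (2 * a))

namespace MTSetting

variable {a : ℝ} {μ : Measure ℝ}

theorem mem_postCritFinset (S : MTSetting a μ) {x : ℝ} : x ∈ postCritFinset a ↔ x ∈ postCrit a := by
  simp [postCritFinset, S.postCrit_finite]

theorem postCritPoly_monic : (postCritPoly a).Monic :=
  Polynomial.monic_prod_of_monic _ _ fun c _ => Polynomial.monic_X_sub_C c

theorem postCritPoly_eval (x : ℝ) :
    (postCritPoly a).eval x = ∏ c ∈ postCritFinset a, (x - c) := by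
  simp [postCritPoly, Polynomial.eval_prod]

theorem postCritPoly_eval_eq_zero (S : MTSetting a μ) {x : ℝ} :
    (postCritPoly a).eval x = 0 ↔ x ∈ postCrit a := by
  rw [postCritPoly_eval, Finset.prod_eq_zero_iff]
  simp only [S.mem_postCritFinset, sub_eq_zero]
  exact ⟨fun ⟨c, hc, h⟩ => h ▸ hc, fun h => ⟨x, h, rfl⟩⟩

theorem postCritPoly_derivative_ne_zero (S : MTSetting a μ) {x : ℝ} (hx : x ∈ postCrit a) :
    (postCritPoly a).derivative.eval x ≠ 0 := by
  classical
  have hx' := S.mem_postCritFinset.2 hx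
  rw [postCritPoly, ← Finset.mul_prod_erase _ _ hx', Polynomial.derivative_mul]
  simp only [Polynomial.derivative_X_sub_C, one_mul, Polynomial.eval_add, Polynomial.eval_mul,
    Polynomial.eval_sub, Polynomial.eval_X, Polynomial.eval_C, sub_self, zero_mul, add_zero,
    Polynomial.eval_prod]
  rw [Finset.prod_ne_zero_iff]
  intro c hc
  rw [sub_ne_zero]
  exact (Finset.ne_of_mem_erase hc).symm

theorem comp_postCritPoly (S : MTSetting a μ) :
    (postCritPoly a).comp (iterPoly a 1) = Polynomial.X ^ 2 * postCritPoly a * quotPoly a := by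
  classical
  have hmon : (Polynomial.X ^ 2 * postCritPoly a).Monic :=
    (Polynomial.monic_X_pow 2).mul postCritPoly_monic
  have hdvd : Polynomial.X ^ 2 * postCritPoly a ∣ (postCritPoly a).comp (iterPoly a 1) := by
    refine IsCoprime.mul_dvd ?_ ?_ ?_
    · refine IsCoprime.pow_left (IsCoprime.prod_right fun c hc => ?_)
      have h0 : (0 : ℝ) ≠ c := fun h => S.zero_notMem_postCrit (h ▸ S.mem_postCritFinset.1 hc)
      simpa using Polynomial.isCoprime_X_sub_C_of_isUnit_sub (R := ℝ) (a := 0) (b := c)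
        (by simpa using h0.symm)
    · have h1 := Finset.dvd_prod_of_mem (fun c => (Polynomial.X - Polynomial.C c : Polynomial ℝ))
        (S.mem_postCritFinset.2 one_mem_postCrit)
      have h2 := map_dvd (Polynomial.compRingHom (iterPoly a 1)) h1
      simp only [Polynomial.coe_compRingHom] at h2
      refine Dvd.dvd.trans ⟨-Polynomial.C a, ?_⟩ h2
      simp [iterPoly]
    · refine Finset.prod_dvd_of_coprime ?_ ?_
      · intro c _ d _ hcd
        exact Polynomial.isCoprime_X_sub_C_of_isUnit_sub (sub_ne_zero.2 hcd).isUnit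
      · intro c hc
        rw [Polynomial.dvd_iff_isRoot, Polynomial.IsRoot, Polynomial.eval_comp, iterPoly_eval,
          S.postCritPoly_eval_eq_zero]
        exact mapsTo_postCrit (S.mem_postCritFinset.1 hc)
  have := Polynomial.modByMonic_add_div ((postCritPoly a).comp (iterPoly a 1))
    (Polynomial.X ^ 2 * postCritPoly a)
  rw [(Polynomial.modByMonic_eq_zero_iff_dvd hmon).2 hdvd, zero_add] at this
  exact this.symm

theorem eval_postCritPoly_Ta (S : MTSetting a μ) (x : ℝ) :
    (postCritPoly a).eval (Ta a x) =
      (postCritPoly a).eval x * (x ^ 2 * (quotPoly a).eval x) := by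
  have := congrArg (Polynomial.eval x) S.comp_postCritPoly
  rw [Polynomial.eval_comp, iterPoly_eval] at this
  simp only [Function.iterate_one] at this
  rw [this]
  simp
  ring

theorem eval_postCritPoly_iterate (S : MTSetting a μ) (n : ℕ) (x : ℝ) :
    (postCritPoly a).eval ((Ta a)^[n] x) = (postCritPoly a).eval x *
      ∏ j ∈ Finset.range n, (((Ta a)^[j] x) ^ 2 * (quotPoly a).eval ((Ta a)^[j] x)) := by
  induction n with
  | zero => simp
  | succ n ih =>
    rw [Function.iterate_succ_apply', S.eval_postCritPoly_Ta, ih, Finset.prod_range_succ]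
    ring

theorem quotPoly_ne_zero (S : MTSetting a μ) : quotPoly a ≠ 0 := by
  intro h
  have h1 := S.comp_postCritPoly
  rw [h, mul_zero, Polynomial.comp_eq_zero_iff] at h1
  rcases h1 with h1 | ⟨_, h1⟩
  · exact postCritPoly_monic.ne_zero h1
  · have := iterPoly_natDegree S.pos.ne' 1
    rw [h1, Polynomial.natDegree_C] at this
    norm_num at this

theorem sq_derivIter_mul (S : MTSetting a μ) (n : ℕ) (x : ℝ) :
    derivIter a n x ^ 2 * invExpansion a n x ^ 2 =
      |∏ j ∈ Finset.range n, (((Ta a)^[j] x) ^ 2 * (quotPoly a).eval ((Ta a)^[j] x))| := by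
  unfold derivIter invExpansion
  rw [← Finset.prod_pow, ← Finset.prod_pow, ← Finset.prod_mul_distrib, Finset.abs_prod]
  refine Finset.prod_congr rfl fun j _ => ?_
  have := S.pos
  rw [div_pow, Real.sq_sqrt (abs_nonneg _), abs_mul, abs_pow, sq_abs]
  field_simp

theorem abs_postCritPoly_iterate (S : MTSetting a μ) (n : ℕ) (x : ℝ) :
    |(postCritPoly a).eval ((Ta a)^[n] x)| =
      |(postCritPoly a).eval x| * (derivIter a n x ^ 2 * invExpansion a n x ^ 2) := by
  rw [S.eval_postCritPoly_iterate, abs_mul, S.sq_derivIter_mul]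

theorem invExpansion_nonneg (S : MTSetting a μ) (n : ℕ) (x : ℝ) : 0 ≤ invExpansion a n x :=
  Finset.prod_nonneg fun _ _ => div_nonneg (Real.sqrt_nonneg _) (by linarith [S.pos])

theorem continuous_invExpansion (n : ℕ) : Continuous (invExpansion a n) := by
  refine continuous_finsetProd _ fun j _ => Continuous.div_const ?_ _
  exact (((quotPoly a).continuous.comp (continuous_iterate_Ta j)).abs).sqrt

theorem invExpansion_add (m n : ℕ) (x : ℝ) :
    invExpansion a (m + n) x = invExpansion a m x * invExpansion a n ((Ta a)^[m] x) := by
  unfold invExpansion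
  rw [Finset.prod_range_add]
  congr 1
  refine Finset.prod_congr rfl fun j _ => ?_
  rw [← Function.iterate_add_apply, add_comm]

/-- The polynomial whose absolute value is, up to a constant, the square of `invExpansion`. -/
theorem exists_poly_invExpansion (S : MTSetting a μ) (n : ℕ) :
    ∃ p : Polynomial ℝ, p ≠ 0 ∧ ∀ x, invExpansion a n x = √|p.eval x| := by
  refine ⟨Polynomial.C (1 / (2 * a) ^ 2) ^ n *
    ∏ j ∈ Finset.range n, (quotPoly a).comp (iterPoly a j), ?_, fun x => ?_⟩
  · refine mul_ne_zero (pow_ne_zero _ ?_) (Finset.prod_ne_zero_iff.2 fun j _ => ?_)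
    · have := S.pos
      rw [Polynomial.C_ne_zero]; positivity
    · intro h
      rw [Polynomial.comp_eq_zero_iff] at h
      rcases h with h | ⟨_, h⟩
      · exact S.quotPoly_ne_zero h
      · have := iterPoly_natDegree S.pos.ne' j
        rw [h, Polynomial.natDegree_C] at this
        exact absurd this.symm (by positivity)
  · have ha := S.pos
    symm
    rw [Real.sqrt_eq_iff_mul_self_eq (abs_nonneg _) (S.invExpansion_nonneg n x), invExpansion,
      ← Finset.prod_mul_distrib]
    simp only [Polynomial.eval_mul, Polynomial.eval_pow, Polynomial.eval_C, Polynomial.eval_prod,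
      Polynomial.eval_comp, iterPoly_eval]
    rw [abs_mul, Finset.abs_prod, abs_of_nonneg (by positivity)]
    have : (1 / (2 * a) ^ 2) ^ n = ∏ j ∈ Finset.range n, (1 / (2 * a) ^ 2) := by simp
    rw [this, ← Finset.prod_mul_distrib]
    refine Finset.prod_congr rfl fun j _ => ?_
    rw [div_mul_div_comm, Real.mul_self_sqrt (abs_nonneg _)]
    ring

theorem derivIter_ne_zero_of_mem_postCrit (S : MTSetting a μ) {z : ℝ} (hz : z ∈ postCrit a)
    (q : ℕ) : derivIter a q z ≠ 0 :=
  (derivIter_ne_zero_iff S.pos).2 fun j _ => S.iterate_ne_zero_of_mem_postCrit hz j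

theorem sq_invExpansion_periodic (S : MTSetting a μ) {z : ℝ} (hz : z ∈ postCrit a) {q : ℕ}
    (hq : (Ta a)^[q] z = z) : |derivIter a q z| * invExpansion a q z ^ 2 = 1 := by
  set W := postCritPoly a with hW
  set Q : ℝ → ℝ := fun x =>
    ∏ j ∈ Finset.range q, (((Ta a)^[j] x) ^ 2 * (quotPoly a).eval ((Ta a)^[j] x)) with hQ
  have hQd : Differentiable ℝ Q := by
    rw [hQ]
    refine Differentiable.fun_finsetProd fun j _ => ?_
    have h1 : Differentiable ℝ ((Ta a)^[j]) := fun x =>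
      (hasDerivAt_iterate_Ta j x).differentiableAt
    exact (h1.pow 2).mul ((quotPoly a).differentiable.comp h1)
  have h1 : HasDerivAt (fun x => W.eval ((Ta a)^[q] x))
      (W.derivative.eval z * derivIter a q z) z := by
    have := (W.hasDerivAt ((Ta a)^[q] z)).comp z (hasDerivAt_iterate_Ta (a := a) q z)
    rwa [hq] at this
  have h2 := (W.hasDerivAt z).mul (hQd z).hasDerivAt
  have h3 : (fun x => W.eval ((Ta a)^[q] x)) = (fun x => W.eval x) * Q := by
    ext x; exact S.eval_postCritPoly_iterate q x
  rw [h3] at h1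
  have h4 := h1.unique h2
  have hz0 : W.eval z = 0 := S.postCritPoly_eval_eq_zero.2 hz
  rw [hz0, zero_mul, add_zero] at h4
  have h5 := mul_left_cancel₀ (S.postCritPoly_derivative_ne_zero hz) h4
  have h6 := S.sq_derivIter_mul q z
  change _ = |Q z| at h6
  rw [← h5] at h6
  have h7 : |derivIter a q z| ≠ 0 := abs_ne_zero.2 (S.derivIter_ne_zero_of_mem_postCrit hz q)
  rw [← sq_abs (derivIter a q z)] at h6
  apply mul_left_cancel₀ h7
  rw [mul_one, ← mul_assoc, ← sq, h6]

/-- The polynomials `M_j` with `a T^j(0) = - M_j(a)`. -/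
noncomputable def critOrbitPoly : ℕ → Polynomial ℤ
  | 0 => 0
  | n + 1 => critOrbitPoly n ^ 2 - Polynomial.X

theorem aeval_critOrbitPoly (n : ℕ) :
    Polynomial.aeval a (critOrbitPoly n) = -(a * (Ta a)^[n] 0) := by
  induction n with
  | zero => simp [critOrbitPoly]
  | succ n ih =>
    rw [Function.iterate_succ_apply', critOrbitPoly, map_sub, map_pow, ih, Polynomial.aeval_X, Ta]
    ring

theorem critOrbitPoly_monic (n : ℕ) :
    (critOrbitPoly (n + 2)).Monic ∧ (critOrbitPoly (n + 2)).natDegree = 2 ^ (n + 1) := by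
  induction n with
  | zero =>
    have : critOrbitPoly 2 = Polynomial.X ^ 2 - Polynomial.X := by simp [critOrbitPoly]
    rw [this]
    have hd : (Polynomial.X : Polynomial ℤ).degree < (Polynomial.X ^ 2 : Polynomial ℤ).degree := by
      simp
    refine ⟨(Polynomial.monic_X_pow 2).sub_of_left hd, ?_⟩
    rw [Polynomial.natDegree_sub_eq_left_of_natDegree_lt] <;> simp
  | succ n ih =>
    have h1 : (critOrbitPoly (n + 2) ^ 2).natDegree = 2 ^ (n + 2) := by
      rw [ih.1.natDegree_pow, ih.2]; ring
    have hlt : (Polynomial.X : Polynomial ℤ).natDegree < (critOrbitPoly (n + 2) ^ 2).natDegree := by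
      rw [h1, Polynomial.natDegree_X]; exact Nat.one_lt_two_pow (by omega)
    refine ⟨(ih.1.pow 2).sub_of_left (Polynomial.degree_lt_degree hlt), ?_⟩
    rw [critOrbitPoly, Polynomial.natDegree_sub_eq_left_of_natDegree_lt hlt, h1]

theorem isIntegral_parameter (S : MTSetting a μ) : IsIntegral ℤ a := by
  obtain ⟨k, hk, p, hp, h⟩ := S.mis
  have hm := critOrbitPoly_monic (k + p - 2)
  rw [show k + p - 2 + 2 = k + p by omega] at hm
  have hlt : (critOrbitPoly k).natDegree < (critOrbitPoly (k + p)).natDegree := by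
    rw [hm.2]
    rcases Nat.lt_or_ge k 2 with hk2 | hk2
    · have : k = 1 := by omega
      subst this
      have : critOrbitPoly 1 = -Polynomial.X := by simp [critOrbitPoly]
      rw [this, Polynomial.natDegree_neg, Polynomial.natDegree_X]
      exact Nat.one_lt_two_pow (by omega)
    · have h2 := critOrbitPoly_monic (k - 2)
      rw [show k - 2 + 2 = k by omega] at h2
      rw [h2.2]
      exact Nat.pow_lt_pow_right (by norm_num) (by omega)
  refine ⟨critOrbitPoly (k + p) - critOrbitPoly k,
    hm.1.sub_of_left (Polynomial.degree_lt_degree hlt), ?_⟩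
  have := aeval_critOrbitPoly (a := a) (k + p)
  have h2 := aeval_critOrbitPoly (a := a) k
  rw [← Polynomial.aeval_def, map_sub, this, h2, h]
  ring

theorem abs_derivIter_ne_one (S : MTSetting a μ) {z : ℝ} (hz : z ∈ postCrit a) {q : ℕ}
    (hq : 1 ≤ q) : |derivIter a q z| ≠ 1 := by
  obtain ⟨i, _, rfl⟩ := hz
  intro h
  have hInt : ∀ n, IsIntegral ℤ (a * (Ta a)^[n] 0) := by
    intro n
    have h1 : IsIntegral ℤ (Polynomial.aeval a (critOrbitPoly n)) := by
      refine IsIntegral.of_mem_of_fg (Algebra.adjoin ℤ {a}) S.isIntegral_parameter.fg_adjoin_singleton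
        _ ?_
      exact Polynomial.aeval_mem_adjoin_singleton ℤ a
    rw [aeval_critOrbitPoly] at h1
    simpa using h1.neg
  set u : ℝ := ∏ j ∈ Finset.range q, (a * (Ta a)^[j + i] 0) with hu
  have hui : IsIntegral ℤ u := IsIntegral.prod _ fun j _ => hInt _
  have e : derivIter a q ((Ta a)^[i] 0) = (-2) ^ q * u := by
    rw [hu, derivIter]
    have : ((-2 : ℝ)) ^ q = ∏ j ∈ Finset.range q, (-2 : ℝ) := by simp
    rw [this, ← Finset.prod_mul_distrib]
    refine Finset.prod_congr rfl fun j _ => ?_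
    rw [Function.iterate_add_apply]; ring
  have h1 : 2 ^ q * |u| = 1 := by
    rw [← h, e, abs_mul, abs_pow]; norm_num
  have hui' : IsIntegral ℤ |u| := by
    rcases abs_choice u with h | h <;> rw [h]
    exacts [hui, hui.neg]
  have h2 : |u| = algebraMap ℚ ℝ (1 / 2 ^ q) := by
    have : (2 : ℝ) ^ q ≠ 0 := by positivity
    simp only [eq_ratCast]
    push_cast
    field_simp
    linarith
  rw [h2] at hui'
  have h3 : IsIntegral ℤ (1 / 2 ^ q : ℚ) := (isIntegral_algebraMap_iff
    (algebraMap ℚ ℝ).injective).1 hui'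
  obtain ⟨y, hy⟩ := IsIntegrallyClosed.isIntegral_iff.1 h3
  have h4 : (y : ℚ) * 2 ^ q = 1 := by
    have : (2 : ℚ) ^ q ≠ 0 := by positivity
    have hy' : (y : ℚ) = 1 / 2 ^ q := by simpa using hy
    rw [hy']; field_simp
  have h5 : y * 2 ^ q = 1 := by exact_mod_cast h4
  have h6 : (2 : ℤ) ∣ 1 := by
    rw [← h5]; exact Dvd.dvd.mul_left (dvd_pow_self 2 (by omega)) y
  norm_num at h6

end MTSetting

namespace MTSetting

variable {a : ℝ} {μ : Measure ℝ}

theorem support_subset_Icc (S : MTSetting a μ) : μ.support ⊆ Icc (-1) 1 :=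
  Measure.support_subset_of_isClosed isClosed_Icc S.ae_mem_Icc

theorem isCompact_support (S : MTSetting a μ) : IsCompact μ.support :=
  isCompact_Icc.of_isClosed_subset Measure.isClosed_support S.support_subset_Icc

theorem mapsTo_support (S : MTSetting a μ) : MapsTo (Ta a) μ.support μ.support := by
  intro x hx
  rw [Measure.mem_support_iff_forall] at hx ⊢
  intro U hU
  obtain ⟨V, hVU, hV, hxV⟩ := mem_nhds_iff.1 hU
  have h1 := hx (Ta a ⁻¹' V) (continuous_Ta.continuousAt.preimage_mem_nhds (hV.mem_nhds hxV))
  rw [S.mp.measure_preimage hV.measurableSet.nullMeasurableSet] at h1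
  exact h1.trans_le (measure_mono hVU)

theorem iterate_mem_support (S : MTSetting a μ) {x : ℝ} (hx : x ∈ μ.support) (n : ℕ) :
    (Ta a)^[n] x ∈ μ.support := S.mapsTo_support.iterate n hx

theorem measure_ball_pos (S : MTSetting a μ) {x : ℝ} (hx : x ∈ μ.support) {r : ℝ} (hr : 0 < r) :
    0 < μ (Metric.ball x r) :=
  (Measure.mem_support_iff_forall x).1 hx _ (Metric.ball_mem_nhds x hr)

/-- An invariant set on which an even iterate is monotone is negligible. -/
theorem measure_eq_zero_of_monotoneOn (S : MTSetting a μ) {D : Set ℝ} (mD : MeasurableSet D)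
    {n : ℕ} (hn : 1 ≤ n) (hD : MapsTo ((Ta a)^[n]) D D) (hm : MonotoneOn ((Ta a)^[n]) D) :
    μ D = 0 := by
  have := S.prob
  have h1 := ae_eq_self_of_monotoneOn (S.mp.iterate n) mD hD hm
  have h2 : ∀ᵐ x ∂μ, ¬ (Ta a)^[n] x = x := by
    rw [ae_iff]
    simpa using S.null_of_finite (finite_iterate_Ta_fixed S.pos.ne' hn)
  rw [measure_eq_zero_iff_ae_notMem]
  filter_upwards [h1, h2] with x h1 h2 h
  exact h2 (h1 h)

/-- Absence of homtervals: an interval of positive measure eventually covers the critical point. -/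
theorem exists_iterate_eq_zero (S : MTSetting a μ) {U : Set ℝ} (hU : U.OrdConnected)
    (hpos : μ U ≠ 0) : ∃ x ∈ U, ∃ n, (Ta a)^[n] x = 0 := by
  have := S.prob
  by_contra! hcon
  obtain ⟨x, hx, p, hp, hpx⟩ := S.mp.conservative.exists_mem_iterate_mem
    hU.measurableSet.nullMeasurableSet hpos
  set H : Set ℝ := ⋃ k : ℕ, (Ta a)^[k * p] '' U with hH
  have hUH : U ⊆ H := fun y hy => mem_iUnion.2 ⟨0, y, hy, by simp⟩
  have hpre : IsPreconnected H := by
    refine IsPreconnected.iUnion_of_chain (fun k => hU.isPreconnected.image _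
      (continuous_iterate_Ta _).continuousOn) fun k => ?_
    refine ⟨(Ta a)^[k * p] ((Ta a)^[p] x), ⟨_, hpx, rfl⟩, x, hx, ?_⟩
    rw [← Function.iterate_add_apply]
    congr 2
    rw [Order.succ_eq_add_one]; ring
  have hmaps : MapsTo ((Ta a)^[p]) H H := by
    intro y hy
    obtain ⟨k, w, hw, rfl⟩ := mem_iUnion.1 hy
    refine mem_iUnion.2 ⟨k + 1, w, hw, ?_⟩
    rw [← Function.iterate_add_apply]
    congr 2; ring
  have hne : ∀ y ∈ H, ∀ n, (Ta a)^[n] y ≠ 0 := by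
    intro y hy n
    obtain ⟨k, w, hw, rfl⟩ := mem_iUnion.1 hy
    rw [← Function.iterate_add_apply]
    exact hcon w hw _
  have hDne : ∀ y ∈ H, derivIter a p y ≠ 0 := fun y hy =>
    (derivIter_ne_zero_iff S.pos).2 fun j _ => hne y hy j
  have hsign : ∀ y ∈ H, ∀ z ∈ H, 0 < derivIter a p y * derivIter a p z := by
    intro y hy z hz
    by_contra hle
    rw [not_lt] at hle
    have h0 : ∃ w ∈ H, derivIter a p w = 0 := by
      have himg := hpre.image _ (continuous_derivIter (a := a) p).continuousOn
      have hoc := himg.ordConnected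
      rcases mul_nonpos_iff.1 hle with h | h
      · exact hoc.out (mem_image_of_mem _ hz) (mem_image_of_mem _ hy) ⟨h.2, h.1⟩
      · exact hoc.out (mem_image_of_mem _ hy) (mem_image_of_mem _ hz) ⟨h.1, h.2⟩
    obtain ⟨w, hw, h0⟩ := h0
    exact hDne w hw h0
  have hmono : MonotoneOn ((Ta a)^[p + p]) H := by
    refine monotoneOn_of_deriv_nonneg hpre.ordConnected.convex
      (continuous_iterate_Ta _).continuousOn
      (fun y _ => (hasDerivAt_iterate_Ta _ y).differentiableAt.differentiableWithinAt)
      fun y hy => ?_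
    have hy := interior_subset hy
    rw [(hasDerivAt_iterate_Ta _ y).deriv, derivIter_add]
    exact (hsign y hy _ (hmaps hy)).le
  have h0 := S.measure_eq_zero_of_monotoneOn hpre.ordConnected.measurableSet (n := p + p)
    (by omega) (by rw [Function.iterate_add]; exact hmaps.comp hmaps) hmono
  exact hpos (measure_mono_null hUH h0)

/-- Postcritical cycles in the support are repelling. -/
theorem one_lt_abs_derivIter (S : MTSetting a μ) {z : ℝ} (hz : z ∈ postCrit a)
    (hzS : z ∈ μ.support) {q : ℕ} (hq : 1 ≤ q) (hzq : (Ta a)^[q] z = z) :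
    1 < |derivIter a q z| := by
  refine lt_of_le_of_ne (not_lt.1 fun hlt => ?_) (S.abs_derivIter_ne_one hz hq).symm
  have hD : derivIter a (q + q) z = derivIter a q z ^ 2 := by
    rw [derivIter_add, hzq]; ring
  have h0 : 0 < derivIter a (q + q) z := by
    rw [hD]; have := S.derivIter_ne_zero_of_mem_postCrit hz q; positivity
  have h1 : derivIter a (q + q) z < 1 := by
    rw [hD, ← sq_abs]; have := abs_nonneg (derivIter a q z); nlinarith
  have hev : ∀ᶠ y in 𝓝 z, 0 < derivIter a (q + q) y ∧ derivIter a (q + q) y < 1 :=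
    ((continuous_derivIter _).continuousAt.eventually_const_lt h0).and
      ((continuous_derivIter _).continuousAt.eventually_lt_const h1)
  obtain ⟨ρ, hρ, hball⟩ := Metric.eventually_nhds_iff_ball.1 hev
  have hzqq : (Ta a)^[q + q] z = z := by rw [Function.iterate_add_apply, hzq, hzq]
  refine (S.measure_ball_pos hzS hρ).ne' (S.measure_eq_zero_of_monotoneOn measurableSet_ball
    (n := q + q) (by omega) ?_ ?_)
  · intro y hy
    have := (convex_ball z ρ).norm_image_sub_le_of_norm_hasDerivWithin_le (C := 1)
      (fun w _ => (hasDerivAt_iterate_Ta (a := a) (q + q) w).hasDerivWithinAt)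
      (fun w hw => by
        rw [Real.norm_eq_abs, abs_of_pos (hball w hw).1]; exact (hball w hw).2.le)
      (Metric.mem_ball_self hρ) hy
    rw [hzqq, one_mul] at this
    rw [mem_ball_iff_norm] at hy ⊢
    exact this.trans_lt hy
  · refine monotoneOn_of_deriv_nonneg (convex_ball z ρ)
      (continuous_iterate_Ta _).continuousOn
      (fun y _ => (hasDerivAt_iterate_Ta _ y).differentiableAt.differentiableWithinAt)
      fun y hy => ?_
    rw [(hasDerivAt_iterate_Ta _ y).deriv]
    exact (hball y (interior_subset hy)).1.le

theorem exists_periodic_iterate (S : MTSetting a μ) {c : ℝ} (hc : c ∈ postCrit a) :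
    ∃ i q, 1 ≤ q ∧ (Ta a)^[q] ((Ta a)^[i] c) = (Ta a)^[i] c := by
  have hfin := S.postCrit_finite
  obtain ⟨i, _, j, _, hij, h⟩ := infinite_univ.exists_lt_map_eq_of_mapsTo
    (f := fun i : ℕ => (Ta a)^[i] c) (fun i _ => iterate_mem_postCrit hc i) hfin
  refine ⟨i, j - i, by omega, ?_⟩
  rw [← Function.iterate_add_apply, show j - i + i = j by omega]
  exact h.symm

/-- An orbit avoiding the postcritical set stays away from it infinitely often. -/
theorem frequently_far_postCrit (S : MTSetting a μ) {x : ℝ} (hx : x ∈ μ.support)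
    (hxP : ∀ n, (Ta a)^[n] x ∉ postCrit a) :
    ∃ δ > 0, ∃ᶠ n in atTop, ∀ c ∈ postCrit a, δ ≤ |(Ta a)^[n] x - c| := by
  by_contra hcon
  simp only [not_exists, not_and, not_frequently] at hcon
  push Not at hcon
  -- separation of the postcritical set
  obtain ⟨s, hs, hsep⟩ : ∃ s > 0, ∀ c ∈ postCrit a, ∀ d ∈ postCrit a, |c - d| < s → c = d := by
    have hfin := (S.postCrit_finite.prod S.postCrit_finite)
    have : ∀ᶠ s in 𝓝[>] (0 : ℝ), ∀ e ∈ postCrit a ×ˢ postCrit a, |e.1 - e.2| < s → e.1 = e.2 := by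
      rw [hfin.eventually_all]
      intro e _
      by_cases h : e.1 = e.2
      · simp [h]
      · have : 0 < |e.1 - e.2| := abs_pos.2 (sub_ne_zero.2 h)
        filter_upwards [Ioo_mem_nhdsGT this] with s hs h'
        exact absurd h' (not_lt.2 hs.2.le)
    obtain ⟨s, h, hs⟩ := (this.and self_mem_nhdsWithin).exists
    exact ⟨s, hs, fun c hc d hd => h (c, d) ⟨hc, hd⟩⟩
  obtain ⟨N, hN⟩ := eventually_atTop.1 (hcon (s / 5) (by positivity))
  choose! c hcP hcd using hN
  have hstep : ∀ n ≥ N, c (n + 1) = Ta a (c n) := by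
    intro n hn
    refine hsep _ (hcP _ (by omega)) _ (mapsTo_postCrit (hcP n hn)) ?_
    have h1 := hcd (n + 1) (by omega)
    have h2 := Ta_lipschitz_Icc S.ha (S.support_subset_Icc (S.iterate_mem_support hx n))
      (S.postCrit_subset (hcP n hn))
    rw [Function.iterate_succ_apply'] at h1
    have h3 := hcd n hn
    rw [abs_lt] at h1 ⊢
    rw [abs_le] at h2
    constructor <;> linarith [h1.1, h1.2, h2.1, h2.2]
  have hiter : ∀ k, c (N + k) = (Ta a)^[k] (c N) := by
    intro k
    induction k with
    | zero => rfl
    | succ k ih => rw [← add_assoc, hstep _ (by omega), ih, Function.iterate_succ_apply']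
  obtain ⟨i, q, hq, hper⟩ := S.exists_periodic_iterate (hcP N le_rfl)
  set z := (Ta a)^[i] (c N) with hz
  have hzP : z ∈ postCrit a := iterate_mem_postCrit (hcP N le_rfl) i
  have hck : ∀ k, c (N + i + k * q) = z := by
    intro k
    rw [add_assoc, hiter, add_comm i, Function.iterate_add_apply, ← hz, mul_comm,
      Function.iterate_mul]
    exact Function.iterate_fixed hper k
  -- the orbit along the period converges to `z`
  have hlim : Tendsto (fun k => (Ta a)^[N + i + k * q] x) atTop (𝓝 z) := by
    rw [Metric.tendsto_atTop]
    intro ε hε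
    obtain ⟨M, hM⟩ := eventually_atTop.1 (hcon (min ε (s / 5)) (by positivity))
    refine ⟨M, fun k hk => ?_⟩
    have hk' : k ≤ N + i + k * q := by nlinarith
    obtain ⟨d, hd, hdd⟩ := hM (N + i + k * q) (hk.le.trans hk')
    have h1 := hcd (N + i + k * q) (by nlinarith)
    rw [hck] at h1
    have : d = z := by
      refine hsep d hd z hzP ?_
      have h2 := hdd.trans_le (min_le_right _ _)
      rw [abs_lt] at *
      constructor <;> linarith [h1.1, h1.2, h2.1, h2.2]
    rw [Real.dist_eq, ← this]
    exact hdd.trans_le (min_le_left _ _)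
  have hzS : z ∈ μ.support :=
    Measure.isClosed_support.mem_of_tendsto hlim
      (Eventually.of_forall fun k => S.iterate_mem_support hx _)
  have hrep := S.one_lt_abs_derivIter hzP hzS hq hper
  have hgrow : ∀ᶠ y in 𝓝 z, |y - z| ≤ |(Ta a)^[q] y - z| := by
    have hd := hasDerivAt_iterate_Ta (a := a) q z
    have h1 := (hasDerivAt_iff_tendsto_slope.1 hd).abs.eventually_const_lt hrep
    rw [eventually_nhdsWithin_iff] at h1
    filter_upwards [h1] with y hy
    by_cases hyz : y = z
    · simp [hyz]
    · have := hy hyz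
      rw [slope_def_field, hper, abs_div, one_lt_div (abs_pos.2 (sub_ne_zero.2 hyz))] at this
      exact this.le
  obtain ⟨K, hK⟩ := eventually_atTop.1 (hlim.eventually hgrow)
  have hmono : ∀ k, |(Ta a)^[N + i + K * q] x - z| ≤ |(Ta a)^[N + i + (K + k) * q] x - z| := by
    intro k
    induction k with
    | zero => simp
    | succ k ih =>
      refine ih.trans ((hK (K + k) (by omega)).trans_eq ?_)
      rw [← Function.iterate_add_apply]
      congr 3; ring
  have h0 : Tendsto (fun k => |(Ta a)^[N + i + (K + k) * q] x - z|) atTop (𝓝 0) := by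
    have h1 : Tendsto (fun k => (Ta a)^[N + i + (K + k) * q] x) atTop (𝓝 z) :=
      hlim.comp (f := fun k => K + k) (tendsto_atTop_mono (fun k => Nat.le_add_left k K) tendsto_id)
    simpa using (h1.sub_const z).abs
  have := ge_of_tendsto' h0 hmono
  have h2 : (Ta a)^[N + i + K * q] x = z := by
    have := abs_nonpos_iff.1 this
    linarith
  exact hxP _ (h2 ▸ hzP)

/-- If derivatives stay bounded along an orbit that avoids the postcritical set, then the point
has a neighbourhood on which all iterates avoid the critical point. -/
theorem exists_ball_iterate_ne_zero (S : MTSetting a μ) {x : ℝ} (hx : x ∈ μ.support)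
    (hxP : ∀ n, (Ta a)^[n] x ∉ postCrit a) {C : ℝ} (hC : ∀ n, |derivIter a n x| ≤ C) :
    ∃ η > 0, ∀ y ∈ Metric.ball x η, ∀ j, (Ta a)^[j] y ≠ 0 := by
  obtain ⟨δ, hδ, hfreq⟩ := S.frequently_far_postCrit hx hxP
  have hC1 : 1 ≤ C := by simpa [derivIter] using hC 0
  have hxI := S.support_subset_Icc hx
  have hne1 : x ≠ 1 := fun h => hxP 0 (by simpa [h] using one_mem_postCrit)
  have hTm1 : Ta a (-1) ∈ postCrit a := by
    have : Ta a (-1) = Ta a 1 := by simp [Ta]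
    rw [this]; exact mapsTo_postCrit one_mem_postCrit
  have hnem1 : x ≠ -1 := fun h => hxP 1 (by simpa [h] using hTm1)
  refine ⟨δ / (2 * C), by positivity, fun y hy j hj => ?_⟩
  obtain ⟨n, hn, hfar⟩ := (frequently_atTop.1 hfreq) (j + 1)
  have hcl : IsClosed ((Ta a)^[n] ⁻¹' postCrit a) :=
    S.postCrit_finite.isClosed.preimage (continuous_iterate_Ta n)
  have h1 : IsCompact (Icc (-1) x ∩ (Ta a)^[n] ⁻¹' postCrit a) := isCompact_Icc.inter_right hcl
  have h2 : IsCompact (Icc x 1 ∩ (Ta a)^[n] ⁻¹' postCrit a) := isCompact_Icc.inter_right hcl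
  obtain ⟨p, hp⟩ := h1.exists_isGreatest ⟨-1, ⟨le_rfl, hxI.1⟩,
    iterate_mem_postCrit_of_le (m := 1) (by omega) (by simpa using hTm1)⟩
  obtain ⟨q, hq⟩ := h2.exists_isLeast ⟨1, ⟨hxI.2, le_rfl⟩, iterate_mem_postCrit one_mem_postCrit n⟩
  have hpx : p < x := lt_of_le_of_ne hp.1.1.2 fun h => hxP n (h ▸ hp.1.2)
  have hxq : x < q := lt_of_le_of_ne hq.1.1.1 fun h => hxP n (h ▸ hq.1.2)
  have hno : ∀ w ∈ Ioo p q, ∀ i < n, (Ta a)^[i] w ≠ 0 := by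
    intro w hw i hi h0
    have hwP : w ∈ (Ta a)^[n] ⁻¹' postCrit a := iterate_mem_postCrit_of_eq_zero hi h0
    rcases le_total w x with h | h
    · exact absurd (hp.2 ⟨⟨hp.1.1.1.trans hw.1.le, h⟩, hwP⟩) (not_le.2 hw.1)
    · exact absurd (hq.2 ⟨⟨h, hw.2.le.trans hq.1.1.2⟩, hwP⟩) (not_le.2 hw.2)
  have hsign : ∀ i < n, 0 ≤ (Ta a)^[i] p * (Ta a)^[i] q := by
    intro i hi
    by_contra hlt
    rw [not_le] at hlt
    have hc := (continuous_iterate_Ta (a := a) i).continuousOn (s := Icc p q)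
    rcases mul_neg_iff.1 hlt with h | h
    · obtain ⟨w, hw, h0⟩ := intermediate_value_Ioo' (hpx.trans hxq).le hc ⟨h.2, h.1⟩
      exact hno w hw i hi h0
    · obtain ⟨w, hw, h0⟩ := intermediate_value_Ioo (hpx.trans hxq).le hc ⟨h.1, h.2⟩
      exact hno w hw i hi h0
  have hk := koebe_iterate S.pos n (Or.inl ⟨hpx, hxq⟩) hsign
  have hb1 : 1 / |(Ta a)^[n] x - (Ta a)^[n] p| ≤ 1 / δ :=
    one_div_le_one_div_of_le hδ (hfar _ hp.1.2)
  have hb2 : 1 / |(Ta a)^[n] q - (Ta a)^[n] x| ≤ 1 / δ := by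
    rw [abs_sub_comm]
    exact one_div_le_one_div_of_le hδ (hfar _ hq.1.2)
  have hR : 1 / |x - p| + 1 / |q - x| ≤ 2 * C / δ := by
    refine hk.trans ?_
    calc _ ≤ C * (1 / δ + 1 / δ) := by
          refine mul_le_mul (hC n) (add_le_add hb1 hb2) (by positivity) (by linarith)
      _ = _ := by ring
  rw [abs_of_pos (sub_pos.2 hpx), abs_of_pos (sub_pos.2 hxq)] at hR
  have i1 := one_div_pos.2 (sub_pos.2 hpx)
  have i2 := one_div_pos.2 (sub_pos.2 hxq)
  have e : (2 * C / δ) = 1 / (δ / (2 * C)) := by field_simp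
  rw [e] at hR
  have hpos : 0 < δ / (2 * C) := by positivity
  have j1 : δ / (2 * C) ≤ x - p := by
    refine (one_div_le_one_div (sub_pos.2 hpx) hpos).1 (by linarith)
  have j2 : δ / (2 * C) ≤ q - x := by
    refine (one_div_le_one_div (sub_pos.2 hxq) hpos).1 (by linarith)
  rw [Metric.mem_ball, Real.dist_eq, abs_lt] at hy
  exact hno y ⟨by linarith [hy.1], by linarith [hy.2]⟩ j (by omega) hj

theorem exists_invExpansion_lt_one (S : MTSetting a μ) {x : ℝ} (hx : x ∈ μ.support) :
    ∃ n, 1 ≤ n ∧ invExpansion a n x < 1 := by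
  by_contra! hcon
  by_cases hxP : ∀ n, (Ta a)^[n] x ∉ postCrit a
  · -- bounded derivatives
    obtain ⟨M, hM⟩ := (isCompact_Icc (a := (-1 : ℝ)) (b := 1)).exists_bound_of_continuousOn
      (postCritPoly a).continuous.continuousOn
    have hw : 0 < |(postCritPoly a).eval x| :=
      abs_pos.2 fun h => hxP 0 (S.postCritPoly_eval_eq_zero.1 h)
    have hxI := S.support_subset_Icc hx
    have hM0 : 0 ≤ M := (norm_nonneg _).trans (hM x hxI)
    have hb : ∀ n, |derivIter a n x| ≤ √(M / |(postCritPoly a).eval x|) := by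
      intro n
      apply Real.abs_le_sqrt
      rw [le_div_iff₀ hw]
      have h1 := S.abs_postCritPoly_iterate n x
      have h2 := hM _ (iterate_Ta_mem_Icc S.ha n hxI)
      rw [Real.norm_eq_abs, h1] at h2
      have h3 : 1 ≤ invExpansion a n x := by
        rcases Nat.eq_zero_or_pos n with rfl | hn
        · simp [invExpansion]
        · exact hcon n hn
      have h4 : 1 ≤ invExpansion a n x ^ 2 := by nlinarith
      have h5 := mul_nonneg (mul_nonneg hw.le (sq_nonneg (derivIter a n x))) (sub_nonneg.2 h4)
      nlinarith
    obtain ⟨η, hη, hball⟩ := S.exists_ball_iterate_ne_zero hx hxP hb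
    have hoc : (Metric.ball x η).OrdConnected := (convex_ball x η).ordConnected
    obtain ⟨y, hy, n, hn⟩ := S.exists_iterate_eq_zero hoc (S.measure_ball_pos hx hη).ne'
    exact hball y hy n hn
  · push Not at hxP
    obtain ⟨j, hj⟩ := hxP
    obtain ⟨i, q, hq, hper⟩ := S.exists_periodic_iterate hj
    rw [← Function.iterate_add_apply (Ta a) i j x] at hper
    set z := (Ta a)^[i + j] x with hz
    have hzP : z ∈ postCrit a := by
      rw [hz, Function.iterate_add_apply]; exact iterate_mem_postCrit hj i
    have h1 := S.one_lt_abs_derivIter hzP (S.iterate_mem_support hx _) hq hper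
    have h2 := S.sq_invExpansion_periodic hzP hper
    have h3 : invExpansion a q z < 1 := by
      by_contra h
      rw [not_lt] at h
      have : 1 ≤ invExpansion a q z ^ 2 := by nlinarith
      nlinarith
    have h4 : ∀ k, invExpansion a (i + j + k * q) x =
        invExpansion a (i + j) x * invExpansion a q z ^ k := by
      intro k
      induction k with
      | zero => simp
      | succ k ih =>
        rw [add_mul, one_mul, ← add_assoc, invExpansion_add, ih, pow_succ, mul_assoc]
        congr 3
        rw [add_comm, Function.iterate_add_apply, ← hz, mul_comm, Function.iterate_mul]
        exact Function.iterate_fixed hper k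
    have h5 : Tendsto (fun k => invExpansion a (i + j + k * q) x) atTop (𝓝 0) := by
      simp_rw [h4]
      simpa using (tendsto_pow_atTop_nhds_zero_of_lt_one (S.invExpansion_nonneg q z) h3).const_mul
        (invExpansion a (i + j) x)
    obtain ⟨k, hk, hk1⟩ := ((h5.eventually_lt_const one_pos).and (eventually_ge_atTop 1)).exists
    exact absurd hk (not_lt.2 (hcon _ (by nlinarith)))

/-- Uniform expansion on the support. -/
theorem exists_invExpansion_le (S : MTSetting a μ) {η : ℝ} (hη : 0 < η) :
    ∃ n, 1 ≤ n ∧ ∀ x ∈ μ.support, invExpansion a n x < η := by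
  have := S.prob
  set V : ℕ → Set ℝ := fun N =>
    ⋃ n ∈ Icc 1 N, {x | invExpansion a n x < (1 - 1 / ((N : ℝ) + 2)) ^ n} with hV
  have hVo : ∀ N, IsOpen (V N) := fun N => isOpen_biUnion fun n _ =>
    isOpen_lt (continuous_invExpansion n) continuous_const
  have hmonoV : Monotone V := by
    intro M N hMN
    refine biUnion_mono (Icc_subset_Icc_right hMN) fun n _ x hx => ?_
    refine lt_of_lt_of_le (mem_ofPred_eq ▸ hx : invExpansion a n x < _) (pow_le_pow_left₀ ?_ ?_ n)
    · rw [sub_nonneg, div_le_one (by positivity)]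
      have : (0 : ℝ) ≤ M := by positivity
      linarith
    · have : (M : ℝ) ≤ N := by exact_mod_cast hMN
      gcongr
  obtain ⟨N, hN⟩ := S.isCompact_support.elim_directed_cover V hVo (fun x hx => by
    obtain ⟨n, hn, hlt⟩ := S.exists_invExpansion_lt_one hx
    have hlim : Tendsto (fun N : ℕ => (1 - 1 / ((N : ℝ) + 2)) ^ n) atTop (𝓝 1) := by
      have h1 : Tendsto (fun N : ℕ => 1 / ((N : ℝ) + 2)) atTop (𝓝 0) := by
        have := (tendsto_one_div_add_atTop_nhds_zero_nat (𝕜 := ℝ)).comp (tendsto_add_atTop_nat 1)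
        refine this.congr fun N => ?_
        simp; ring
      simpa using (h1.const_sub 1).pow n
    obtain ⟨N, hN, hn2⟩ := ((hlim.eventually_const_lt hlt).and (eventually_ge_atTop n)).exists
    exact mem_iUnion.2 ⟨N, mem_biUnion (x := n) ⟨hn, hn2⟩ hN⟩) hmonoV.directed_le
  set ρ : ℝ := 1 - 1 / ((N : ℝ) + 2) with hρ
  have hρ1 : ρ < 1 := by rw [hρ]; have : 0 < 1 / ((N : ℝ) + 2) := by positivity
                         linarith
  have hρ0 : 0 < ρ := by
    rw [hρ, sub_pos, div_lt_one (by positivity)]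
    have : (0 : ℝ) ≤ N := by positivity
    linarith
  obtain ⟨C, hC0, hC⟩ : ∃ C, 0 ≤ C ∧ ∀ j < N, ∀ x ∈ μ.support, invExpansion a j x ≤ C := by
    have hb : ∀ j, ∃ C, ∀ x ∈ μ.support, ‖invExpansion a j x‖ ≤ C := fun j =>
      S.isCompact_support.exists_bound_of_continuousOn (continuous_invExpansion j).continuousOn
    choose c hc using hb
    refine ⟨∑ j ∈ Finset.range N, |c j|, by positivity, fun j hj x hx => ?_⟩
    refine (le_abs_self _).trans ((hc j x hx).trans ((le_abs_self _).trans ?_))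
    exact Finset.single_le_sum (f := fun j => |c j|) (fun _ _ => abs_nonneg _)
      (Finset.mem_range.2 hj)
  have key : ∀ M, ∀ x ∈ μ.support, invExpansion a M x ≤ C / ρ ^ N * ρ ^ M := by
    intro M
    induction M using Nat.strong_induction_on with
    | _ M ih =>
      intro x hx
      rcases Nat.lt_or_ge M N with h | h
      · refine (hC M h x hx).trans ?_
        rw [div_mul_eq_mul_div, le_div_iff₀ (by positivity)]
        exact mul_le_mul_of_nonneg_left (pow_le_pow_of_le_one hρ0.le hρ1.le h.le) hC0
      · obtain ⟨n, hn, hlt⟩ := mem_iUnion₂.1 (hN hx)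
        obtain ⟨k, rfl⟩ := Nat.exists_eq_add_of_le (hn.2.trans h)
        rw [invExpansion_add, pow_add]
        have h1 := ih k (by have := hn.1; omega) _ (S.iterate_mem_support hx n)
        have h2 : invExpansion a n x ≤ ρ ^ n := le_of_lt hlt
        calc _ ≤ ρ ^ n * (C / ρ ^ N * ρ ^ k) :=
              mul_le_mul h2 h1 (S.invExpansion_nonneg _ _) (by positivity)
          _ = _ := by ring
  have hlim : Tendsto (fun M => C / ρ ^ N * ρ ^ M) atTop (𝓝 0) := by
    simpa using (tendsto_pow_atTop_nhds_zero_of_lt_one hρ0.le hρ1).const_mul (C / ρ ^ N)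
  obtain ⟨n, hn, hn1⟩ := ((hlim.eventually_lt_const hη).and (eventually_ge_atTop 1)).exists
  exact ⟨n, hn1, fun x hx => (key n x hx).trans_lt hn⟩

end MTSetting

/-- Dual formulation of bounded variation of the density of `ν` with respect to `m`. -/
def VarLE (m ν : Measure ℝ) (V : ℝ) : Prop :=
  ∀ θ : ℝ → ℝ, Measurable θ → (∃ C, ∀ x, |θ x| ≤ C) →
    (∀ J : Set ℝ, J.OrdConnected → |∫ x in J, θ x ∂m| ≤ 1) → ∫ x, θ x ∂ν ≤ V

namespace VarLE

variable {m ν : Measure ℝ} {V : ℝ}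

theorem nonneg (h : VarLE m ν V) : 0 ≤ V := by
  simpa using h (fun _ => 0) measurable_const ⟨0, by simp⟩ (by simp)

theorem mono (h : VarLE m ν V) {V' : ℝ} (hV : V ≤ V') : VarLE m ν V' :=
  fun θ h1 h2 h3 => (h θ h1 h2 h3).trans hV

theorem integral_le (h : VarLE m ν V) {θ : ℝ → ℝ} (hθ : Measurable θ) {C : ℝ}
    (hC : ∀ x, |θ x| ≤ C) {b : ℝ} (hb : 0 ≤ b)
    (hJ : ∀ J : Set ℝ, J.OrdConnected → |∫ x in J, θ x ∂m| ≤ b) : ∫ x, θ x ∂ν ≤ b * V := by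
  have key : ∀ ε > 0, ∫ x, θ x ∂ν ≤ (b + ε) * V := by
    intro ε hε
    have hbε : 0 < b + ε := by linarith
    have := h (fun x => (b + ε)⁻¹ * θ x) (hθ.const_mul _) ⟨(b + ε)⁻¹ * C, fun x => by
      rw [abs_mul, abs_of_pos (inv_pos.2 hbε)]
      exact mul_le_mul_of_nonneg_left (hC x) (inv_pos.2 hbε).le⟩ (fun J hJ' => by
      rw [integral_const_mul, abs_mul, abs_of_pos (inv_pos.2 hbε), inv_mul_le_iff₀ hbε]
      linarith [hJ J hJ'])
    rwa [integral_const_mul, inv_mul_le_iff₀ hbε] at this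
  have hlim : Tendsto (fun ε : ℝ => (b + ε) * V) (𝓝[>] 0) (𝓝 (b * V)) := by
    have : Tendsto (fun ε : ℝ => (b + ε) * V) (𝓝 0) (𝓝 ((b + 0) * V)) :=
      (tendsto_id.const_add b).mul_const V
    rw [add_zero] at this
    exact this.mono_left nhdsWithin_le_nhds
  exact ge_of_tendsto hlim (by filter_upwards [self_mem_nhdsWithin] with ε hε using key ε hε)

theorem abs_integral_le (h : VarLE m ν V) {θ : ℝ → ℝ} (hθ : Measurable θ) {C : ℝ}
    (hC : ∀ x, |θ x| ≤ C) {b : ℝ} (hb : 0 ≤ b)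
    (hJ : ∀ J : Set ℝ, J.OrdConnected → |∫ x in J, θ x ∂m| ≤ b) : |∫ x, θ x ∂ν| ≤ b * V := by
  refine abs_le.2 ⟨?_, h.integral_le hθ hC hb hJ⟩
  have := h.integral_le (θ := fun x => -θ x) hθ.neg (C := C) (by simpa using hC) hb
    (fun J hJ' => by rw [integral_neg, abs_neg]; exact hJ J hJ')
  rw [integral_neg] at this
  linarith

theorem measureReal_le [IsFiniteMeasure m] (h : VarLE m ν V) {A : Set ℝ} (hA : MeasurableSet A) :
    ν.real A ≤ m.real A * V := by
  have := h.integral_le (θ := A.indicator 1) (measurable_one.indicator hA) (C := 1)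
    (fun x => by by_cases hx : x ∈ A <;> simp [hx]) (measureReal_nonneg (μ := m) (s := A))
    (fun J hJ => by
      rw [integral_indicator_one hA, abs_of_nonneg measureReal_nonneg, Measure.real,
        Measure.restrict_apply hA]
      exact measureReal_mono inter_subset_left)
  rwa [integral_indicator_one hA] at this

theorem restrict (h : VarLE m ν V) {B : Set ℝ} (hB : B.OrdConnected) : VarLE m (ν.restrict B) V := by
  rintro θ h1 ⟨C, hC⟩ h3
  rw [← integral_indicator hB.measurableSet]
  refine h _ (h1.indicator hB.measurableSet) ⟨C, fun x => ?_⟩ fun J hJ => ?_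
  · by_cases hx : x ∈ B
    · simpa [hx] using hC x
    · simpa [hx] using (abs_nonneg _).trans (hC x)
  · rw [integral_indicator hB.measurableSet, Measure.restrict_restrict hB.measurableSet]
    exact h3 _ (hB.inter hJ)

end VarLE

section Pieces

variable {m : Measure ℝ} [IsFiniteMeasure m] {ℓ : ℝ → ℕ} {N : ℕ}

theorem ordConnected_fiber (hℓ : Monotone ℓ) (i : ℕ) : (ℓ ⁻¹' {i}).OrdConnected := by
  rw [ordConnected_iff]
  intro x hx y hy _ z hz
  have h1 := hℓ hz.1
  have h2 := hℓ hz.2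
  simp only [mem_preimage, mem_singleton_iff] at *
  omega

theorem measurableSet_fiber (hℓ : Monotone ℓ) (i : ℕ) : MeasurableSet (ℓ ⁻¹' {i}) :=
  (ordConnected_fiber hℓ i).measurableSet

theorem integral_eq_sum_fibers (κ : Measure ℝ) (hℓ : Monotone ℓ) (hN : ∀ x, ℓ x < N) {θ : ℝ → ℝ}
    (hθ : Integrable θ κ) :
    ∫ x, θ x ∂κ = ∑ i ∈ Finset.range N, ∫ x in ℓ ⁻¹' {i}, θ x ∂κ := by
  rw [← integral_biUnion_finset _ (fun i _ => measurableSet_fiber hℓ i)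
    (fun i _ j _ hij => by
      refine Disjoint.preimage _ ?_
      simpa using hij) (fun i _ => hθ.integrableOn)]
  have : (⋃ i ∈ Finset.range N, ℓ ⁻¹' {i}) = univ := by
    ext x; simp [hN x]
  rw [this, Measure.restrict_univ]

/-- A function with zero mean on each piece of an interval partition has integrals over intervals
controlled by those over intervals inside pieces. -/
theorem abs_setIntegral_le_of_pieces (hℓ : Monotone ℓ) (hN : ∀ x, ℓ x < N) {θ : ℝ → ℝ}
    (hθ : Integrable θ m) {b : ℝ} (h0 : ∀ i, ∫ x in ℓ ⁻¹' {i}, θ x ∂m = 0)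
    (hb : ∀ i, ∀ J : Set ℝ, J.OrdConnected → |∫ x in J ∩ ℓ ⁻¹' {i}, θ x ∂m| ≤ b)
    (J : Set ℝ) (hJ : J.OrdConnected) : |∫ x in J, θ x ∂m| ≤ 2 * b := by
  have hb0 : 0 ≤ b := (abs_nonneg _).trans (hb 0 J hJ)
  rw [integral_eq_sum_fibers _ hℓ hN hθ.integrableOn]
  have hrr : ∀ i, ∫ x in ℓ ⁻¹' {i}, θ x ∂(m.restrict J) = ∫ x in J ∩ ℓ ⁻¹' {i}, θ x ∂m := by
    intro i
    rw [Measure.restrict_restrict (measurableSet_fiber hℓ i), inter_comm]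
  simp_rw [hrr]
  classical
  set I := (Finset.range N).filter fun i => ∫ x in J ∩ ℓ ⁻¹' {i}, θ x ∂m ≠ 0 with hI
  rw [← Finset.sum_filter_ne_zero, ← hI]
  have hne : ∀ i ∈ I, (J ∩ ℓ ⁻¹' {i}).Nonempty := by
    intro i hi
    by_contra h
    rw [not_nonempty_iff_eq_empty] at h
    have := (Finset.mem_filter.1 hi).2
    rw [h] at this
    simp at this
  have hcard : I.card ≤ 2 := by
    rcases I.eq_empty_or_nonempty with h | h
    · simp [h]
    · refine (Finset.card_le_card (t := {I.min' h, I.max' h}) fun j hj => ?_).trans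
        Finset.card_le_two
      by_contra hcon
      simp only [Finset.mem_insert, Finset.mem_singleton, not_or] at hcon
      have h1 : I.min' h < j := lt_of_le_of_ne (I.min'_le j hj) (Ne.symm hcon.1)
      have h2 : j < I.max' h := lt_of_le_of_ne (I.le_max' j hj) hcon.2
      obtain ⟨x, hx, hxi⟩ := hne _ (I.min'_mem h)
      obtain ⟨y, hy, hyi⟩ := hne _ (I.max'_mem h)
      have hsub : ℓ ⁻¹' {j} ⊆ J := by
        intro w hw
        simp only [mem_preimage, mem_singleton_iff] at hw hxi hyi
        refine hJ.out hx hy ⟨?_, ?_⟩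
        · by_contra hlt
          have := hℓ (not_le.1 hlt).le
          omega
        · by_contra hlt
          have := hℓ (not_le.1 hlt).le
          omega
      have := (Finset.mem_filter.1 hj).2
      rw [inter_eq_self_of_subset_right hsub] at this
      exact this (h0 j)
  calc |∑ i ∈ I, ∫ x in J ∩ ℓ ⁻¹' {i}, θ x ∂m| ≤ ∑ i ∈ I, |∫ x in J ∩ ℓ ⁻¹' {i}, θ x ∂m| :=
        Finset.abs_sum_le_sum_abs _ _
    _ ≤ ∑ _i ∈ I, b := Finset.sum_le_sum fun i _ => hb i J hJ
    _ = I.card * b := by simp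
    _ ≤ 2 * b := by gcongr; exact_mod_cast hcard

/-- Interval partitions adapted to a finite set of cut points, with small pieces. -/
theorem exists_label (Cut : Finset ℝ) {δ : ℝ} (hδ : 0 < δ) :
    ∃ (ℓ : ℝ → ℕ) (N : ℕ), Monotone ℓ ∧ (∀ x, ℓ x < N) ∧
      (∀ x ∈ Icc (-1 : ℝ) 1, ∀ y ∈ Icc (-1 : ℝ) 1, ℓ x = ℓ y → |x - y| < δ) ∧
      ∀ c ∈ Cut, ∀ x, ℓ x = ℓ c → x = c := by
  classical
  set D : Finset ℝ := Cut ∪ (Finset.range (⌈2 / δ⌉₊ + 1)).image fun k : ℕ => -1 + k * δ with hD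
  set ℓ : ℝ → ℕ := fun x => (D.filter (· < x)).card + (D.filter (· ≤ x)).card with hℓ
  have m1 : ∀ {x y : ℝ}, x ≤ y → D.filter (· < x) ⊆ D.filter (· < y) := fun h c hc => by
    rw [Finset.mem_filter] at hc ⊢; exact ⟨hc.1, hc.2.trans_le h⟩
  have m2 : ∀ {x y : ℝ}, x ≤ y → D.filter (· ≤ x) ⊆ D.filter (· ≤ y) := fun h c hc => by
    rw [Finset.mem_filter] at hc ⊢; exact ⟨hc.1, hc.2.trans h⟩
  have s1 : ∀ {x y : ℝ}, ∀ c ∈ D, x ≤ c → c < y → ℓ x < ℓ y := by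
    intro x y c hc hxc hcy
    have hxy := hxc.trans hcy.le
    refine add_lt_add_of_lt_of_le (Finset.card_lt_card ?_) (Finset.card_le_card (m2 hxy))
    rw [Finset.ssubset_iff_of_subset (m1 hxy)]
    exact ⟨c, Finset.mem_filter.2 ⟨hc, hcy⟩, fun h => absurd (Finset.mem_filter.1 h).2 (not_lt.2 hxc)⟩
  have s2 : ∀ {x y : ℝ}, ∀ c ∈ D, x < c → c ≤ y → ℓ x < ℓ y := by
    intro x y c hc hxc hcy
    have hxy := hxc.le.trans hcy
    refine add_lt_add_of_le_of_lt (Finset.card_le_card (m1 hxy)) (Finset.card_lt_card ?_)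
    rw [Finset.ssubset_iff_of_subset (m2 hxy)]
    exact ⟨c, Finset.mem_filter.2 ⟨hc, hcy⟩, fun h => absurd (Finset.mem_filter.1 h).2 (not_le.2 hxc)⟩
  have grid : ∀ x ∈ Icc (-1 : ℝ) 1, ∀ y ∈ Icc (-1 : ℝ) 1, x ≤ y → ℓ x = ℓ y → y - x < δ := by
    intro x hx y hy hxy h
    by_contra hlt
    rw [not_lt] at hlt
    have hnn : 0 ≤ (x + 1) / δ := div_nonneg (by linarith [hx.1]) hδ.le
    set k := ⌈(x + 1) / δ⌉₊ with hk
    have k1 : (x + 1) / δ ≤ k := Nat.le_ceil _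
    have k2 : (k : ℝ) < (x + 1) / δ + 1 := Nat.ceil_lt_add_one hnn
    rw [div_le_iff₀ hδ] at k1
    have k2' : k * δ < x + 1 + δ := by
      have := mul_lt_mul_of_pos_right k2 hδ
      rwa [add_mul, div_mul_cancel₀ _ hδ.ne', one_mul] at this
    have hkD : -1 + (k : ℝ) * δ ∈ D := by
      refine Finset.mem_union_right _ (Finset.mem_image.2 ⟨k, Finset.mem_range.2 ?_, rfl⟩)
      refine Nat.lt_succ_of_le (Nat.ceil_mono ?_)
      gcongr
      linarith [hx.2]
    exact absurd h (s1 _ hkD (by linarith) (by linarith)).ne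
  refine ⟨ℓ, 2 * D.card + 1, fun x y h =>
    add_le_add (Finset.card_le_card (m1 h)) (Finset.card_le_card (m2 h)), fun x => ?_, ?_, ?_⟩
  · have h1 := Finset.card_filter_le D (· < x)
    have h2 := Finset.card_filter_le D (· ≤ x)
    simp only [hℓ]
    omega
  · intro x hx y hy h
    rcases le_total x y with hxy | hxy
    · rw [abs_sub_comm, abs_of_nonneg (sub_nonneg.2 hxy)]
      exact grid x hx y hy hxy h
    · rw [abs_of_nonneg (sub_nonneg.2 hxy)]
      exact grid y hy x hx hxy h.symm
  · intro c hc x h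
    have hcD : c ∈ D := Finset.mem_union_left _ hc
    rcases lt_trichotomy x c with hlt | heq | hlt
    · exact absurd h (s2 c hcD hlt le_rfl).ne
    · exact heq
    · exact absurd h (s1 c hcD le_rfl hlt).ne'

/-- Abstract Lasota–Yorke inequality. -/
theorem VarLE.map_restrict {ν : Measure ℝ} [IsFiniteMeasure ν] {V : ℝ} (hν : VarLE m ν V)
    (hℓ : Monotone ℓ) (hN : ∀ x, ℓ x < N) {F : ℝ → ℝ} (hF : Measurable F) (G : Set ℕ) {η : ℝ}
    (hη : 0 ≤ η)
    (key : ∀ i ∈ G, ∀ J : Set ℝ, J.OrdConnected → J ⊆ ℓ ⁻¹' {i} → ∀ θ : ℝ → ℝ, Measurable θ →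
      (∃ C, ∀ x, |θ x| ≤ C) → (∀ J : Set ℝ, J.OrdConnected → |∫ x in J, θ x ∂m| ≤ 1) →
      |∫ x in J, θ (F x) ∂m| ≤ η) :
    VarLE m ((ν.restrict (ℓ ⁻¹' G)).map F)
      (4 * η * V + (∑ i ∈ Finset.range N, η / m.real (ℓ ⁻¹' {i})) * ν.real univ) := by
  classical
  rintro θ h1 ⟨C, hC⟩ h3
  have hG : MeasurableSet (ℓ ⁻¹' G) := hℓ.measurable (MeasurableSet.of_discrete)
  set A : ℕ → ℝ := fun i => (∫ x in ℓ ⁻¹' {i}, θ (F x) ∂m) / m.real (ℓ ⁻¹' {i}) with hA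
  set φ : ℝ → ℝ := (ℓ ⁻¹' G).indicator fun x => θ (F x) - A (ℓ x) with hφ
  have hmθ : Measurable fun x => θ (F x) := h1.comp hF
  have hmA : Measurable fun x => A (ℓ x) := (measurable_from_nat (f := A)).comp hℓ.measurable
  have hmφ : Measurable φ := (hmθ.sub hmA).indicator hG
  have hC0 : 0 ≤ C := (abs_nonneg _).trans (hC 0)
  set CA : ℝ := ∑ i ∈ Finset.range N, |A i| with hCA
  have hAb : ∀ x, |A (ℓ x)| ≤ CA := fun x =>
    Finset.single_le_sum (f := fun i => |A i|) (fun _ _ => abs_nonneg _)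
      (Finset.mem_range.2 (hN x))
  have hCA0 : 0 ≤ CA := (abs_nonneg _).trans (hAb 0)
  have hbφ : ∀ x, |φ x| ≤ C + CA := by
    intro x
    by_cases hx : x ∈ ℓ ⁻¹' G
    · rw [hφ, indicator_of_mem hx]
      exact (abs_sub _ _).trans (add_le_add (hC _) (hAb x))
    · rw [hφ, indicator_of_notMem hx, abs_zero]; positivity
  have hAη : ∀ i ∈ G, |A i| ≤ η / m.real (ℓ ⁻¹' {i}) := by
    intro i hi
    rw [hA, abs_div, abs_of_nonneg (measureReal_nonneg (μ := m))]
    exact div_le_div_of_nonneg_right (key i hi _ (ordConnected_fiber hℓ i) Subset.rfl θ h1 ⟨C, hC⟩ h3)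
      measureReal_nonneg
  -- integrals of `φ` over parts of pieces
  have hpiece : ∀ i, ∀ J : Set ℝ, J.OrdConnected → i ∈ G → ∫ x in J ∩ ℓ ⁻¹' {i}, φ x ∂m =
      (∫ x in J ∩ ℓ ⁻¹' {i}, θ (F x) ∂m) - m.real (J ∩ ℓ ⁻¹' {i}) * A i := by
    intro i J hJ hi
    have hms : MeasurableSet (J ∩ ℓ ⁻¹' {i}) := hJ.measurableSet.inter (measurableSet_fiber hℓ i)
    have : ∫ x in J ∩ ℓ ⁻¹' {i}, φ x ∂m = ∫ x in J ∩ ℓ ⁻¹' {i}, (θ (F x) - A i) ∂m := by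
      refine setIntegral_congr_fun hms fun x hx => ?_
      have hxi : ℓ x = i := hx.2
      have : x ∈ ℓ ⁻¹' G := by rw [mem_preimage, hxi]; exact hi
      simp only [hφ, indicator_of_mem this, hxi]
    rw [this, integral_sub (integrable_of_abs_le_one hmθ fun x => hC _) (integrable_const _)]
    simp
  have hpiece0 : ∀ i, ∀ J : Set ℝ, J.OrdConnected → i ∉ G → ∫ x in J ∩ ℓ ⁻¹' {i}, φ x ∂m = 0 := by
    intro i J hJ hi
    have hms : MeasurableSet (J ∩ ℓ ⁻¹' {i}) := hJ.measurableSet.inter (measurableSet_fiber hℓ i)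
    rw [← integral_zero ℝ ℝ (μ := m.restrict (J ∩ ℓ ⁻¹' {i}))]
    refine setIntegral_congr_fun hms fun x hx => ?_
    have hxi : ℓ x = i := hx.2
    have : x ∉ ℓ ⁻¹' G := by rw [mem_preimage, hxi]; exact hi
    simp only [hφ, indicator_of_notMem this]
  have hInt : ∀ κ : Measure ℝ, IsFiniteMeasure κ → Integrable φ κ := fun κ _ =>
    integrable_of_abs_le_one hmφ hbφ
  have hφJ : ∀ J : Set ℝ, J.OrdConnected → |∫ x in J, φ x ∂m| ≤ 2 * (2 * η) := by
    refine abs_setIntegral_le_of_pieces hℓ hN (hInt m inferInstance) (fun i => ?_) fun i J hJ => ?_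
    · by_cases hi : i ∈ G
      · have := hpiece i univ ordConnected_univ hi
        rw [univ_inter] at this
        rw [this]
        by_cases h0 : m.real (ℓ ⁻¹' {i}) = 0
        · rw [h0, zero_mul, sub_zero]
          apply setIntegral_measure_zero
          rwa [measureReal_eq_zero_iff] at h0
        · simp only [hA]; field_simp; simp
      · simpa using hpiece0 i univ ordConnected_univ hi
    · by_cases hi : i ∈ G
      · rw [hpiece i J hJ hi, two_mul]
        refine (abs_sub _ _).trans (add_le_add ?_ ?_)
        · exact key i hi _ (hJ.inter (ordConnected_fiber hℓ i)) inter_subset_right θ h1 ⟨C, hC⟩ h3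
        · rw [abs_mul, abs_of_nonneg measureReal_nonneg]
          calc _ ≤ m.real (ℓ ⁻¹' {i}) * (η / m.real (ℓ ⁻¹' {i})) := by
                refine mul_le_mul (measureReal_mono inter_subset_right) (hAη i hi) (abs_nonneg _)
                  measureReal_nonneg
            _ ≤ η := by
                by_cases h0 : m.real (ℓ ⁻¹' {i}) = 0
                · simp [h0, hη]
                · rw [mul_div_cancel₀ _ h0]
      · rw [hpiece0 i J hJ hi, abs_zero]; positivity
  have hmain := hν.integral_le hmφ hbφ (b := 2 * (2 * η)) (by positivity) hφJ
  rw [integral_map hF.aemeasurable h1.aestronglyMeasurable, ← integral_indicator hG]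
  have hdecomp : ∀ x, (ℓ ⁻¹' G).indicator (fun x => θ (F x)) x =
      φ x + (ℓ ⁻¹' G).indicator (fun x => A (ℓ x)) x := by
    intro x
    by_cases hx : x ∈ ℓ ⁻¹' G
    · simp only [hφ, indicator_of_mem hx]; ring
    · simp only [hφ, indicator_of_notMem hx]; ring
  set E := ∑ i ∈ Finset.range N, η / m.real (ℓ ⁻¹' {i}) with hE
  have hE0 : ∀ i ∈ Finset.range N, 0 ≤ η / m.real (ℓ ⁻¹' {i}) := fun i _ =>
    div_nonneg hη measureReal_nonneg
  have hAE : ∀ x, |(ℓ ⁻¹' G).indicator (fun x => A (ℓ x)) x| ≤ E := by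
    intro x
    by_cases hx : x ∈ ℓ ⁻¹' G
    · rw [indicator_of_mem hx]
      refine (hAη _ hx).trans ?_
      exact Finset.single_le_sum (f := fun i => η / m.real (ℓ ⁻¹' {i})) hE0
        (Finset.mem_range.2 (hN x))
    · rw [indicator_of_notMem hx, abs_zero]; exact Finset.sum_nonneg hE0
  simp_rw [hdecomp]
  have hiA : Integrable ((ℓ ⁻¹' G).indicator (fun x => A (ℓ x))) ν :=
    integrable_of_abs_le_one (hmA.indicator hG) hAE
  rw [integral_add (hInt ν inferInstance) hiA]
  refine add_le_add (by linarith) ?_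
  calc _ ≤ ∫ _x, E ∂ν := integral_mono hiA (integrable_const _) fun x => (abs_le.1 (hAE x)).2
    _ = _ := by simp [mul_comm]

end Pieces

/-- Layer cake bound. -/
theorem abs_integral_mul_le_of_superlevel {κ : Measure ℝ} [SFinite κ] {q g : ℝ → ℝ}
    (hq : Integrable q κ) (hg : Measurable g) {η : ℝ} (g0 : ∀ᵐ x ∂κ, 0 ≤ g x)
    (gη : ∀ᵐ x ∂κ, g x ≤ η) (hη : 0 ≤ η) (h : ∀ t ∈ Ioc 0 η, |∫ x in {x | t < g x}, q x ∂κ| ≤ 1) :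
    |∫ x, g x * q x ∂κ| ≤ η := by
  have hlc : ∀ᵐ x ∂κ, g x * q x = ∫ t in Ioc 0 η, (Iio (g x)).indicator (fun _ => q x) t := by
    filter_upwards [g0, gη] with x h0 h1
    rw [integral_indicator measurableSet_Iio, integral_const, smul_eq_mul,
      Measure.restrict_restrict measurableSet_Iio]
    congr 1
    have : (Iio (g x) ∩ Ioc 0 η : Set ℝ) =ᵐ[volume] (Ioc 0 (g x) : Set ℝ) := by
      have e : Iio (g x) ∩ Ioc 0 η = Ioo 0 (g x) := by
        ext t; simp only [mem_inter_iff, mem_Iio, mem_Ioc, mem_Ioo]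
        exact ⟨fun h => ⟨h.2.1, h.1⟩, fun h => ⟨h.2, h.1, h.2.le.trans h1⟩⟩
      rw [e]; exact Ioo_ae_eq_Ioc
    rw [Measure.real, Measure.restrict_apply_univ, measure_congr this, Real.volume_Ioc, sub_zero,
      ENNReal.toReal_ofReal h0]
  rw [integral_congr_ae hlc]
  have hms : MeasurableSet {p : ℝ × ℝ | p.2 < g p.1} :=
    measurableSet_lt measurable_snd (hg.comp measurable_fst)
  have hInt : Integrable (fun p : ℝ × ℝ => (Iio (g p.1)).indicator (fun _ => q p.1) p.2)
      (κ.prod (volume.restrict (Ioc 0 η))) := by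
    have h1 : Integrable (fun p : ℝ × ℝ => q p.1) (κ.prod (volume.restrict (Ioc 0 η))) :=
      hq.comp_fst _
    refine (h1.indicator hms).congr (Eventually.of_forall fun p => ?_)
    simp [indicator]
  rw [integral_integral_swap hInt]
  have hin : ∀ t ∈ Ioc 0 η, |∫ x, (Iio (g x)).indicator (fun _ => q x) t ∂κ| ≤ 1 := by
    intro t ht
    have : ∫ x, (Iio (g x)).indicator (fun _ => q x) t ∂κ = ∫ x in {x | t < g x}, q x ∂κ := by
      rw [← integral_indicator (measurableSet_lt measurable_const hg)]
      refine integral_congr_ae (Eventually.of_forall fun x => ?_)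
      simp [indicator]
    rw [this]; exact h t ht
  have := norm_setIntegral_le_of_norm_le_const (μ := volume) (s := Ioc 0 η) (C := 1)
    (by simp) (f := fun t => ∫ x, (Iio (g x)).indicator (fun _ => q x) t ∂κ)
    (fun t ht => by rw [Real.norm_eq_abs]; exact hin t ht)
  rw [Real.norm_eq_abs] at this
  refine this.trans ?_
  simp [Measure.real, hη]

/-- A measure absolutely continuous with respect to `m` is close to measures of bounded
variation. -/
theorem exists_varLE_approx {m μ : Measure ℝ} [IsFiniteMeasure m] [IsFiniteMeasure μ]
    (hm : ∀ᵐ x ∂m, x ∈ Icc (-1 : ℝ) 1) (hμ : μ ≪ m) {ε : ℝ} (hε : 0 < ε) :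
    ∃ (ν : Measure ℝ) (V : ℝ), IsFiniteMeasure ν ∧ VarLE m ν V ∧
      ∀ (θ : ℝ → ℝ) (C : ℝ), Measurable θ → (∀ x, |θ x| ≤ C) →
        |∫ x, θ x ∂μ - ∫ x, θ x ∂ν| ≤ ε * C := by
  set v : ℝ → ℝ := fun x => (μ.rnDeriv m x).toReal with hv
  have iv : Integrable v m := Measure.integrable_toReal_rnDeriv
  obtain ⟨f, -, hf1, hf2, hf3⟩ := iv.exists_hasCompactSupport_integral_sub_le (half_pos hε)
  set M := m.real univ with hM
  have hM0 : 0 ≤ M := measureReal_nonneg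
  set e := ε / 2 / (M + 1) with he
  have he0 : 0 < e := by positivity
  have huc : UniformContinuousOn f (Icc (-1 : ℝ) 1) :=
    isCompact_Icc.uniformContinuousOn_of_continuous hf2.continuousOn
  rw [Metric.uniformContinuousOn_iff] at huc
  obtain ⟨δ, hδ, hδ'⟩ := huc e he0
  obtain ⟨ℓ, N, hℓ, hN, hmesh, -⟩ := exists_label ∅ hδ
  classical
  set c : ℕ → ℝ := fun i => if h : ∃ x ∈ Icc (-1 : ℝ) 1, ℓ x = i then max (f h.choose) 0 else 0
    with hc
  have hc0 : ∀ i, 0 ≤ c i := by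
    intro i; simp only [hc]; split_ifs
    · exact le_max_right _ _
    · exact le_rfl
  have hcf : ∀ x ∈ Icc (-1 : ℝ) 1, |c (ℓ x) - max (f x) 0| ≤ e := by
    intro x hx
    have h : ∃ y ∈ Icc (-1 : ℝ) 1, ℓ y = ℓ x := ⟨x, hx, rfl⟩
    simp only [hc, dif_pos h]
    refine (abs_max_sub_max_le_abs _ _ _).trans ?_
    have h1 := hδ' h.choose h.choose_spec.1 x hx (by
      rw [Real.dist_eq]; exact hmesh _ h.choose_spec.1 _ hx h.choose_spec.2)
    rw [Real.dist_eq] at h1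
    exact h1.le
  have hcm : Measurable fun x => c (ℓ x) := (measurable_from_nat (f := c)).comp hℓ.measurable
  have hcb : ∀ x, |c (ℓ x)| ≤ ∑ i ∈ Finset.range N, c i := by
    intro x
    rw [abs_of_nonneg (hc0 _)]
    exact Finset.single_le_sum (f := c) (fun _ _ => hc0 _) (Finset.mem_range.2 (hN x))
  have hci : Integrable (fun x => c (ℓ x)) m := integrable_of_abs_le_one hcm hcb
  have hνi : ∀ θ : ℝ → ℝ, ∫ x, θ x ∂(m.withDensity fun x => ENNReal.ofReal (c (ℓ x))) =
      ∫ x, c (ℓ x) * θ x ∂m := by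
    intro θ
    rw [integral_withDensity_eq_integral_toReal_smul hcm.ennreal_ofReal
      (Eventually.of_forall fun x => ENNReal.ofReal_lt_top)]
    simp [ENNReal.toReal_ofReal (hc0 _)]
  refine ⟨m.withDensity fun x => ENNReal.ofReal (c (ℓ x)), ∑ i ∈ Finset.range N, c i,
    isFiniteMeasure_withDensity_ofReal hci.2, ?_, ?_⟩
  · rintro θ hθ ⟨C, hC⟩ hJ
    have hi : Integrable (fun x => c (ℓ x) * θ x) m :=
      integrable_of_abs_le_one (hcm.mul hθ) (C := (∑ i ∈ Finset.range N, c i) * C) fun x => by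
        rw [abs_mul]
        exact mul_le_mul (hcb x) (hC x) (abs_nonneg _) (Finset.sum_nonneg fun _ _ => hc0 _)
    rw [hνi, integral_eq_sum_fibers _ hℓ hN hi]
    refine Finset.sum_le_sum fun i _ => ?_
    have : ∫ x in ℓ ⁻¹' {i}, c (ℓ x) * θ x ∂m = ∫ x in ℓ ⁻¹' {i}, c i * θ x ∂m := by
      refine setIntegral_congr_fun (measurableSet_fiber hℓ i) fun x hx => ?_
      have : ℓ x = i := hx
      simp only [this]
    rw [this, integral_const_mul]
    have := (le_abs_self _).trans (hJ _ (ordConnected_fiber hℓ i))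
    nlinarith [hc0 i]
  · intro θ C hθ hC
    have hC0 : 0 ≤ C := (abs_nonneg _).trans (hC 0)
    rw [hνi, ← integral_rnDeriv_smul hμ]
    have i1 : Integrable (fun x => (μ.rnDeriv m x).toReal • θ x) m := by
      simp only [smul_eq_mul]
      exact iv.mul_bdd (c := C) hθ.aestronglyMeasurable (Eventually.of_forall hC)
    have i2 : Integrable (fun x => c (ℓ x) * θ x) m :=
      hci.mul_bdd (c := C) hθ.aestronglyMeasurable (Eventually.of_forall hC)
    rw [← integral_sub i1 i2, ← Real.norm_eq_abs]
    have i3 : Integrable (fun x => ‖v x - f x‖) m := (iv.sub hf3).norm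
    calc _ ≤ ∫ x, (‖v x - f x‖ + e) * C ∂m := by
          refine norm_integral_le_of_norm_le ((i3.add (integrable_const e)).mul_const C) ?_
          filter_upwards [hm] with x hx
          have h1 := hcf x hx
          have hv0 : 0 ≤ v x := ENNReal.toReal_nonneg
          have h2 : |v x - max (f x) 0| ≤ |v x - f x| := by
            rw [← max_eq_left hv0]
            nth_rewrite 2 [max_eq_left hv0]
            exact abs_max_sub_max_le_abs _ _ _
          rw [smul_eq_mul, ← sub_mul, norm_mul]
          refine mul_le_mul ?_ (hC x) (abs_nonneg _) (by positivity)
          rw [Real.norm_eq_abs, Real.norm_eq_abs]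
          have : (μ.rnDeriv m x).toReal - c (ℓ x) = (v x - max (f x) 0) - (c (ℓ x) - max (f x) 0) := by
            simp only [hv]; ring
          rw [this]
          exact (abs_sub _ _).trans (add_le_add h2 h1)
      _ = ((∫ x, ‖v x - f x‖ ∂m) + M * e) * C := by
          rw [integral_mul_const, integral_add i3 (integrable_const e)]
          simp [hM]
      _ ≤ ε * C := by
          refine mul_le_mul_of_nonneg_right ?_ hC0
          have : M * e ≤ ε / 2 := by
            rw [he, mul_div_assoc', div_le_iff₀ (by positivity)]
            nlinarith
          linarith

/-- An invariant measure of a map satisfying a Lasota–Yorke inequality has bounded variation. -/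
theorem varLE_of_lasotaYorke {m μ : Measure ℝ} [IsFiniteMeasure m] [IsProbabilityMeasure μ]
    (hm : ∀ᵐ x ∂m, x ∈ Icc (-1 : ℝ) 1) (hμ : μ ≪ m) {U : Set ℝ} (hU : MeasurableSet U)
    (hUμ : ∀ᵐ x ∂μ, x ∈ U) {F : ℝ → ℝ} (hF : MeasurePreserving F μ μ) {C : ℝ} (hC : 0 ≤ C)
    (hLY : ∀ (ν : Measure ℝ) (V : ℝ), IsFiniteMeasure ν → VarLE m ν V →
      VarLE m ((ν.restrict U).map F) (V / 2 + C * ν.real univ)) : VarLE m μ (2 * C) := by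
  have step : ∀ ε > 0, ∃ V₀ : ℝ, ∀ k : ℕ, ∃ (ν : Measure ℝ), IsFiniteMeasure ν ∧
      ν.real univ ≤ 1 + ε ∧ VarLE m ν (V₀ / 2 ^ k + 2 * C * (1 + ε)) ∧
      ∀ (θ : ℝ → ℝ) (B : ℝ), Measurable θ → (∀ x, |θ x| ≤ B) →
        |∫ x, θ x ∂μ - ∫ x, θ x ∂ν| ≤ ε * B := by
    intro ε hε
    obtain ⟨ν, V, hν, hV, happ⟩ := exists_varLE_approx hm hμ hε
    have hmass : ∀ ν : Measure ℝ, (∀ (θ : ℝ → ℝ) (B : ℝ), Measurable θ → (∀ x, |θ x| ≤ B) →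
        |∫ x, θ x ∂μ - ∫ x, θ x ∂ν| ≤ ε * B) → ν.real univ ≤ 1 + ε := by
      intro ν h
      have := h (fun _ => 1) 1 measurable_const (by simp)
      simp only [integral_const, probReal_univ, smul_eq_mul, mul_one] at this
      linarith [(abs_le.1 this).1]
    refine ⟨V, fun k => ?_⟩
    induction k with
    | zero =>
      refine ⟨ν, hν, hmass ν happ, hV.mono ?_, happ⟩
      have : 0 ≤ 2 * C * (1 + ε) := by positivity
      simp; linarith
    | succ k ih =>
      obtain ⟨κ, hκ, hκm, hκV, hκa⟩ := ih
      have happ' : ∀ (θ : ℝ → ℝ) (B : ℝ), Measurable θ → (∀ x, |θ x| ≤ B) →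
          |∫ x, θ x ∂μ - ∫ x, θ x ∂((κ.restrict U).map F)| ≤ ε * B := by
        intro θ B hθ hB
        have hB0 : 0 ≤ B := (abs_nonneg _).trans (hB 0)
        have h1 := hκa (U.indicator fun x => θ (F x)) B ((hθ.comp hF.measurable).indicator hU)
          (fun x => by
            by_cases hx : x ∈ U
            · rw [indicator_of_mem hx]; exact hB _
            · rw [indicator_of_notMem hx, abs_zero]; exact hB0)
        rw [integral_indicator hU, integral_indicator hU] at h1
        rw [integral_map hF.measurable.aemeasurable hθ.aestronglyMeasurable]
        have h2 : ∫ x in U, θ (F x) ∂μ = ∫ x, θ x ∂μ := by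
          rw [Measure.restrict_eq_self_of_ae_mem hUμ]
          have := integral_map (μ := μ) hF.measurable.aemeasurable hθ.aestronglyMeasurable
          rw [hF.map_eq] at this
          exact this.symm
        rwa [h2] at h1
      refine ⟨_, inferInstance, hmass _ happ', (hLY κ _ hκ hκV).mono ?_, happ'⟩
      have := mul_le_mul_of_nonneg_left hκm hC
      rw [pow_succ]
      have e : V / (2 ^ k * 2) = V / 2 ^ k / 2 := by rw [div_div]
      rw [e]
      nlinarith
  rintro θ hθ ⟨B, hB⟩ hJ
  have hε : ∀ ε > 0, ∫ x, θ x ∂μ ≤ 2 * C * (1 + ε) + ε * B := by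
    intro ε hε
    obtain ⟨V₀, hk⟩ := step ε hε
    have hk' : ∀ k : ℕ, ∫ x, θ x ∂μ ≤ V₀ / 2 ^ k + 2 * C * (1 + ε) + ε * B := by
      intro k
      obtain ⟨ν, -, -, h1, h2⟩ := hk k
      have h3 := h1 θ hθ ⟨B, hB⟩ hJ
      linarith [(abs_le.1 (h2 θ B hθ hB)).2]
    have hlim : Tendsto (fun k : ℕ => V₀ / 2 ^ k + 2 * C * (1 + ε) + ε * B) atTop
        (𝓝 (0 + 2 * C * (1 + ε) + ε * B)) :=
      ((tendsto_const_nhds.div_atTop (tendsto_pow_atTop_atTop_of_one_lt one_lt_two)).add_const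
        _).add_const _
    rw [zero_add] at hlim
    exact ge_of_tendsto' hlim hk'
  have hlim : Tendsto (fun ε : ℝ => 2 * C * (1 + ε) + ε * B) (𝓝[>] 0) (𝓝 (2 * C)) := by
    have : Tendsto (fun ε : ℝ => 2 * C * (1 + ε) + ε * B) (𝓝 0) (𝓝 (2 * C * (1 + 0) + 0 * B)) :=
      Continuous.tendsto (by fun_prop) 0
    rw [add_zero, mul_one, zero_mul, add_zero] at this
    exact this.mono_left nhdsWithin_le_nhds
  exact ge_of_tendsto hlim (by filter_upwards [self_mem_nhdsWithin] with ε hε' using hε ε hε')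

theorem lintegral_inv_sqrt_ball (c : ℝ) {r : ℝ} (hr : 0 < r) :
    ∫⁻ x in Metric.ball c r, ENNReal.ofReal (√|x - c|)⁻¹ ≤ ENNReal.ofReal (4 * √r) := by
  set f : ℝ → ℝ≥0∞ := fun x => ENNReal.ofReal (√|x|)⁻¹ with hf
  have hfm : Measurable f := by fun_prop
  have h0 : ∫⁻ x in Ioc 0 r, f x = ENNReal.ofReal (2 * √r) := by
    have e : ∀ x ∈ Ioc 0 r, f x = ENNReal.ofReal (x ^ (-1 / 2 : ℝ)) := by
      intro x hx
      simp only [hf]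
      rw [abs_of_pos hx.1, Real.sqrt_eq_rpow, ← Real.rpow_neg hx.1.le]
      norm_num
    rw [setLIntegral_congr_fun measurableSet_Ioc e]
    have hi : IntervalIntegrable (fun x : ℝ => x ^ (-1 / 2 : ℝ)) volume 0 r :=
      intervalIntegral.intervalIntegrable_rpow' (by norm_num)
    rw [intervalIntegrable_iff_integrableOn_Ioc_of_le hr.le] at hi
    rw [← ofReal_integral_eq_lintegral_ofReal hi
      ((ae_restrict_iff' measurableSet_Ioc).2 (Eventually.of_forall fun x hx =>
        Real.rpow_nonneg hx.1.le _)), ← intervalIntegral.integral_of_le hr.le,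
      integral_rpow (Or.inl (by norm_num)), Real.sqrt_eq_rpow]
    congr 1
    norm_num
    ring
  have hneg : ∫⁻ x in Ico (-r) 0, f x = ENNReal.ofReal (2 * √r) := by
    rw [← h0, ← (Measure.measurePreserving_neg (volume : Measure ℝ)).setLIntegral_comp_preimage
      measurableSet_Ico hfm]
    have : (Neg.neg ⁻¹' Ico (-r) 0 : Set ℝ) = Ioc 0 r := by
      ext x; simp only [mem_preimage, mem_Ico, mem_Ioc]; constructor <;> rintro ⟨h1, h2⟩ <;>
        constructor <;> linarith
    rw [this]
    simp [hf]
  have hsub : Metric.ball (0 : ℝ) r ⊆ Ioc 0 r ∪ Ico (-r) 0 ∪ {0} := by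
    intro x hx
    rw [Metric.mem_ball, Real.dist_eq, sub_zero, abs_lt] at hx
    rcases lt_trichotomy x 0 with h | h | h
    · exact Or.inl (Or.inr ⟨hx.1.le, h⟩)
    · exact Or.inr h
    · exact Or.inl (Or.inl ⟨h, hx.2.le⟩)
  have htr : ∫⁻ x in Metric.ball c r, ENNReal.ofReal (√|x - c|)⁻¹ =
      ∫⁻ x in Metric.ball (0 : ℝ) r, f x := by
    rw [← (measurePreserving_sub_right (volume : Measure ℝ) c).setLIntegral_comp_preimage
      measurableSet_ball hfm]
    have : (fun x : ℝ => x - c) ⁻¹' Metric.ball 0 r = Metric.ball c r := by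
      ext x; simp [Real.dist_eq]
    rw [this]
  rw [htr]
  calc ∫⁻ x in Metric.ball (0 : ℝ) r, f x ≤ ∫⁻ x in Ioc 0 r ∪ Ico (-r) 0 ∪ {0}, f x :=
        lintegral_mono_set hsub
    _ ≤ (∫⁻ x in Ioc 0 r, f x) + (∫⁻ x in Ico (-r) 0, f x) + ∫⁻ x in ({0} : Set ℝ), f x :=
        (lintegral_union_le _ _ _).trans (add_le_add (lintegral_union_le _ _ _) le_rfl)
    _ = ENNReal.ofReal (4 * √r) := by
        rw [h0, hneg, setLIntegral_measure_zero _ _ (by simp), add_zero,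
          ← ENNReal.ofReal_add (by positivity) (by positivity)]
        congr 1; ring

theorem lintegral_inv_sqrt_ball_le (z c : ℝ) {r : ℝ} (hr : 0 < r) :
    ∫⁻ x in Metric.ball z r, ENNReal.ofReal (√|x - c|)⁻¹ ≤ ENNReal.ofReal (6 * √r) := by
  have h1 : ∫⁻ x in Metric.ball z r \ Metric.ball c r, ENNReal.ofReal (√|x - c|)⁻¹ ≤
      ENNReal.ofReal (2 * √r) := by
    calc _ ≤ ∫⁻ _x in Metric.ball z r \ Metric.ball c r, ENNReal.ofReal (√r)⁻¹ := by
          refine setLIntegral_mono' (measurableSet_ball.diff measurableSet_ball) fun x hx => ?_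
          have : r ≤ |x - c| := by
            have := hx.2
            rwa [Metric.mem_ball, Real.dist_eq, not_lt] at this
          gcongr
      _ ≤ ENNReal.ofReal (√r)⁻¹ * volume (Metric.ball z r) := by
          rw [setLIntegral_const]
          gcongr
          exact sdiff_subset
      _ = ENNReal.ofReal (2 * √r) := by
          rw [Real.volume_ball, ← ENNReal.ofReal_mul (by positivity)]
          congr 1
          have : 0 < √r := Real.sqrt_pos.2 hr
          have h2 : r = √r * √r := (Real.mul_self_sqrt hr.le).symm
          nth_rewrite 2 [h2]
          field_simp
  calc _ ≤ ∫⁻ x in Metric.ball c r ∪ (Metric.ball z r \ Metric.ball c r),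
        ENNReal.ofReal (√|x - c|)⁻¹ := lintegral_mono_set (by rw [union_sdiff_self]; exact subset_union_right)
    _ ≤ ENNReal.ofReal (4 * √r) + ENNReal.ofReal (2 * √r) :=
        (lintegral_union_le _ _ _).trans (add_le_add (lintegral_inv_sqrt_ball c hr) h1)
    _ = _ := by
        rw [← ENNReal.ofReal_add (by positivity) (by positivity)]
        congr 1; ring

/-- The density `|W|^{-1/2}`. -/
noncomputable def refDensity (a x : ℝ) : ℝ := (√|(postCritPoly a).eval x|)⁻¹

/-- The measure on `[-1, 1]` with density `|W|^{-1/2}`. -/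
noncomputable def refMeasure (a : ℝ) : Measure ℝ :=
  (volume.restrict (Icc (-1) 1)).withDensity fun x => ENNReal.ofReal (refDensity a x)

namespace MTSetting

variable {a : ℝ} {μ : Measure ℝ}

theorem measurable_refDensity : Measurable (refDensity a) := by
  unfold refDensity
  exact (((postCritPoly a).continuous.abs).sqrt).measurable.inv

theorem refDensity_nonneg (x : ℝ) : 0 ≤ refDensity a x := by unfold refDensity; positivity

theorem refDensity_pos (S : MTSetting a μ) {x : ℝ} (hx : x ∉ postCrit a) : 0 < refDensity a x := by
  rw [← S.postCritPoly_eval_eq_zero] at hx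
  unfold refDensity; positivity

theorem exists_refDensity_le (S : MTSetting a μ) : ∃ K > 0, ∀ x ∈ Icc (-1 : ℝ) 1,
    refDensity a x ≤ K * ∑ c ∈ postCritFinset a, (√|x - c|)⁻¹ := by
  classical
  set Q : ℝ → ℝ := fun x => ∑ c ∈ postCritFinset a, √(∏ c' ∈ (postCritFinset a).erase c, |x - c'|)
    with hQ
  have hQc : Continuous Q := by fun_prop
  have hQpos : ∀ x, 0 < Q x := by
    intro x
    obtain ⟨c, hc, hcx⟩ : ∃ c ∈ postCritFinset a, ∀ c' ∈ (postCritFinset a).erase c, x ≠ c' := by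
      by_cases hx : x ∈ postCritFinset a
      · exact ⟨x, hx, fun c' hc' => (Finset.ne_of_mem_erase hc').symm⟩
      · exact ⟨1, S.mem_postCritFinset.2 one_mem_postCrit, fun c' hc' h =>
          hx (h ▸ Finset.mem_of_mem_erase hc')⟩
    refine Finset.sum_pos' (fun _ _ => Real.sqrt_nonneg _) ⟨c, hc, Real.sqrt_pos.2 ?_⟩
    exact Finset.prod_pos fun c' hc' => abs_pos.2 (sub_ne_zero.2 (hcx c' hc'))
  obtain ⟨x₀, -, hx₀⟩ := isCompact_Icc.exists_isMinOn (nonempty_Icc.2 (by norm_num : (-1 : ℝ) ≤ 1))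
    hQc.continuousOn
  refine ⟨(Q x₀)⁻¹, inv_pos.2 (hQpos _), fun x hx => ?_⟩
  have hmin : Q x₀ ≤ Q x := hx₀ hx
  rw [← div_eq_inv_mul, le_div_iff₀ (hQpos _)]
  by_cases hxP : x ∈ postCrit a
  · have : refDensity a x = 0 := by
      rw [refDensity, S.postCritPoly_eval_eq_zero.2 hxP]; simp
    rw [this, zero_mul]; positivity
  calc refDensity a x * Q x₀ ≤ refDensity a x * Q x :=
        mul_le_mul_of_nonneg_left hmin (refDensity_nonneg x)
    _ = ∑ c ∈ postCritFinset a, (√|x - c|)⁻¹ := by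
        rw [hQ, Finset.mul_sum]
        refine Finset.sum_congr rfl fun c hc => ?_
        have hxc : ∀ c' ∈ postCritFinset a, 0 < |x - c'| := fun c' hc' =>
          abs_pos.2 (sub_ne_zero.2 fun h => hxP (h ▸ S.mem_postCritFinset.1 hc'))
        have hp : 0 < ∏ c' ∈ (postCritFinset a).erase c, |x - c'| :=
          Finset.prod_pos fun c' hc' => hxc c' (Finset.mem_of_mem_erase hc')
        rw [refDensity, postCritPoly_eval, Finset.abs_prod, ← Finset.mul_prod_erase _ _ hc,
          Real.sqrt_mul (abs_nonneg _), mul_inv, mul_assoc, inv_mul_cancel₀ (Real.sqrt_pos.2 hp).ne',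
          mul_one]

theorem exists_refMeasure_ball_le (S : MTSetting a μ) : ∃ K > 0, ∀ z r : ℝ, 0 < r →
    refMeasure a (Metric.ball z r) ≤ ENNReal.ofReal (K * √r) := by
  obtain ⟨K, hK, h⟩ := S.exists_refDensity_le
  refine ⟨K * ((postCritFinset a).card * 6 + 1), by positivity, fun z r hr => ?_⟩
  rw [refMeasure, withDensity_apply _ measurableSet_ball, Measure.restrict_restrict measurableSet_ball]
  calc _ ≤ ∫⁻ x in Metric.ball z r ∩ Icc (-1) 1,
        ENNReal.ofReal K * ∑ c ∈ postCritFinset a, ENNReal.ofReal (√|x - c|)⁻¹ := by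
        refine setLIntegral_mono' (measurableSet_ball.inter measurableSet_Icc) fun x hx => ?_
        rw [← ENNReal.ofReal_sum_of_nonneg fun _ _ => by positivity, ← ENNReal.ofReal_mul hK.le]
        exact ENNReal.ofReal_le_ofReal (h x hx.2)
    _ ≤ ∫⁻ x in Metric.ball z r,
        ENNReal.ofReal K * ∑ c ∈ postCritFinset a, ENNReal.ofReal (√|x - c|)⁻¹ :=
        lintegral_mono_set inter_subset_left
    _ = ENNReal.ofReal K * ∑ c ∈ postCritFinset a,
        ∫⁻ x in Metric.ball z r, ENNReal.ofReal (√|x - c|)⁻¹ := by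
        rw [lintegral_const_mul _ (by fun_prop), lintegral_finsetSum _ fun c _ => by fun_prop]
    _ ≤ ENNReal.ofReal K * ∑ c ∈ postCritFinset a, ENNReal.ofReal (6 * √r) := by
        gcongr with c hc
        exact lintegral_inv_sqrt_ball_le z c hr
    _ ≤ _ := by
        rw [← ENNReal.ofReal_sum_of_nonneg fun _ _ => by positivity, ← ENNReal.ofReal_mul hK.le]
        apply ENNReal.ofReal_le_ofReal
        rw [Finset.sum_const, nsmul_eq_mul]
        have : 0 ≤ K * √r := by positivity
        nlinarith

theorem ae_refMeasure_mem_Icc : ∀ᵐ x ∂refMeasure a, x ∈ Icc (-1 : ℝ) 1 :=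
  (withDensity_absolutelyContinuous _ _).ae_le (ae_restrict_mem measurableSet_Icc)

theorem refMeasure_ac : refMeasure a ≪ volume :=
  (withDensity_absolutelyContinuous _ _).trans Measure.absolutelyContinuous_restrict

theorem isFiniteMeasure_refMeasure (S : MTSetting a μ) : IsFiniteMeasure (refMeasure a) := by
  obtain ⟨K, hK, h⟩ := S.exists_refMeasure_ball_le
  refine ⟨lt_of_le_of_lt ?_ (lt_of_le_of_lt (h 0 2 (by norm_num)) ENNReal.ofReal_lt_top)⟩
  refine measure_mono_ae ?_
  filter_upwards [ae_refMeasure_mem_Icc (a := a)] with x hx _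
  change x ∈ Metric.ball (0 : ℝ) 2
  rw [Metric.mem_ball, Real.dist_eq, sub_zero, abs_lt]
  constructor <;> linarith [hx.1, hx.2]

theorem ae_volume_notMem_postCrit (S : MTSetting a μ) : ∀ᵐ x : ℝ, x ∉ postCrit a :=
  measure_eq_zero_iff_ae_notMem.1 (S.postCrit_finite.measure_zero volume)

theorem restrict_ac_refMeasure (S : MTSetting a μ) : volume.restrict (Icc (-1 : ℝ) 1) ≪ refMeasure a := by
  refine withDensity_absolutelyContinuous' measurable_refDensity.ennreal_ofReal.aemeasurable ?_
  filter_upwards [ae_restrict_of_ae S.ae_volume_notMem_postCrit] with x hx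
  simpa using S.refDensity_pos hx

theorem ac_refMeasure (S : MTSetting a μ) : μ ≪ refMeasure a := by
  refine Measure.AbsolutelyContinuous.trans ?_ S.restrict_ac_refMeasure
  have := S.ac.restrict (Icc (-1 : ℝ) 1)
  rwa [Measure.restrict_eq_self_of_ae_mem S.ae_mem_Icc] at this

theorem exists_volume_le_refMeasure (S : MTSetting a μ) : ∃ K > 0, ∀ A ⊆ Icc (-1 : ℝ) 1,
    MeasurableSet A → volume A ≤ ENNReal.ofReal K * refMeasure a A := by
  obtain ⟨K, hK⟩ := isCompact_Icc.exists_bound_of_continuousOn (s := Icc (-1 : ℝ) 1)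
    (f := fun x => √|(postCritPoly a).eval x|) ((postCritPoly a).continuous.abs.sqrt).continuousOn
  have hK0 : 0 < max K 1 := by positivity
  refine ⟨max K 1, hK0, fun A hA mA => ?_⟩
  rw [refMeasure, withDensity_apply _ mA, Measure.restrict_restrict mA, inter_eq_left.2 hA,
    ← lintegral_const_mul _ measurable_refDensity.ennreal_ofReal, ← setLIntegral_one]
  refine lintegral_mono_ae ?_
  filter_upwards [ae_restrict_of_ae S.ae_volume_notMem_postCrit, ae_restrict_mem mA] with x hx hxA
  have h1 := hK x (hA hxA)
  rw [← ENNReal.ofReal_mul hK0.le, ← ENNReal.ofReal_one]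
  apply ENNReal.ofReal_le_ofReal
  have h2 := S.refDensity_pos hx
  rw [refDensity] at h2 ⊢
  have h3 := inv_pos.1 h2
  rw [← div_eq_mul_inv, le_div_iff₀ h3, one_mul]
  rw [Real.norm_eq_abs] at h1
  exact (le_abs_self _).trans (h1.trans (le_max_left _ _))

theorem exists_refMeasure_ball_le_of_notMem (S : MTSetting a μ) {z : ℝ} (hz : z ∉ postCrit a) :
    ∃ K > 0, ∃ r₀ > 0, ∀ r, 0 < r → r ≤ r₀ →
      refMeasure a (Metric.ball z r) ≤ ENNReal.ofReal (K * r) := by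
  have hc : ContinuousAt (refDensity a) z := by
    unfold refDensity
    refine ((postCritPoly a).continuous.abs.sqrt).continuousAt.inv₀ ?_
    have := S.refDensity_pos hz
    rw [refDensity] at this
    exact (inv_pos.1 this).ne'
  have hev : ∀ᶠ x in 𝓝 z, refDensity a x < refDensity a z + 1 :=
    hc.eventually (gt_mem_nhds (by linarith))
  obtain ⟨r₀, hr₀, h⟩ := Metric.eventually_nhds_iff_ball.1 hev
  have hp := S.refDensity_pos hz
  refine ⟨(refDensity a z + 1) * 2, by positivity, r₀, hr₀, fun r hr hrr => ?_⟩
  rw [refMeasure, withDensity_apply _ measurableSet_ball, Measure.restrict_restrict measurableSet_ball]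
  calc _ ≤ ∫⁻ _x in Metric.ball z r, ENNReal.ofReal (refDensity a z + 1) := by
        refine (lintegral_mono_set inter_subset_left).trans
          (setLIntegral_mono' measurableSet_ball fun x hx => ?_)
        exact ENNReal.ofReal_le_ofReal (h x (Metric.ball_subset_ball hrr hx)).le
    _ = _ := by
        rw [setLIntegral_const, Real.volume_ball, ← ENNReal.ofReal_mul (by positivity)]
        congr 1; ring

theorem setIntegral_refMeasure {A : Set ℝ} (hA : MeasurableSet A) (θ : ℝ → ℝ) :
    ∫ x in A, θ x ∂refMeasure a = ∫ x in A ∩ Icc (-1) 1, refDensity a x * θ x := by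
  rw [refMeasure, setIntegral_withDensity_eq_setIntegral_toReal_smul
    measurable_refDensity.ennreal_ofReal (Eventually.of_forall fun x => ENNReal.ofReal_lt_top) _ hA,
    Measure.restrict_restrict hA]
  simp [ENNReal.toReal_ofReal (refDensity_nonneg _)]

theorem integrableOn_refDensity (S : MTSetting a μ) :
    IntegrableOn (refDensity a) (Icc (-1) 1) := by
  have := S.isFiniteMeasure_refMeasure.measure_univ_lt_top
  rw [refMeasure, withDensity_apply _ MeasurableSet.univ, Measure.restrict_univ] at this
  refine ⟨measurable_refDensity.aestronglyMeasurable, ?_⟩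
  rwa [hasFiniteIntegral_iff_ofReal (Eventually.of_forall refDensity_nonneg)]

end MTSetting

namespace MTSetting

variable {a : ℝ} {μ : Measure ℝ}

theorem refDensity_eq (S : MTSetting a μ) {n : ℕ} {x : ℝ} (hx : (Ta a)^[n] x ∉ postCrit a) :
    refDensity a x = invExpansion a n x * (|derivIter a n x| * refDensity a ((Ta a)^[n] x)) := by
  have hx0 : x ∉ postCrit a := fun h => hx (iterate_mem_postCrit h n)
  have h1 := S.abs_postCritPoly_iterate n x
  have hs : √|(postCritPoly a).eval ((Ta a)^[n] x)| =
      √|(postCritPoly a).eval x| * (|derivIter a n x| * invExpansion a n x) := by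
    rw [h1, Real.sqrt_mul (abs_nonneg _), ← mul_pow, Real.sqrt_sq_eq_abs, abs_mul,
      abs_of_nonneg (S.invExpansion_nonneg n x)]
  have p1 := S.refDensity_pos hx
  have p0 := S.refDensity_pos hx0
  unfold refDensity at p1 p0 ⊢
  have q1 := (inv_pos.1 p1).ne'
  have q0 := (inv_pos.1 p0).ne'
  rw [hs] at q1 ⊢
  have q2 : |derivIter a n x| * invExpansion a n x ≠ 0 := right_ne_zero_of_mul q1
  have q3 := left_ne_zero_of_mul q2
  have q4 := right_ne_zero_of_mul q2
  field_simp

theorem finite_iterate_mem_postCrit (S : MTSetting a μ) (n : ℕ) :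
    {x | (Ta a)^[n] x ∈ postCrit a}.Finite := by
  have : {x | (Ta a)^[n] x ∈ postCrit a} = ⋃ c ∈ postCrit a, {x | (Ta a)^[n] x = c} := by
    ext x; simp
  rw [this]
  exact S.postCrit_finite.biUnion fun c _ => finite_iterate_Ta_eq S.pos.ne' n c

/-- Test functions composed with a branch of `T^n` remain test functions, contracted by the
expansion. -/
theorem abs_setIntegral_comp_le (S : MTSetting a μ) (n : ℕ) {J : Set ℝ} (hJ : J.OrdConnected)
    (hinj : InjOn ((Ta a)^[n]) J)
    (hmono : MonotoneOn (invExpansion a n) J ∨ AntitoneOn (invExpansion a n) J) {η : ℝ} (hη : 0 ≤ η)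
    (hb : ∀ x ∈ J, x ∈ Icc (-1 : ℝ) 1 → invExpansion a n x ≤ η) {θ : ℝ → ℝ} (hθ : Measurable θ)
    {C : ℝ} (hC : ∀ x, |θ x| ≤ C)
    (htest : ∀ J : Set ℝ, J.OrdConnected → |∫ x in J, θ x ∂refMeasure a| ≤ 1) :
    |∫ x in J, θ ((Ta a)^[n] x) ∂refMeasure a| ≤ η := by
  set F := (Ta a)^[n] with hF
  set I : Set ℝ := Icc (-1) 1 with hI
  have hFc : Continuous F := continuous_iterate_Ta n
  set J' := J ∩ I with hJ'
  have oJ' : J'.OrdConnected := hJ.inter ordConnected_Icc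
  have hFI : ∀ x ∈ J', F x ∈ I := fun x hx => iterate_Ta_mem_Icc S.ha n hx.2
  set q : ℝ → ℝ := fun x => |derivIter a n x| • (refDensity a (F x) * θ (F x)) with hq
  rw [setIntegral_refMeasure hJ.measurableSet]
  have e1 : ∫ x in J', refDensity a x * θ (F x) = ∫ x in J', invExpansion a n x * q x := by
    refine integral_congr_ae ?_
    have := measure_eq_zero_iff_ae_notMem.1 ((S.finite_iterate_mem_postCrit n).measure_zero volume)
    filter_upwards [ae_restrict_of_ae this] with x hx
    rw [S.refDensity_eq hx]
    simp only [hq, smul_eq_mul]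
    ring
  rw [e1]
  have hder : ∀ s : Set ℝ, ∀ x ∈ s, HasDerivWithinAt F (derivIter a n x) s x := fun s x _ =>
    (hasDerivAt_iterate_Ta n x).hasDerivWithinAt
  have hInt : IntegrableOn (fun y => refDensity a y * θ y) I :=
    S.integrableOn_refDensity.mul_bdd (c := C) hθ.aestronglyMeasurable (Eventually.of_forall hC)
  have hqi : IntegrableOn q J' := by
    rw [hq, ← integrableOn_image_iff_integrableOn_abs_deriv_smul oJ'.measurableSet (hder J')
      (hinj.mono inter_subset_left) (fun y => refDensity a y * θ y)]
    exact hInt.mono_set (image_subset_iff.2 hFI)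
  refine abs_integral_mul_le_of_superlevel hqi (continuous_invExpansion n).measurable
    (Eventually.of_forall (S.invExpansion_nonneg n)) ?_ hη fun t _ => ?_
  · filter_upwards [ae_restrict_mem oJ'.measurableSet] with x hx using hb x hx.1 hx.2
  · have mt : MeasurableSet {x | t < invExpansion a n x} :=
      measurableSet_lt measurable_const (continuous_invExpansion n).measurable
    rw [Measure.restrict_restrict mt]
    set L := {x | t < invExpansion a n x} ∩ J' with hL
    have oL : L.OrdConnected := by
      rw [ordConnected_iff]
      intro x hx y hy hxy z hz
      have hzJ : z ∈ J' := oJ'.out hx.2 hy.2 hz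
      refine ⟨?_, hzJ⟩
      rcases hmono with h | h
      · exact lt_of_lt_of_le hx.1 (h hx.2.1 hzJ.1 hz.1)
      · exact lt_of_lt_of_le hy.1 (h hzJ.1 hy.2.1 hz.2)
    have hLJ : L ⊆ J' := inter_subset_right
    rw [hq, ← integral_image_eq_integral_abs_deriv_smul oL.measurableSet (hder L)
      (hinj.mono (hLJ.trans inter_subset_left)) (fun y => refDensity a y * θ y)]
    have oFL : (F '' L).OrdConnected :=
      (oL.isPreconnected.image F hFc.continuousOn).ordConnected
    have hsub : F '' L ⊆ I := image_subset_iff.2 fun x hx => hFI x (hLJ hx)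
    have := htest _ oFL
    rwa [setIntegral_refMeasure oFL.measurableSet, inter_eq_left.2 hsub] at this

theorem exists_cut (S : MTSetting a μ) (n : ℕ) : ∃ Cut : Finset ℝ, ∀ K : Set ℝ, K.OrdConnected →
    (∀ c ∈ Cut, c ∈ K → K.Subsingleton) → InjOn ((Ta a)^[n]) K ∧
      (MonotoneOn (invExpansion a n) K ∨ AntitoneOn (invExpansion a n) K) := by
  classical
  obtain ⟨p, hp, hg⟩ := S.exists_poly_invExpansion n
  set Q := (iterPoly a n).derivative with hQ
  have hQ0 : Q ≠ 0 := by
    intro h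
    have := Polynomial.derivative_eq_zero.1 h
    rw [iterPoly_natDegree S.pos.ne'] at this
    exact absurd this (by positivity)
  set R := (p * p).derivative with hR
  refine ⟨Q.roots.toFinset ∪ R.roots.toFinset, fun K hK hcut => ?_⟩
  by_cases hsub : K.Subsingleton
  · exact ⟨hsub.injOn _, Or.inl (hsub.monotoneOn _)⟩
  have hno : ∀ c ∈ K, c ∉ Q.roots.toFinset ∪ R.roots.toFinset := fun c hc h => hsub (hcut c h hc)
  have hQn : ∀ c ∈ K, Q.eval c ≠ 0 := fun c hc h => hno c hc (by
    rw [Finset.mem_union, Multiset.mem_toFinset, Polynomial.mem_roots hQ0]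
    exact Or.inl h)
  constructor
  · have hlt : ∀ x ∈ K, ∀ y ∈ K, x < y → (Ta a)^[n] x ≠ (Ta a)^[n] y := by
      intro x hx y hy hxy h
      obtain ⟨c, hc, hd⟩ := exists_deriv_eq_zero hxy (continuous_iterate_Ta n).continuousOn h
      refine hQn c (hK.out hx hy (Ioo_subset_Icc_self hc)) ?_
      have e : (Ta a)^[n] = fun x => (iterPoly a n).eval x := by
        funext x; rw [iterPoly_eval]
      rw [e, Polynomial.deriv] at hd
      exact hd
    intro x hx y hy h
    rcases lt_trichotomy x y with h1 | h1 | h1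
    · exact absurd h (hlt x hx y hy h1)
    · exact h1
    · exact absurd h.symm (hlt y hy x hx h1)
  · have hle : ∀ x y, (p * p).eval x ≤ (p * p).eval y → invExpansion a n x ≤ invExpansion a n y := by
      intro x y h
      rw [hg, hg]
      refine Real.sqrt_le_sqrt ?_
      rw [Polynomial.eval_mul, Polynomial.eval_mul, ← sq, ← sq] at h
      exact sq_le_sq.1 h
    by_cases hR0 : R = 0
    · left
      intro x _ y _ _
      apply hle
      rw [Polynomial.eq_C_of_derivative_eq_zero hR0]
      simp
    have hRn : ∀ c ∈ K, R.eval c ≠ 0 := fun c hc h => hno c hc (by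
      rw [Finset.mem_union, Multiset.mem_toFinset (s := R.roots), Polynomial.mem_roots hR0]
      exact Or.inr h)
    have hcv : Convex ℝ K := hK.convex
    have hdR : ∀ x ∈ K, HasDerivWithinAt (fun x => (p * p).eval x) (R.eval x) K x := fun x _ =>
      ((p * p).hasDerivAt x).hasDerivWithinAt
    rcases hasDerivWithinAt_forall_lt_or_forall_gt_of_forall_ne hcv hdR hRn with h | h
    · right
      have : AntitoneOn (fun x => (p * p).eval x) K := antitoneOn_of_deriv_nonpos hcv
        (p * p).continuous.continuousOn (p * p).differentiable.differentiableOn fun x hx => by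
          rw [Polynomial.deriv]; exact (h x (interior_subset hx)).le
      exact fun x hx y hy hxy => hle _ _ (this hx hy hxy)
    · left
      have : MonotoneOn (fun x => (p * p).eval x) K := monotoneOn_of_deriv_nonneg hcv
        (p * p).continuous.continuousOn (p * p).differentiable.differentiableOn fun x hx => by
          rw [Polynomial.deriv]; exact (h x (interior_subset hx)).le
      exact fun x hx y hy hxy => hle _ _ (this hx hy hxy)

/-- Lasota–Yorke inequality for `T^n` near a set where `T^n` expands. -/
theorem exists_lasotaYorke (S : MTSetting a μ) (n : ℕ) {η : ℝ} (hη : 0 < η) {A : Set ℝ}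
    (hA : A ⊆ Icc (-1) 1) (hAη : ∀ x ∈ A, invExpansion a n x ≤ η) :
    ∃ (U : Set ℝ) (C : ℝ), MeasurableSet U ∧ A ⊆ U ∧ 0 ≤ C ∧
      ∀ (ν : Measure ℝ) (V : ℝ), IsFiniteMeasure ν → VarLE (refMeasure a) ν V →
        VarLE (refMeasure a) ((ν.restrict U).map ((Ta a)^[n])) (8 * η * V + C * ν.real univ) := by
  have := S.isFiniteMeasure_refMeasure
  obtain ⟨Cut, hCut⟩ := S.exists_cut n
  have huc : UniformContinuousOn (invExpansion a n) (Icc (-1 : ℝ) 1) :=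
    isCompact_Icc.uniformContinuousOn_of_continuous (continuous_invExpansion n).continuousOn
  rw [Metric.uniformContinuousOn_iff] at huc
  obtain ⟨δ, hδ, hδ'⟩ := huc η hη
  obtain ⟨ℓ, N, hℓ, hN, hmesh, hcutℓ⟩ := exists_label Cut hδ
  set G : Set ℕ := ℓ '' A with hG
  refine ⟨ℓ ⁻¹' G, ∑ i ∈ Finset.range N, 2 * η / (refMeasure a).real (ℓ ⁻¹' {i}),
    hℓ.measurable (MeasurableSet.of_discrete), subset_preimage_image ℓ A,
    Finset.sum_nonneg fun _ _ => div_nonneg (by linarith) measureReal_nonneg,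
    fun ν V hν hV => ?_⟩
  have := hV.map_restrict hℓ hN (continuous_iterate_Ta (a := a) n).measurable G (η := 2 * η)
    (by linarith) ?_
  · refine this.mono (le_of_eq ?_); ring
  · rintro i ⟨y, hyA, rfl⟩ J hJ hJi θ hθ ⟨C, hC⟩ htest
    obtain ⟨h1, h2⟩ := hCut J hJ fun c hc hcJ x hx z hz => by
      have e1 : ℓ c = ℓ y := hJi hcJ
      have e2 : ℓ x = ℓ y := hJi hx
      have e3 : ℓ z = ℓ y := hJi hz
      rw [hcutℓ c hc x (e2.trans e1.symm), hcutℓ c hc z (e3.trans e1.symm)]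
    refine S.abs_setIntegral_comp_le n hJ h1 h2 (by linarith) (fun x hx hxI => ?_) hθ hC htest
    have h3 := hδ' x hxI y (hA hyA) (by
      rw [Real.dist_eq]; exact hmesh x hxI y (hA hyA) (hJi hx))
    rw [Real.dist_eq] at h3
    linarith [(abs_lt.1 h3).2, hAη y hyA]

/-- An iterate of the map halves the variation. -/
theorem exists_contraction (S : MTSetting a μ) : ∃ (n : ℕ) (U : Set ℝ) (C : ℝ), 1 ≤ n ∧
    MeasurableSet U ∧ μ.support ⊆ U ∧ 0 ≤ C ∧
      ∀ (ν : Measure ℝ) (V : ℝ), IsFiniteMeasure ν → VarLE (refMeasure a) ν V →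
        VarLE (refMeasure a) ((ν.restrict U).map ((Ta a)^[n])) (V / 2 + C * ν.real univ) := by
  obtain ⟨n, hn, h⟩ := S.exists_invExpansion_le (η := 1 / 16) (by norm_num)
  obtain ⟨U, C, hU, hsU, hC, hLY⟩ := S.exists_lasotaYorke n (η := 1 / 16) (by norm_num)
    S.support_subset_Icc fun x hx => (h x hx).le
  refine ⟨n, U, C, hn, hU, hsU, hC, fun ν V hν hV => (hLY ν V hν hV).mono (le_of_eq ?_)⟩
  ring

theorem ae_mem_support_of_ac {ν : Measure ℝ} (hν : ν ≪ μ) : ∀ᵐ x ∂ν, x ∈ μ.support :=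
  hν.ae_le (Measure.support_mem_ae)

theorem exists_map_varLE (S : MTSetting a μ) (n : ℕ) : ∃ C : ℝ, 0 ≤ C ∧
    ∀ (ν : Measure ℝ) (V : ℝ), IsFiniteMeasure ν → ν ≪ μ → VarLE (refMeasure a) ν V →
      VarLE (refMeasure a) (ν.map ((Ta a)^[n])) (C * (V + ν.real univ)) := by
  obtain ⟨M, hM⟩ := isCompact_Icc.exists_bound_of_continuousOn (s := Icc (-1 : ℝ) 1)
    (continuous_invExpansion (a := a) n).continuousOn
  obtain ⟨U, C, hU, hsU, hC, hLY⟩ := S.exists_lasotaYorke n (η := max M 1) (by positivity)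
    Subset.rfl fun x hx => (le_abs_self _).trans ((hM x hx).trans (le_max_left _ _))
  refine ⟨max (8 * max M 1) C, by positivity, fun ν V hν hac hV => ?_⟩
  have := hLY ν V hν hV
  have hr : ν.restrict U = ν := Measure.restrict_eq_self_of_ae_mem <| by
    filter_upwards [ae_mem_support_of_ac hac] with x hx using hsU (S.support_subset_Icc hx)
  rw [hr] at this
  refine this.mono ?_
  rw [mul_add]
  exact add_le_add (mul_le_mul_of_nonneg_right (le_max_left _ _) hV.nonneg)
    (mul_le_mul_of_nonneg_right (le_max_right _ _) measureReal_nonneg)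

theorem exists_varLE (S : MTSetting a μ) : ∃ C : ℝ, VarLE (refMeasure a) μ C := by
  have := S.isFiniteMeasure_refMeasure
  have := S.prob
  obtain ⟨n, U, C, -, hU, hsU, hC, hLY⟩ := S.exists_contraction
  refine ⟨2 * C, varLE_of_lasotaYorke ae_refMeasure_mem_Icc S.ac_refMeasure hU ?_
    (S.mp.iterate n) hC hLY⟩
  filter_upwards [ae_mem_support_of_ac (Measure.AbsolutelyContinuous.refl μ)] with x hx using hsU hx

end MTSetting

/-- A probability measure of bounded variation with respect to a measure `m` has a piece, in any
fine enough interval partition, on which it dominates a multiple of `m`. -/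
theorem exists_fiber_lower {m μ : Measure ℝ} [IsFiniteMeasure m] [IsProbabilityMeasure μ] {V : ℝ}
    (hV : VarLE m μ V) {ℓ : ℝ → ℕ} {N : ℕ} (hℓ : Monotone ℓ) (hN : ∀ x, ℓ x < N)
    (hsmall : ∀ i, m.real (ℓ ⁻¹' {i}) ≤ 1 / (8 * (V + 1))) :
    ∃ i, 0 < m.real (ℓ ⁻¹' {i}) ∧ ∃ c > 0, ∀ A ⊆ ℓ ⁻¹' {i}, MeasurableSet A →
      c * m.real A ≤ μ.real A := by
  have hV0 := hV.nonneg
  set M := m.real univ with hM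
  have hM0 : 0 ≤ M := measureReal_nonneg
  set c : ℝ := 1 / (2 * (M + 1)) with hc
  have hc0 : 0 < c := by positivity
  by_contra hcon
  have hA : ∀ i, ∃ A ⊆ ℓ ⁻¹' {i}, MeasurableSet A ∧ μ.real A ≤ c * m.real A + (if m.real (ℓ ⁻¹' {i}) = 0 then 1 else 0) ∧
      (m.real (ℓ ⁻¹' {i}) = 0 ∨ 0 < m.real A) := by
    intro i
    by_cases h0 : m.real (ℓ ⁻¹' {i}) = 0
    · refine ⟨ℓ ⁻¹' {i}, Subset.rfl, measurableSet_fiber hℓ i, ?_, Or.inl h0⟩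
      rw [if_pos h0, h0, mul_zero, zero_add]
      exact measureReal_le_one
    · have hpos := lt_of_le_of_ne measureReal_nonneg (Ne.symm h0)
      by_contra h
      refine hcon ⟨i, hpos, c, hc0, fun A hAs mA => ?_⟩
      by_contra hlt
      rw [not_le] at hlt
      refine h ⟨A, hAs, mA, ?_, Or.inr ?_⟩
      · rw [if_neg h0, add_zero]; exact hlt.le
      · have := measureReal_nonneg.trans_lt hlt
        exact (mul_pos_iff_of_pos_left hc0).1 this
  choose A hAs mA hAμ hAm using hA
  set w : ℕ → ℝ := fun i => m.real (ℓ ⁻¹' {i}) / m.real (A i) with hw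
  have hw0 : ∀ i, 0 ≤ w i := fun i => div_nonneg measureReal_nonneg measureReal_nonneg
  have hwA : ∀ i, w i * m.real (A i) = m.real (ℓ ⁻¹' {i}) := by
    intro i
    rcases hAm i with h | h
    · simp [hw, h]
    · simp only [hw]; field_simp
  set θ : ℝ → ℝ := fun x => 1 - ∑ i ∈ Finset.range N, w i * (A i).indicator 1 x with hθ
  have mθ : Measurable θ := measurable_const.sub (Finset.measurable_sum _ fun i _ =>
    (measurable_one.indicator (mA i)).const_mul _)
  have ind : ∀ i x, 0 ≤ (A i).indicator (1 : ℝ → ℝ) x ∧ (A i).indicator (1 : ℝ → ℝ) x ≤ 1 := by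
    intro i x
    by_cases hx : x ∈ A i <;> simp [hx]
  have bθ : ∀ x, |θ x| ≤ 1 + ∑ i ∈ Finset.range N, w i := by
    intro x
    refine (abs_sub _ _).trans (add_le_add (by simp) ?_)
    rw [abs_of_nonneg (Finset.sum_nonneg fun i _ => mul_nonneg (hw0 i) (ind i x).1)]
    exact Finset.sum_le_sum fun i _ => mul_le_of_le_one_right (hw0 i) (ind i x).2
  have hInt : ∀ κ : Measure ℝ, IsFiniteMeasure κ →
      ∫ x, θ x ∂κ = κ.real univ - ∑ i ∈ Finset.range N, w i * κ.real (A i) := by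
    intro κ _
    have hi : ∀ i, Integrable (fun x => w i * (A i).indicator (1 : ℝ → ℝ) x) κ := fun i =>
      ((integrable_const (1 : ℝ)).indicator (mA i)).const_mul _
    simp only [hθ]
    rw [integral_sub (integrable_const _) (integrable_finsetSum _ fun i _ => hi i),
      integral_finsetSum _ fun i _ => hi i]
    simp [integral_const_mul, integral_indicator_one (mA _)]
  have hfib : ∀ i, ∀ J : Set ℝ, MeasurableSet J → ∫ x in J ∩ ℓ ⁻¹' {i}, θ x ∂m =
      m.real (J ∩ ℓ ⁻¹' {i}) - w i * m.real (A i ∩ J) := by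
    intro i J hJ
    by_cases hi : i < N
    · rw [hInt _ inferInstance, Finset.sum_eq_single_of_mem i (Finset.mem_range.2 hi)]
      · simp only [measureReal_restrict_apply MeasurableSet.univ, univ_inter,
          measureReal_restrict_apply (mA i)]
        rw [inter_comm J, ← inter_assoc, inter_eq_left.2 (hAs i)]
      · intro j _ hji
        rw [measureReal_restrict_apply (mA j)]
        have : A j ∩ (J ∩ ℓ ⁻¹' {i}) = ∅ := by
          rw [eq_empty_iff_forall_notMem]
          rintro x ⟨h1, -, h2⟩
          have h3 : ℓ x = j := hAs j h1
          have h4 : ℓ x = i := h2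
          exact hji (h3.symm.trans h4)
        simp [this]
    · have h0 : ℓ ⁻¹' {i} = ∅ := by
        rw [eq_empty_iff_forall_notMem]
        intro x hx
        have h4 : ℓ x = i := hx
        exact hi (h4 ▸ hN x)
      have hA0 : A i = ∅ := subset_empty_iff.1 (h0 ▸ hAs i)
      simp [h0, hA0]
  have iθ : Integrable θ m := integrable_of_abs_le_one mθ bθ
  have hJ : ∀ J : Set ℝ, J.OrdConnected → |∫ x in J, θ x ∂m| ≤ 2 * (1 / (8 * (V + 1))) := by
    refine abs_setIntegral_le_of_pieces hℓ hN iθ (fun i => ?_) fun i J hJ => ?_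
    · have := hfib i univ MeasurableSet.univ
      rw [univ_inter, inter_univ, hwA, sub_self] at this
      exact this
    · rw [hfib i J hJ.measurableSet]
      have h1 : m.real (J ∩ ℓ ⁻¹' {i}) ≤ 1 / (8 * (V + 1)) :=
        (measureReal_mono inter_subset_right).trans (hsmall i)
      have h2 : w i * m.real (A i ∩ J) ≤ 1 / (8 * (V + 1)) :=
        (mul_le_mul_of_nonneg_left (measureReal_mono inter_subset_left) (hw0 i)).trans
          ((hwA i).le.trans (hsmall i))
      have h3 : 0 ≤ m.real (J ∩ ℓ ⁻¹' {i}) := measureReal_nonneg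
      have h4 : 0 ≤ w i * m.real (A i ∩ J) := mul_nonneg (hw0 i) measureReal_nonneg
      rw [abs_le]; constructor <;> linarith
  have h1 := hV.integral_le mθ bθ (by positivity) hJ
  rw [hInt μ inferInstance, probReal_univ] at h1
  have h2 : ∑ i ∈ Finset.range N, w i * μ.real (A i) ≤ c * M := by
    have hMs : M = ∑ i ∈ Finset.range N, m.real (ℓ ⁻¹' {i}) := by
      have := integral_eq_sum_fibers m hℓ hN (integrable_const (1 : ℝ))
      simpa [measureReal_restrict_apply, hM] using this
    rw [hMs, Finset.mul_sum]
    refine Finset.sum_le_sum fun i _ => ?_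
    by_cases h0 : m.real (ℓ ⁻¹' {i}) = 0
    · have : w i = 0 := by simp [hw, h0]
      rw [this, h0]; simp
    · have := hAμ i
      rw [if_neg h0, add_zero] at this
      calc w i * μ.real (A i) ≤ w i * (c * m.real (A i)) := mul_le_mul_of_nonneg_left this (hw0 i)
        _ = c * (w i * m.real (A i)) := by ring
        _ = _ := by rw [hwA]
  have h3 : c * M < 1 / 2 := by
    rw [hc, div_mul_eq_mul_div, one_mul, div_lt_div_iff₀ (by positivity) (by norm_num)]
    linarith
  have h4 : 2 * (1 / (8 * (V + 1))) * V ≤ 1 / 4 := by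
    rw [← mul_div_assoc, mul_one, div_mul_eq_mul_div, div_le_div_iff₀ (by positivity) (by norm_num)]
    linarith
  linarith

/-- `μ` dominates a multiple of Lebesgue measure on `J`. -/
def LowerOn (μ : Measure ℝ) (J : Set ℝ) : Prop :=
  ∃ c : ℝ, 0 < c ∧ ∀ A ⊆ J, MeasurableSet A → volume A ≤ ENNReal.ofReal c * μ A

namespace LowerOn

variable {μ : Measure ℝ} {J J' : Set ℝ}

theorem mono (h : LowerOn μ J) (hs : J' ⊆ J) : LowerOn μ J' :=
  let ⟨c, hc, hA⟩ := h
  ⟨c, hc, fun A hAs => hA A (hAs.trans hs)⟩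

theorem union (h : LowerOn μ J) (h' : LowerOn μ J') (mJ : MeasurableSet J) :
    LowerOn μ (J ∪ J') := by
  obtain ⟨c, hc, hA⟩ := h
  obtain ⟨c', hc', hA'⟩ := h'
  refine ⟨c + c', by positivity, fun A hAs mA => ?_⟩
  have h1 := hA (A ∩ J) inter_subset_right (mA.inter mJ)
  have h2 := hA' (A \ J) (fun x hx => (hAs hx.1).resolve_left hx.2) (mA.diff mJ)
  calc volume A = volume (A ∩ J ∪ A \ J) := by rw [inter_union_sdiff]
    _ ≤ volume (A ∩ J) + volume (A \ J) := measure_union_le _ _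
    _ ≤ ENNReal.ofReal c * μ A + ENNReal.ofReal c' * μ A := add_le_add
        (h1.trans (by gcongr; exact inter_subset_left)) (h2.trans (by gcongr; exact sdiff_subset))
    _ = _ := by rw [← add_mul, ENNReal.ofReal_add hc.le hc'.le]

theorem empty : LowerOn μ ∅ :=
  ⟨1, one_pos, fun A hA _ => by simp [subset_empty_iff.1 hA]⟩

theorem biUnion {ι : Type*} {s : Set ι} (hs : s.Finite) {K : ι → Set ℝ}
    (mK : ∀ i, MeasurableSet (K i)) (h : ∀ i ∈ s, LowerOn μ (K i)) : LowerOn μ (⋃ i ∈ s, K i) := by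
  induction s, hs using Set.Finite.induction_on with
  | empty => simpa using empty
  | insert _ _ ih =>
    rw [biUnion_insert]
    exact (h _ (mem_insert _ _)).union (ih fun i hi => h i (mem_insert_of_mem _ hi)) (mK _)

theorem measure_ne_zero (h : LowerOn μ J) {A : Set ℝ} (hA : A ⊆ J) (mA : MeasurableSet A)
    (hv : volume A ≠ 0) : μ A ≠ 0 := by
  obtain ⟨c, -, hc⟩ := h
  intro h0
  have := hc A hA mA
  rw [h0, mul_zero] at this
  exact hv (le_antisymm this zero_le)

end LowerOn

namespace MTSetting

variable {a : ℝ} {μ : Measure ℝ}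

theorem lowerOn_image (S : MTSetting a μ) {J : Set ℝ} (mJ : MeasurableSet J) (hJ : J ⊆ Icc (-1) 1)
    (h : LowerOn μ J) : LowerOn μ (Ta a '' J) := by
  obtain ⟨c, hc, hA⟩ := h
  refine ⟨4 * c, by positivity, fun A hAs mA => ?_⟩
  set A' := J ∩ Ta a ⁻¹' A with hA'
  have mA' : MeasurableSet A' := mJ.inter (continuous_Ta.measurable mA)
  have him : Ta a '' A' = A := by
    rw [hA', image_inter_preimage, inter_eq_right.2 hAs]
  have hlip : LipschitzOnWith 4 (Ta a) A' := LipschitzOnWith.of_dist_le_mul fun x hx y hy => by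
    rw [Real.dist_eq, Real.dist_eq]
    exact Ta_lipschitz_Icc S.ha (hJ hx.1) (hJ hy.1)
  have h1 := hlip.hausdorffMeasure_image_le (d := 1) zero_le_one
  rw [him, hausdorffMeasure_real] at h1
  calc volume A ≤ 4 * volume A' := by simpa using h1
    _ ≤ 4 * (ENNReal.ofReal c * μ A') := by gcongr; exact hA A' inter_subset_left mA'
    _ ≤ 4 * (ENNReal.ofReal c * μ A) := by
        have : μ A' ≤ μ A := by
          rw [← S.mp.measure_preimage mA.nullMeasurableSet]
          exact measure_mono inter_subset_right
        gcongr
    _ = _ := by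
        rw [ENNReal.ofReal_mul (by norm_num), mul_assoc]; norm_num

theorem lowerOn_iterate_image (S : MTSetting a μ) {p q : ℝ} (hJ : Icc p q ⊆ Icc (-1) 1)
    (h : LowerOn μ (Icc p q)) (n : ℕ) : LowerOn μ ((Ta a)^[n] '' Icc p q) := by
  induction n with
  | zero => simpa using h
  | succ n ih =>
    rw [Function.iterate_succ', image_comp]
    refine S.lowerOn_image ?_ ?_ ih
    · exact (isCompact_Icc.image (continuous_iterate_Ta n)).measurableSet
    · rintro _ ⟨x, hx, rfl⟩
      exact iterate_Ta_mem_Icc S.ha n (hJ hx)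

theorem exists_label_refMeasure (S : MTSetting a μ) {ε : ℝ} (hε : 0 < ε) :
    ∃ (ℓ : ℝ → ℕ) (N : ℕ), Monotone ℓ ∧ (∀ x, ℓ x < N) ∧
      ∀ i, (refMeasure a).real (ℓ ⁻¹' {i}) ≤ ε := by
  have := S.isFiniteMeasure_refMeasure
  obtain ⟨K, hK, hball⟩ := S.exists_refMeasure_ball_le
  have hδ : 0 < (ε / K) ^ 2 := by positivity
  obtain ⟨ℓ, N, hℓ, hN, hmesh, -⟩ := exists_label ∅ hδ
  refine ⟨ℓ, N, hℓ, hN, fun i => ?_⟩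
  by_cases hi : ∃ y ∈ Icc (-1 : ℝ) 1, ℓ y = i
  · obtain ⟨y, hy, rfl⟩ := hi
    refine ENNReal.toReal_le_of_le_ofReal hε.le ?_
    calc _ ≤ refMeasure a (Metric.ball y ((ε / K) ^ 2)) := by
          refine measure_mono_ae ?_
          filter_upwards [ae_refMeasure_mem_Icc (a := a)] with x hx hxi
          change x ∈ Metric.ball y _
          rw [Metric.mem_ball, Real.dist_eq]
          exact hmesh x hx y hy hxi
      _ ≤ _ := hball _ _ hδ
      _ = _ := by
          rw [Real.sqrt_sq (by positivity)]
          congr 1; field_simp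
  · have : refMeasure a (ℓ ⁻¹' {i}) = 0 := by
      rw [measure_eq_zero_iff_ae_notMem]
      filter_upwards [ae_refMeasure_mem_Icc (a := a)] with x hx hxi
      exact hi ⟨x, hx, hxi⟩
    rw [Measure.real, this]; simpa using hε.le

theorem exists_lowerOn_Icc (S : MTSetting a μ) : ∃ p q : ℝ, p < q ∧ Icc p q ⊆ Icc (-1) 1 ∧
    LowerOn μ (Icc p q) := by
  have := S.isFiniteMeasure_refMeasure
  have := S.prob
  obtain ⟨V, hV⟩ := S.exists_varLE
  have := hV.nonneg
  obtain ⟨ℓ, N, hℓ, hN, hsm⟩ := S.exists_label_refMeasure (ε := 1 / (8 * (V + 1))) (by positivity)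
  obtain ⟨i, hi, c, hc, hA⟩ := exists_fiber_lower hV hℓ hN hsm
  obtain ⟨K, hK, hvol⟩ := S.exists_volume_le_refMeasure
  set J := ℓ ⁻¹' {i} ∩ Icc (-1 : ℝ) 1 with hJ
  have oJ : J.OrdConnected := (ordConnected_fiber hℓ i).inter ordConnected_Icc
  have hns : ¬ J.Subsingleton := by
    intro hs
    have h0 : refMeasure a J = 0 := refMeasure_ac (hs.measure_zero _)
    have h1 : refMeasure a (ℓ ⁻¹' {i}) = 0 := by
      refine le_antisymm (le_trans (measure_mono_ae ?_) h0.le) zero_le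
      filter_upwards [ae_refMeasure_mem_Icc (a := a)] with x hx hxi using ⟨hxi, hx⟩
    rw [Measure.real, h1] at hi
    simp at hi
  rw [not_subsingleton_iff] at hns
  obtain ⟨p, hp, q, hq, hpq⟩ := hns.exists_lt
  have hsub : Icc p q ⊆ J := oJ.out hp hq
  refine ⟨p, q, hpq, hsub.trans inter_subset_right, K / c, by positivity, fun A hAs mA => ?_⟩
  have h1 := hvol A (hAs.trans (hsub.trans inter_subset_right)) mA
  refine h1.trans ?_
  have h2 := hA A (hAs.trans (hsub.trans inter_subset_left)) mA
  rw [← ofReal_measureReal (μ := refMeasure a) (s := A), ← ofReal_measureReal (μ := μ) (s := A),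
    ← ENNReal.ofReal_mul hK.le, ← ENNReal.ofReal_mul (by positivity)]
  apply ENNReal.ofReal_le_ofReal
  rw [div_mul_eq_mul_div, le_div_iff₀ hc]
  nlinarith

theorem exists_lowerOn_postCrit (S : MTSetting a μ) : ∃ c ∈ postCrit a, ∃ d ∈ postCrit a, c < d ∧
    LowerOn μ (Icc c d) := by
  obtain ⟨p, q, hpq, hI, hlow⟩ := S.exists_lowerOn_Icc
  have hsub : ∀ u v, p ≤ u → u < v → v ≤ q → ∃ x ∈ Icc u v, ∃ n, (Ta a)^[n] x = 0 := by
    intro u v hu huv hv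
    refine S.exists_iterate_eq_zero ordConnected_Icc
      (hlow.measure_ne_zero (Icc_subset_Icc hu hv) measurableSet_Icc ?_)
    simpa using huv
  obtain ⟨x₁, hx₁, n₁, h₁⟩ := hsub p (p + (q - p) / 3) le_rfl (by linarith) (by linarith)
  obtain ⟨x₂, hx₂, n₂, h₂⟩ := hsub (q - (q - p) / 3) q (by linarith) (by linarith) le_rfl
  have hlt : x₁ < x₂ := by linarith [hx₁.2, hx₂.1]
  set n := max n₁ n₂ + 1 with hn
  have q₁ : (Ta a)^[n] x₁ ∈ postCrit a := iterate_mem_postCrit_of_eq_zero (by omega) h₁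
  have q₂ : (Ta a)^[n] x₂ ∈ postCrit a := iterate_mem_postCrit_of_eq_zero (by omega) h₂
  have hin : Icc x₁ x₂ ⊆ Icc p q := Icc_subset_Icc hx₁.1 hx₂.2
  have hFc : Continuous ((Ta a)^[n]) := continuous_iterate_Ta n
  -- two points whose images are distinct postcritical points
  obtain ⟨y, hy, hyP, hne⟩ : ∃ y ∈ Icc x₁ x₂, (Ta a)^[n] y ∈ postCrit a ∧
      (Ta a)^[n] y ≠ (Ta a)^[n] x₁ := by
    by_cases hne : (Ta a)^[n] x₂ = (Ta a)^[n] x₁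
    swap
    · exact ⟨x₂, right_mem_Icc.2 hlt.le, q₂, hne⟩
    have hcrit : ∀ y ∈ Icc x₁ x₂, (Ta a)^[n] y ≠ (Ta a)^[n] x₁ →
        IsMaxOn ((Ta a)^[n]) (Icc x₁ x₂) y ∨ IsMinOn ((Ta a)^[n]) (Icc x₁ x₂) y →
        (Ta a)^[n] y ∈ postCrit a := by
      intro y hy hyne hext
      have h1 : y ≠ x₁ := fun h => hyne (by rw [h])
      have h2 : y ≠ x₂ := fun h => hyne (by rw [h, hne])
      have hnb : Icc x₁ x₂ ∈ 𝓝 y := Icc_mem_nhds (lt_of_le_of_ne hy.1 h1.symm) (lt_of_le_of_ne hy.2 h2)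
      have hd : derivIter a n y = 0 := by
        rcases hext with h | h
        · exact (h.isLocalMax hnb).hasDerivAt_eq_zero (hasDerivAt_iterate_Ta n y)
        · exact (h.isLocalMin hnb).hasDerivAt_eq_zero (hasDerivAt_iterate_Ta n y)
      have := mt (derivIter_ne_zero_iff S.pos).2 (not_not.2 hd)
      push Not at this
      obtain ⟨j, hj, hj0⟩ := this
      exact iterate_mem_postCrit_of_eq_zero hj hj0
    obtain ⟨y, hy, hymax⟩ := isCompact_Icc.exists_isMaxOn (nonempty_Icc.2 hlt.le) hFc.continuousOn
    obtain ⟨z, hz, hzmin⟩ := isCompact_Icc.exists_isMinOn (nonempty_Icc.2 hlt.le) hFc.continuousOn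
    by_cases hy1 : (Ta a)^[n] y = (Ta a)^[n] x₁
    · by_cases hz1 : (Ta a)^[n] z = (Ta a)^[n] x₁
      · exfalso
        have hsub : Icc x₁ x₂ ⊆ {x | (Ta a)^[n] x = (Ta a)^[n] x₁} := fun x hx =>
          le_antisymm ((hymax hx).trans hy1.le) (hz1.ge.trans (hzmin hx))
        exact (Icc_infinite hlt) ((finite_iterate_Ta_eq S.pos.ne' n _).subset hsub)
      · exact ⟨z, hz, hcrit z hz hz1 (Or.inr hzmin), hz1⟩
    · exact ⟨y, hy, hcrit y hy hy1 (Or.inl hymax), hy1⟩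
  have himg : ((Ta a)^[n] '' Icc p q).OrdConnected :=
    (isPreconnected_Icc.image _ hFc.continuousOn).ordConnected
  have m₁ : (Ta a)^[n] x₁ ∈ (Ta a)^[n] '' Icc p q := mem_image_of_mem _ (hin (left_mem_Icc.2 hlt.le))
  have m₂ : (Ta a)^[n] y ∈ (Ta a)^[n] '' Icc p q := mem_image_of_mem _ (hin hy)
  have hl := S.lowerOn_iterate_image hI hlow n
  rcases lt_or_gt_of_ne hne with h | h
  · exact ⟨_, hyP, _, q₁, h, hl.mono (himg.out m₂ m₁)⟩
  · exact ⟨_, q₁, _, hyP, h, hl.mono (himg.out m₁ m₂)⟩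

end MTSetting

/-- The union of the intervals with postcritical endpoints on which `μ` dominates a multiple of
Lebesgue measure. -/
def coreSet (a : ℝ) (μ : Measure ℝ) : Set ℝ :=
  ⋃ p ∈ {p : ℝ × ℝ | p.1 ∈ postCrit a ∧ p.2 ∈ postCrit a ∧ p.1 < p.2 ∧ LowerOn μ (Icc p.1 p.2)},
    Icc p.1 p.2

namespace MTSetting

variable {a : ℝ} {μ : Measure ℝ}

theorem mem_coreSet {x : ℝ} : x ∈ coreSet a μ ↔ ∃ c ∈ postCrit a, ∃ d ∈ postCrit a, c < d ∧
    LowerOn μ (Icc c d) ∧ x ∈ Icc c d := by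
  simp only [coreSet, mem_iUnion, mem_ofPred_eq, Prod.exists]
  constructor
  · rintro ⟨c, d, ⟨hc, hd, hcd, hl⟩, hx⟩
    exact ⟨c, hc, d, hd, hcd, hl, hx⟩
  · rintro ⟨c, hc, d, hd, hcd, hl, hx⟩
    exact ⟨c, d, ⟨hc, hd, hcd, hl⟩, hx⟩

theorem finite_corePairs (S : MTSetting a μ) : {p : ℝ × ℝ | p.1 ∈ postCrit a ∧ p.2 ∈ postCrit a ∧
    p.1 < p.2 ∧ LowerOn μ (Icc p.1 p.2)}.Finite :=
  (S.postCrit_finite.prod S.postCrit_finite).subset fun _ hp => ⟨hp.1, hp.2.1⟩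

theorem isClosed_coreSet (S : MTSetting a μ) : IsClosed (coreSet a μ) :=
  S.finite_corePairs.isClosed_biUnion fun _ _ => isClosed_Icc

theorem lowerOn_coreSet (S : MTSetting a μ) : LowerOn μ (coreSet a μ) :=
  LowerOn.biUnion S.finite_corePairs (fun _ => measurableSet_Icc) fun _ hp => hp.2.2.2

theorem mapsTo_coreSet (S : MTSetting a μ) : MapsTo (Ta a) (coreSet a μ) (coreSet a μ) := by
  intro x hx
  obtain ⟨c, hc, d, hd, hcd, hl, hx⟩ := mem_coreSet.1 hx
  have hcrit : ∀ y ∈ Icc c d, IsMaxOn (Ta a) (Icc c d) y ∨ IsMinOn (Ta a) (Icc c d) y →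
      Ta a y ∈ postCrit a := by
    intro y hy hext
    by_cases h1 : y = c
    · rw [h1]; exact mapsTo_postCrit hc
    by_cases h2 : y = d
    · rw [h2]; exact mapsTo_postCrit hd
    have hnb : Icc c d ∈ 𝓝 y :=
      Icc_mem_nhds (lt_of_le_of_ne hy.1 (Ne.symm h1)) (lt_of_le_of_ne hy.2 h2)
    have h0 : -2 * a * y = 0 := by
      rcases hext with h | h
      · exact (h.isLocalMax hnb).hasDerivAt_eq_zero (hasDerivAt_Ta y)
      · exact (h.isLocalMin hnb).hasDerivAt_eq_zero (hasDerivAt_Ta y)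
    have hy0 : y = 0 := by
      have := S.pos
      rcases mul_eq_zero.1 h0 with h | h
      · linarith
      · exact h
    rw [hy0, Ta_zero]
    exact one_mem_postCrit
  obtain ⟨y, hy, hymax⟩ := isCompact_Icc.exists_isMaxOn (nonempty_Icc.2 hcd.le)
    (continuous_Ta (a := a)).continuousOn
  obtain ⟨z, hz, hzmin⟩ := isCompact_Icc.exists_isMinOn (nonempty_Icc.2 hcd.le)
    (continuous_Ta (a := a)).continuousOn
  have himg : (Ta a '' Icc c d).OrdConnected :=
    (isPreconnected_Icc.image _ continuous_Ta.continuousOn).ordConnected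
  have hI : Icc c d ⊆ Icc (-1) 1 := Icc_subset_Icc (S.postCrit_subset hc).1 (S.postCrit_subset hd).2
  refine mem_coreSet.2 ⟨_, hcrit z hz (Or.inr hzmin), _, hcrit y hy (Or.inl hymax), ?_,
    (S.lowerOn_image measurableSet_Icc hI hl).mono
      (himg.out (mem_image_of_mem _ hz) (mem_image_of_mem _ hy)), hzmin hx, hymax hx⟩
  refine lt_of_le_of_ne (hzmin hy) fun h => ?_
  have hsub : Icc c d ⊆ {x | (Ta a)^[1] x = Ta a z} := fun w hw =>
    le_antisymm ((hymax hw).trans h.ge) (hzmin hw)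
  exact (Icc_infinite hcd) ((finite_iterate_Ta_eq S.pos.ne' 1 _).subset hsub)

theorem ae_mem_coreSet (S : MTSetting a μ) : ∀ᵐ x ∂μ, x ∈ coreSet a μ := by
  have := S.prob
  obtain ⟨c, hc, d, hd, hcd, hl⟩ := S.exists_lowerOn_postCrit
  have hsub : Icc c d ⊆ coreSet a μ := fun x hx => mem_coreSet.2 ⟨c, hc, d, hd, hcd, hl, hx⟩
  have hne : μ (Icc c d) ≠ 0 := hl.measure_ne_zero Subset.rfl measurableSet_Icc (by simpa using hcd)
  rcases S.erg.ae_empty_or_univ_of_ae_le_preimage S.isClosed_coreSet.measurableSet.nullMeasurableSet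
    (Eventually.of_forall S.mapsTo_coreSet) with h | h
  · exact absurd (measure_mono_null hsub (ae_eq_empty.1 h)) hne
  · exact mem_ae_iff.2 (ae_eq_univ.1 h)

theorem support_subset_coreSet (S : MTSetting a μ) : μ.support ⊆ coreSet a μ :=
  Measure.support_subset_of_isClosed S.isClosed_coreSet S.ae_mem_coreSet

theorem zero_mem_coreSet (S : MTSetting a μ) : (0 : ℝ) ∈ coreSet a μ := by
  obtain ⟨c, hc, d, hd, hcd, hl⟩ := S.exists_lowerOn_postCrit
  obtain ⟨x, hx, n, hn⟩ := S.exists_iterate_eq_zero ordConnected_Icc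
    (hl.measure_ne_zero Subset.rfl measurableSet_Icc (by simpa using hcd))
  rw [← hn]
  exact S.mapsTo_coreSet.iterate n (mem_coreSet.2 ⟨c, hc, d, hd, hcd, hl, hx⟩)

theorem refMeasure_restrict_coreSet_ac (S : MTSetting a μ) :
    (refMeasure a).restrict (coreSet a μ) ≪ μ := by
  have mE := S.isClosed_coreSet.measurableSet
  obtain ⟨c, -, hc⟩ := S.lowerOn_coreSet
  refine Measure.AbsolutelyContinuous.mk fun A mA hA => ?_
  rw [Measure.restrict_apply mA]
  refine refMeasure_ac (le_antisymm ?_ zero_le)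
  refine (hc _ inter_subset_right (mA.inter mE)).trans ?_
  rw [measure_mono_null inter_subset_left hA, mul_zero]

/-- Linear lower bound for the measure of small balls centred in the core. -/
theorem exists_le_measure_ball (S : MTSetting a μ) {x : ℝ} (hx : x ∈ coreSet a μ) :
    ∃ k > 0, ∃ s₀ > 0, ∀ s, 0 < s → s ≤ s₀ → ENNReal.ofReal (k * s) ≤ μ (Metric.ball x s) := by
  obtain ⟨c, -, d, -, hcd, ⟨K, hK, hA⟩, hx⟩ := mem_coreSet.1 hx
  refine ⟨K⁻¹, by positivity, (d - c) / 2, by linarith, fun s hs hs' => ?_⟩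
  obtain ⟨u, hu, hu'⟩ : ∃ u, Ioo u (u + s) ⊆ Icc c d ∧ Ioo u (u + s) ⊆ Metric.ball x s := by
    rcases le_total x ((c + d) / 2) with h | h
    · refine ⟨x, fun y hy => ⟨by linarith [hx.1, hy.1], by linarith [hy.2]⟩, fun y hy => ?_⟩
      rw [Metric.mem_ball, Real.dist_eq, abs_lt]
      constructor <;> linarith [hy.1, hy.2]
    · refine ⟨x - s, fun y hy => ⟨by linarith [hy.1], by linarith [hx.2, hy.2]⟩, fun y hy => ?_⟩
      rw [Metric.mem_ball, Real.dist_eq, abs_lt]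
      constructor <;> linarith [hy.1, hy.2]
  have h1 := hA _ hu measurableSet_Ioo
  rw [Real.volume_Ioo, add_sub_cancel_left] at h1
  calc ENNReal.ofReal (K⁻¹ * s) = ENNReal.ofReal K⁻¹ * ENNReal.ofReal s :=
        ENNReal.ofReal_mul (by positivity)
    _ ≤ ENNReal.ofReal K⁻¹ * (ENNReal.ofReal K * μ (Ioo u (u + s))) := by gcongr
    _ = μ (Ioo u (u + s)) := by
        rw [← mul_assoc, ← ENNReal.ofReal_mul (by positivity), inv_mul_cancel₀ hK.ne',
          ENNReal.ofReal_one, one_mul]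
    _ ≤ _ := measure_mono hu'

/-- The reference measure of small balls around a point of the support is controlled by `μ`. -/
theorem exists_refMeasure_ball_le_measure (S : MTSetting a μ) {z : ℝ} (hz : z ∈ μ.support) :
    ∃ K > 0, ∃ r₀ > 0, ∀ r, 0 < r → r ≤ r₀ →
      (refMeasure a).real (Metric.ball z r) ≤ K * μ.real (Metric.ball z r) := by
  have := S.isFiniteMeasure_refMeasure
  have := S.prob
  suffices h : ∃ f : ℝ → ℝ, ∃ K > 0, ∃ k > 0, ∃ r₀ > 0, ∀ r, 0 < r → r ≤ r₀ → 0 ≤ f r ∧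
      refMeasure a (Metric.ball z r) ≤ ENNReal.ofReal (K * f r) ∧
      ENNReal.ofReal (k * f r) ≤ μ (Metric.ball z r) by
    obtain ⟨f, K, hK, k, hk, r₀, hr₀, h⟩ := h
    refine ⟨K / k, by positivity, r₀, hr₀, fun r hr hr' => ?_⟩
    obtain ⟨h0, h1, h2⟩ := h r hr hr'
    have h1' : (refMeasure a).real (Metric.ball z r) ≤ K * f r :=
      ENNReal.toReal_le_of_le_ofReal (by positivity) h1
    have h2' : k * f r ≤ μ.real (Metric.ball z r) :=
      (ENNReal.ofReal_le_iff_le_toReal (measure_ne_top _ _)).1 h2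
    calc _ ≤ K * f r := h1'
      _ = K / k * (k * f r) := by field_simp
      _ ≤ _ := by gcongr
  by_cases hzP : z ∈ postCrit a
  · obtain ⟨j, hj, rfl⟩ := hzP
    obtain ⟨K, hK, hK'⟩ := S.exists_refMeasure_ball_le
    obtain ⟨k, hk, s₀, hs₀, hlow⟩ := S.exists_le_measure_ball S.zero_mem_coreSet
    have hlip : ∀ j : ℕ, 1 ≤ j → ∀ x ∈ Icc (-1 : ℝ) 1,
        |(Ta a)^[j] x - (Ta a)^[j] 0| ≤ 4 ^ j * x ^ 2 := by
      intro j hj x hx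
      induction j, hj using Nat.le_induction with
      | base =>
        simp only [Function.iterate_one, Ta, zero_pow two_ne_zero, mul_zero, sub_zero]
        have : |1 - a * x ^ 2 - 1| = a * x ^ 2 := by
          rw [show 1 - a * x ^ 2 - 1 = -(a * x ^ 2) by ring, abs_neg,
            abs_of_nonneg (mul_nonneg S.pos.le (sq_nonneg x))]
        rw [this]
        nlinarith [S.ha.2, sq_nonneg x]
      | succ j hj ih =>
        rw [Function.iterate_succ_apply', Function.iterate_succ_apply']
        have h0 : (0 : ℝ) ∈ Icc (-1 : ℝ) 1 := by constructor <;> norm_num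
        have := Ta_lipschitz_Icc S.ha (iterate_Ta_mem_Icc S.ha j hx) (iterate_Ta_mem_Icc S.ha j h0)
        rw [pow_succ]
        linarith
    set L : ℝ := 2 ^ j with hL
    have hL0 : 0 < L := by positivity
    refine ⟨fun r => √r, K, hK, k / L, by positivity, min 1 ((L * s₀) ^ 2), by positivity,
      fun r hr hr' => ⟨Real.sqrt_nonneg _, hK' _ _ hr, ?_⟩⟩
    have hsr : √r ≤ L * s₀ := by
      rw [Real.sqrt_le_left (by positivity)]; exact hr'.trans (min_le_right _ _)
    have hsr1 : √r ≤ 1 := by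
      rw [Real.sqrt_le_left zero_le_one, one_pow]; exact hr'.trans (min_le_left _ _)
    have hL1 : 1 ≤ L := one_le_pow₀ one_le_two
    have h1 := hlow (√r / L) (by positivity) (by rwa [div_le_iff₀ hL0, mul_comm])
    have e : k / L * √r = k * (√r / L) := by ring
    rw [e]
    refine h1.trans ?_
    have hinv : μ ((Ta a)^[j] ⁻¹' Metric.ball ((Ta a)^[j] 0) r) = μ (Metric.ball ((Ta a)^[j] 0) r) :=
      (S.mp.iterate j).measure_preimage measurableSet_ball.nullMeasurableSet
    rw [← hinv]
    refine measure_mono fun x hx => ?_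
    rw [Metric.mem_ball, Real.dist_eq, sub_zero] at hx
    have hx1 : |x| < √r := hx.trans_le (div_le_self (Real.sqrt_nonneg _) hL1)
    have hxI : x ∈ Icc (-1 : ℝ) 1 := abs_le.1 (hx1.le.trans hsr1)
    rw [mem_preimage, Metric.mem_ball, Real.dist_eq]
    refine (hlip j hj x hxI).trans_lt ?_
    rw [lt_div_iff₀ hL0] at hx
    have h2 : (|x| * L) ^ 2 < r := by
      rw [← Real.sq_sqrt hr.le]
      exact pow_lt_pow_left₀ hx (by positivity) two_ne_zero
    rw [mul_pow, sq_abs, hL, ← pow_mul, mul_comm j 2, pow_mul] at h2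
    norm_num at h2
    linarith
  · obtain ⟨K, hK, r₁, hr₁, h1⟩ := S.exists_refMeasure_ball_le_of_notMem hzP
    obtain ⟨k, hk, s₀, hs₀, h2⟩ := S.exists_le_measure_ball (S.support_subset_coreSet hz)
    exact ⟨id, K, hK, k, hk, min r₁ s₀, by positivity, fun r hr hr' => ⟨hr.le,
      h1 r hr (hr'.trans (min_le_left _ _)), h2 r hr (hr'.trans (min_le_right _ _))⟩⟩

end MTSetting

/-- Integrals against measures of bounded variation are controlled by integrals over the pieces of
a fine interval partition. -/
theorem VarLE.abs_integral_le_of_partition {m ν : Measure ℝ} [IsFiniteMeasure m] [IsFiniteMeasure ν]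
    {V : ℝ} (h : VarLE m ν V) {ℓ : ℝ → ℕ} {N : ℕ} (hℓ : Monotone ℓ) (hN : ∀ x, ℓ x < N) {ε : ℝ}
    (hε : ∀ i, m.real (ℓ ⁻¹' {i}) ≤ ε) {E : Set ℝ} (mE : MeasurableSet E) (hE : ∀ᵐ x ∂ν, x ∈ E)
    {g : ℝ → ℝ} (mg : Measurable g) {C : ℝ} (hC : ∀ x, |g x| ≤ C) :
    |∫ x, g x ∂ν| ≤ 4 * C * ε * V + ν.real univ *
      ∑ i ∈ Finset.range N, |(∫ x in ℓ ⁻¹' {i} ∩ E, g x ∂m) / m.real (ℓ ⁻¹' {i})| := by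
  have hC0 : 0 ≤ C := (abs_nonneg _).trans (hC 0)
  have hε0 : 0 ≤ ε := measureReal_nonneg.trans (hε 0)
  set A : ℕ → ℝ := fun i => (∫ x in ℓ ⁻¹' {i} ∩ E, g x ∂m) / m.real (ℓ ⁻¹' {i}) with hA
  have mG : Measurable (E.indicator g) := mg.indicator mE
  have bG : ∀ x, |E.indicator g x| ≤ C := fun x => by
    by_cases hx : x ∈ E
    · simpa [hx] using hC x
    · simpa [hx] using hC0
  have hAi : ∀ i, |∫ x in ℓ ⁻¹' {i} ∩ E, g x ∂m| ≤ C * m.real (ℓ ⁻¹' {i}) := fun i => by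
    refine (norm_setIntegral_le_of_norm_le_const (f := g) (C := C) (measure_lt_top _ _)
      fun x _ => hC x).trans ?_
    exact mul_le_mul_of_nonneg_left (measureReal_mono inter_subset_left) hC0
  have bA : ∀ i, |A i| ≤ C := fun i => by
    rw [hA, abs_div, abs_of_nonneg measureReal_nonneg]
    exact div_le_of_le_mul₀ measureReal_nonneg hC0 (hAi i)
  have mA : Measurable fun x => A (ℓ x) := (measurable_from_nat (f := A)).comp hℓ.measurable
  have iG : ∀ κ : Measure ℝ, IsFiniteMeasure κ → Integrable (E.indicator g) κ := fun κ _ =>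
    integrable_of_abs_le_one mG bG
  have iA : ∀ κ : Measure ℝ, IsFiniteMeasure κ → Integrable (fun x => A (ℓ x)) κ := fun κ _ =>
    integrable_of_abs_le_one mA fun x => bA _
  have bθ : ∀ x, |E.indicator g x - A (ℓ x)| ≤ 2 * C := fun x => by
    have := abs_sub (E.indicator g x) (A (ℓ x))
    linarith [bG x, bA (ℓ x)]
  have hJ := abs_setIntegral_le_of_pieces (m := m) hℓ hN
    (θ := fun x => E.indicator g x - A (ℓ x)) ((iG m inferInstance).sub (iA m inferInstance))
    (b := 2 * C * ε) (fun i => by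
      rw [integral_sub (iG _ inferInstance) (iA _ inferInstance), integral_indicator mE,
        Measure.restrict_restrict mE, inter_comm]
      have : ∫ x in ℓ ⁻¹' {i}, A (ℓ x) ∂m = ∫ x in ℓ ⁻¹' {i}, A i ∂m :=
        setIntegral_congr_fun (measurableSet_fiber hℓ i) fun x hx => by
          have : ℓ x = i := hx
          simp only [this]
      rw [this, setIntegral_const, smul_eq_mul, sub_eq_zero]
      by_cases h0 : m.real (ℓ ⁻¹' {i}) = 0
      · have := hAi i
        rw [h0, mul_zero] at this
        rw [h0, zero_mul, abs_eq_zero.1 (le_antisymm this (abs_nonneg _))]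
      · rw [hA, mul_div_cancel₀ _ h0])
    (fun i J _ => by
      refine (norm_setIntegral_le_of_norm_le_const (f := fun x => E.indicator g x - A (ℓ x))
        (C := 2 * C) (measure_lt_top _ _) fun x _ => bθ x).trans ?_
      gcongr
      exact (measureReal_mono inter_subset_right).trans (hε i))
  have hmain := h.abs_integral_le (mG.sub mA) bθ (by positivity) hJ
  rw [show (∫ x, (E.indicator g - fun x => A (ℓ x)) x ∂ν) =
    ∫ x, E.indicator g x ∂ν - ∫ x, A (ℓ x) ∂ν from
    integral_sub (iG _ inferInstance) (iA _ inferInstance)] at hmain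
  have hgE : ∫ x, E.indicator g x ∂ν = ∫ x, g x ∂ν := integral_congr_ae <| by
    filter_upwards [hE] with x hx
    simp [hx]
  have hAs : |∫ x, A (ℓ x) ∂ν| ≤ ν.real univ * ∑ i ∈ Finset.range N, |A i| := by
    have := norm_integral_le_of_norm_le_const (μ := ν) (f := fun x => A (ℓ x))
      (C := ∑ i ∈ Finset.range N, |A i|) (Eventually.of_forall fun x =>
        Finset.single_le_sum (f := fun i => |A i|) (fun i _ => abs_nonneg _)
          (Finset.mem_range.2 (hN x)))
    rwa [mul_comm] at this
  rw [hgE] at hmain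
  have := abs_sub_abs_le_abs_sub (∫ x, g x ∂ν) (∫ x, A (ℓ x) ∂ν)
  linarith

namespace MTSetting

variable {a : ℝ} {μ : Measure ℝ}

/-- Almost invariant bounded functions decorrelate from measures of relatively bounded variation. -/
theorem tendsto_integral_div_sub (S : MTSetting a μ) {R : ℕ → ℝ → ℝ} (mR : ∀ n, Measurable (R n))
    (bR : ∀ n x, |R n x| ≤ 1)
    (hinv : Tendsto (fun n => ∫ x, |R n (Ta a x) - R n x| ∂μ) atTop (𝓝 0))
    {lam : ℕ → Measure ℝ} (hfin : ∀ n, IsFiniteMeasure (lam n)) (hac : ∀ n, lam n ≪ μ) {V : ℝ}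
    (hpos : ∀ᶠ n in atTop, 0 < (lam n).real univ)
    (hV : ∀ᶠ n in atTop, VarLE (refMeasure a) (lam n) (V * (lam n).real univ)) :
    Tendsto (fun n => (∫ x, R n x ∂(lam n)) / (lam n).real univ - ∫ x, R n x ∂μ) atTop (𝓝 0) := by
  have := S.isFiniteMeasure_refMeasure
  have := S.prob
  have hI : ∀ n, |∫ x, R n x ∂μ| ≤ 1 := fun n => by
    have := norm_integral_le_of_norm_le_const (μ := μ) (f := R n) (Eventually.of_forall (bR n))
    simpa using this
  have iR : ∀ n, ∀ κ : Measure ℝ, IsFiniteMeasure κ → Integrable (R n) κ := fun n κ _ =>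
    integrable_of_abs_le_one (mR n) (bR n)
  have mE := S.isClosed_coreSet.measurableSet
  have hV0 : 0 ≤ V := by
    obtain ⟨n, hn, hn'⟩ := (hpos.and hV).exists
    exact nonneg_of_mul_nonneg_left hn'.nonneg hn
  rw [Metric.tendsto_atTop']
  intro δ hδ
  set ε : ℝ := δ / (2 * (8 * (V + 1))) with hε
  have hε0 : 0 < ε := by positivity
  obtain ⟨ℓ, N, hℓ, hN, hfib⟩ := S.exists_label_refMeasure hε0
  have hsum : Tendsto (fun n => ∑ i ∈ Finset.range N,
      |(∫ x in ℓ ⁻¹' {i} ∩ coreSet a μ, (R n x - ∫ y, R n y ∂μ) ∂(refMeasure a)) /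
        (refMeasure a).real (ℓ ⁻¹' {i})|) atTop (𝓝 0) := by
    rw [show (0 : ℝ) = ∑ i ∈ Finset.range N, |0 / (refMeasure a).real (ℓ ⁻¹' {i})| by simp]
    refine tendsto_finsetSum _ fun i _ => (Tendsto.div_const ?_ _).abs
    have := tendsto_integral_of_almost_invariant S.erg R mR bR hinv
      ((refMeasure a).restrict (ℓ ⁻¹' {i} ∩ coreSet a μ))
      ((Measure.restrict_mono inter_subset_right le_rfl).absolutelyContinuous.trans
        S.refMeasure_restrict_coreSet_ac)
    refine this.congr fun n => ?_
    rw [integral_sub (iR n _ inferInstance) (integrable_const _)]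
    simp
  obtain ⟨N₁, hN₁⟩ := eventually_atTop.1 ((hpos.and hV).and
    (hsum.eventually (gt_mem_nhds (half_pos hδ))))
  refine ⟨N₁, fun n hn => ?_⟩
  obtain ⟨⟨hp, hv⟩, hs⟩ := hN₁ n hn.le
  have := hfin n
  have hmain := hv.abs_integral_le_of_partition hℓ hN hfib mE ((hac n).ae_le S.ae_mem_coreSet)
    ((mR n).sub measurable_const) (C := 2) (g := fun x => R n x - ∫ y, R n y ∂μ) (fun x => by
      have := abs_sub (R n x) (∫ y, R n y ∂μ)
      linarith [bR n x, hI n])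
  rw [integral_sub (iR n _ inferInstance) (integrable_const _), integral_const, smul_eq_mul] at hmain
  rw [Real.dist_eq, sub_zero]
  set c := (lam n).real univ
  have e : (∫ x, R n x ∂(lam n)) / c - ∫ x, R n x ∂μ =
      (∫ x, R n x ∂(lam n) - c * ∫ x, R n x ∂μ) / c := by
    field_simp
  rw [e, abs_div, abs_of_pos hp, div_lt_iff₀ hp]
  refine hmain.trans_lt ?_
  have e2 : 4 * 2 * ε * (V * c) ≤ δ / 2 * c := by
    have : 4 * 2 * ε * V ≤ δ / 2 := by
      rw [hε, show 4 * 2 * (δ / (2 * (8 * (V + 1)))) * V = δ / 2 * (V / (V + 1)) by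
        field_simp; ring]
      have : V / (V + 1) ≤ 1 := (div_le_one (by linarith)).2 (by linarith)
      nlinarith
    calc _ = (4 * 2 * ε * V) * c := by ring
      _ ≤ _ := by gcongr
  nlinarith [mul_lt_mul_of_pos_left hs hp]

theorem map_restrict_ac (S : MTSetting a μ) (B : Set ℝ) (j : ℕ) :
    (μ.restrict B).map ((Ta a)^[j]) ≪ μ := by
  have := (Measure.absolutelyContinuous_of_le (Measure.restrict_le_self (μ := μ) (s := B))).map
    (continuous_iterate_Ta (a := a) j).measurable
  rwa [(S.mp.iterate j).map_eq] at this

theorem measureReal_map_restrict_univ (B : Set ℝ) (j : ℕ) :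
    ((μ.restrict B).map ((Ta a)^[j])).real univ = μ.real B := by
  rw [map_measureReal_apply (continuous_iterate_Ta j).measurable MeasurableSet.univ]
  simp

/-- Exponential relaxation of the variation of the images of the restricted invariant measure. -/
theorem exists_varLE_map_restrict (S : MTSetting a μ) : ∃ (q : ℕ) (C : ℝ), 1 ≤ q ∧ 0 ≤ C ∧
    ∀ B : Set ℝ, B.OrdConnected → ∀ k i, i < q →
      VarLE (refMeasure a) ((μ.restrict B).map ((Ta a)^[q * k + i]))
        (C * ((1 / 2) ^ k + μ.real B)) := by
  have := S.prob
  have mT : ∀ j, Measurable ((Ta a)^[j]) := fun j => (continuous_iterate_Ta j).measurable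
  obtain ⟨C₀, h₀⟩ := S.exists_varLE
  obtain ⟨q, U, C, hq, hU, hsU, hC, hLY⟩ := S.exists_contraction
  choose D hD hD' using S.exists_map_varLE
  have hstep : ∀ B : Set ℝ, B.OrdConnected → ∀ k,
      VarLE (refMeasure a) ((μ.restrict B).map ((Ta a)^[q * k]))
        (C₀ * (1 / 2) ^ k + 2 * C * μ.real B) := by
    intro B hB k
    induction k with
    | zero =>
      have := h₀.restrict hB
      simp only [mul_zero, Function.iterate_zero, Measure.map_id, pow_zero, mul_one]
      exact this.mono (le_add_of_nonneg_right (by positivity))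
    | succ k ih =>
      have := hLY _ _ inferInstance ih
      rw [Measure.restrict_eq_self_of_ae_mem, Measure.map_map (mT _) (mT _), measureReal_map_restrict_univ,
        ← Function.iterate_add] at this
      · rw [show q * (k + 1) = q + q * k by ring]
        refine this.mono (le_of_eq ?_)
        rw [pow_succ]; ring
      · filter_upwards [ae_mem_support_of_ac (S.map_restrict_ac B _)] with x hx using hsU hx
  set M := ∑ i ∈ Finset.range q, D i with hM
  have hM0 : 0 ≤ M := Finset.sum_nonneg fun i _ => hD i
  have hC₀ := h₀.nonneg
  refine ⟨q, M * (C₀ + 2 * C + 1), hq, by positivity, fun B hB k i hi => ?_⟩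
  have := hD' i _ _ inferInstance (S.map_restrict_ac B _) (hstep B hB k)
  rw [Measure.map_map (mT _) (mT _), measureReal_map_restrict_univ, ← Function.iterate_add, add_comm i] at this
  refine this.mono ?_
  have hDM : D i ≤ M := Finset.single_le_sum (f := D) (fun i _ => hD i) (Finset.mem_range.2 hi)
  have hb : 0 ≤ μ.real B := measureReal_nonneg
  have hp : (0 : ℝ) ≤ (1 / 2) ^ k := by positivity
  calc _ ≤ M * (C₀ * (1 / 2) ^ k + 2 * C * μ.real B + μ.real B) := by gcongr
    _ ≤ _ := by
      rw [mul_assoc M]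
      refine mul_le_mul_of_nonneg_left ?_ hM0
      nlinarith [mul_nonneg hC₀ hb, mul_nonneg hC hp]

end MTSetting

theorem summable_half_pow_div {q : ℕ} (hq : 1 ≤ q) : Summable fun j : ℕ => (1 / 2 : ℝ) ^ (j / q) := by
  have : NeZero q := ⟨by omega⟩
  have h : Summable fun p : ℕ × Fin q => (1 / 2 : ℝ) ^ p.1 * 1 :=
    summable_geometric_two.mul_of_nonneg (Summable.of_finite (f := fun _ : Fin q => (1 : ℝ)))
      (fun _ => by positivity) (fun _ => zero_le_one)
  simpa [Function.comp_def, Nat.divModEquiv] using (Nat.divModEquiv q).summable_iff.2 h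

theorem succ_sq_le_two_pow (s : ℕ) : (s + 1) ^ 2 ≤ 4 * 2 ^ s := by
  rcases lt_or_ge s 2 with hs | hs
  · interval_cases s <;> norm_num
  · induction s, hs using Nat.le_induction with
    | base => norm_num
    | succ s hs ih =>
      rw [pow_succ 2 s]
      nlinarith

theorem tendsto_natSqrt_atTop : Tendsto Nat.sqrt atTop atTop :=
  tendsto_atTop.2 fun b => eventually_atTop.2 ⟨b * b, fun _ hn => Nat.le_sqrt.2 hn⟩

namespace MTSetting

variable {a : ℝ} {μ : Measure ℝ}

/-- Balls shrinking to a non-periodic point have asymptotically no short returns. -/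
theorem tendsto_shortReturn (S : MTSetting a μ) {ζ : ℝ} (hζnp : ∀ p, 1 ≤ p → (Ta a)^[p] ζ ≠ ζ)
    {r : ℕ → ℝ} (hr0 : Tendsto r atTop (𝓝 0)) {q : ℕ} (hq : 1 ≤ q) {C : ℝ} (hC : 0 ≤ C)
    (hvar : ∀ B : Set ℝ, B.OrdConnected → ∀ k i, i < q →
      VarLE (refMeasure a) ((μ.restrict B).map ((Ta a)^[q * k + i])) (C * ((1 / 2) ^ k + μ.real B)))
    {K : ℝ} (hK : 0 < K) (hball : ∀ᶠ n in atTop, (refMeasure a).real (Metric.ball ζ (r n)) ≤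
      K * μ.real (Metric.ball ζ (r n)))
    (hpos : ∀ᶠ n in atTop, 0 < μ.real (Metric.ball ζ (r n))) {k : ℕ → ℕ}
    (hk : Tendsto (fun n => k n * μ.real (Metric.ball ζ (r n))) atTop (𝓝 0)) :
    Tendsto (fun n => μ.real (Metric.ball ζ (r n) ∩
      {x | ∃ j, 1 ≤ j ∧ j ≤ k n ∧ (Ta a)^[j] x ∈ Metric.ball ζ (r n)}) /
        μ.real (Metric.ball ζ (r n))) atTop (𝓝 0) := by
  classical
  have := S.prob
  have := S.isFiniteMeasure_refMeasure
  have mT : ∀ j, Measurable ((Ta a)^[j]) := fun j => (continuous_iterate_Ta j).measurable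
  set B : ℕ → Set ℝ := fun n => Metric.ball ζ (r n) with hB
  have mB : ∀ n, MeasurableSet (B n) := fun n => measurableSet_ball
  set f : ℕ → ℕ → ℝ := fun n j => if 1 ≤ j ∧ (B n ∩ (Ta a)^[j] ⁻¹' B n).Nonempty then
    (1 / 2 : ℝ) ^ (j / q) else 0 with hf
  have hf0 : ∀ n j, 0 ≤ f n j := fun n j => by
    simp only [hf]; split_ifs <;> positivity
  have hfle : ∀ n j, f n j ≤ (1 / 2 : ℝ) ^ (j / q) := fun n j => by
    simp only [hf]; split_ifs <;> first | exact le_rfl | positivity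
  have hfs : ∀ n, Summable (f n) := fun n =>
    Summable.of_nonneg_of_le (hf0 n) (hfle n) (summable_half_pow_div hq)
  have hterm : ∀ j, 1 ≤ j → ∀ᶠ n in atTop, ¬ (B n ∩ (Ta a)^[j] ⁻¹' B n).Nonempty := by
    intro j hj
    have hd : 0 < dist ((Ta a)^[j] ζ) ζ := dist_pos.2 (hζnp j hj)
    obtain ⟨δ, hδ, hδ'⟩ := Metric.continuousAt_iff.1
      ((continuous_iterate_Ta (a := a) j).continuousAt (x := ζ)) _ (half_pos hd)
    filter_upwards [hr0.eventually (gt_mem_nhds hδ), hr0.eventually (gt_mem_nhds (half_pos hd))]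
      with n h1 h2
    rintro ⟨x, hx, hx'⟩
    have h3 := hδ' ((Metric.mem_ball.1 hx).trans h1)
    have h4 : dist ((Ta a)^[j] x) ζ < r n := hx'
    have := dist_triangle_left ((Ta a)^[j] ζ) ζ ((Ta a)^[j] x)
    linarith
  have hsum : Tendsto (fun n => ∑' j, f n j) atTop (𝓝 0) := by
    rw [show (0 : ℝ) = ∑' _ : ℕ, (0 : ℝ) by simp]
    refine tendsto_tsum_of_dominated_convergence (summable_half_pow_div hq) (fun j => ?_)
      (Eventually.of_forall fun n j => ?_)
    · refine tendsto_const_nhds.congr' ?_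
      rcases Nat.eq_zero_or_pos j with rfl | hj
      · exact Eventually.of_forall fun n => by simp [hf]
      · filter_upwards [hterm j hj] with n hn
        simp [hf, hn]
    · rw [Real.norm_eq_abs, abs_of_nonneg (hf0 n j)]
      exact hfle n j
  have hlim : Tendsto (fun n => K * C * ((∑' j, f n j) + k n * μ.real (B n))) atTop (𝓝 0) := by
    simpa using (hsum.add hk).const_mul (K * C)
  refine squeeze_zero' (Eventually.of_forall fun n => by positivity) ?_ hlim
  filter_upwards [hball, hpos] with n hbn hpn
  rw [div_le_iff₀ hpn]
  have hcov : B n ∩ {x | ∃ j, 1 ≤ j ∧ j ≤ k n ∧ (Ta a)^[j] x ∈ B n} ⊆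
      ⋃ j ∈ Finset.Icc 1 (k n), B n ∩ (Ta a)^[j] ⁻¹' B n := by
    rintro x ⟨hx, j, h1, h2, h3⟩
    exact mem_biUnion (Finset.mem_coe.2 (Finset.mem_Icc.2 ⟨h1, h2⟩)) ⟨hx, h3⟩
  have hj : ∀ j ∈ Finset.Icc 1 (k n), μ.real (B n ∩ (Ta a)^[j] ⁻¹' B n) ≤
      K * C * μ.real (B n) * (f n j + μ.real (B n)) := by
    intro j hj
    by_cases hne : (B n ∩ (Ta a)^[j] ⁻¹' B n).Nonempty
    · have hfj : f n j = (1 / 2 : ℝ) ^ (j / q) := if_pos ⟨(Finset.mem_Icc.1 hj).1, hne⟩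
      have := (hvar (B n) (convex_ball ζ (r n)).ordConnected (j / q) (j % q)
        (Nat.mod_lt _ hq)).measureReal_le (mB n)
      rw [Nat.div_add_mod, map_measureReal_apply (mT j) (mB n),
        measureReal_restrict_apply (mT j (mB n)), inter_comm] at this
      rw [hfj]
      refine this.trans ?_
      calc _ ≤ (K * μ.real (B n)) * (C * ((1 / 2) ^ (j / q) + μ.real (B n))) := by
            gcongr
        _ = _ := by ring
    · rw [not_nonempty_iff_eq_empty] at hne
      rw [hne, measureReal_empty]
      have := hf0 n j
      positivity
  calc _ ≤ μ.real (⋃ j ∈ Finset.Icc 1 (k n), B n ∩ (Ta a)^[j] ⁻¹' B n) :=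
        measureReal_mono hcov (measure_ne_top _ _)
    _ ≤ ∑ j ∈ Finset.Icc 1 (k n), μ.real (B n ∩ (Ta a)^[j] ⁻¹' B n) :=
        measureReal_biUnion_finset_le _ _
    _ ≤ ∑ j ∈ Finset.Icc 1 (k n), K * C * μ.real (B n) * (f n j + μ.real (B n)) :=
        Finset.sum_le_sum hj
    _ = K * C * μ.real (B n) * (∑ j ∈ Finset.Icc 1 (k n), f n j + k n * μ.real (B n)) := by
        rw [← Finset.mul_sum, Finset.sum_add_distrib]
        simp
    _ ≤ K * C * μ.real (B n) * (∑' j, f n j + k n * μ.real (B n)) := by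
        gcongr
        exact (hfs n).sum_le_tsum _ fun j _ => hf0 n j
    _ = _ := by ring

end MTSetting

/-- For a Misiurewicz–Thurston quadratic map and a non-periodic point
`ζ ∈ [1-a, 1]`, the rescaled interarrival process of shrinking balls `B_n` around `ζ` with
`n μ(B_n) → τ > 0` converges in distribution under `μ` to `ν₁`, the interarrival law of a
standard homogeneous Poisson process of intensity `1`. -/
theorem statement5 (a : ℝ) (ha : a ∈ Set.Ioc (0 : ℝ) 2)
    (hMis : ∃ k, 1 ≤ k ∧ ∃ p, 1 ≤ p ∧ (Ta a)^[k + p] 0 = (Ta a)^[k] 0)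
    (hnotper : ∀ m, 1 ≤ m → (Ta a)^[m] 0 ≠ 0)
    (μ : Measure ℝ) [IsProbabilityMeasure μ] (hErg : Ergodic (Ta a) μ)
    (hac : μ ≪ MeasureTheory.volume)
    (ζ : ℝ) (hζ : ζ ∈ Set.Icc (1 - a) 1) (hζnp : ∀ p, 1 ≤ p → (Ta a)^[p] ζ ≠ ζ)
    (r : ℕ → ℝ) (hrpos : ∀ n, 0 < r n) (hr0 : Tendsto r atTop (𝓝 0))
    (τ : ℝ) (hτ : 0 < τ)
    (hlim : Tendsto (fun n : ℕ => (n : ℝ≥0∞) * μ (Metric.ball ζ (r n))) atTop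
      (𝓝 (ENNReal.ofReal τ))) :
    ∀ ν : Measure (ℕ → ℝ≥0∞), IsNuTheta 1 ν →
      ConvInDist (fun _ => μ)
        (fun n x => rescaledProcess (Ta a) (Metric.ball ζ (r n))
          (μ (Metric.ball ζ (r n))) x) ν := by

  intro ν hν
  have S : MTSetting a μ := ⟨ha, hMis, hnotper, inferInstance, hErg, hac⟩
  set β : ℕ → ℝ := fun n => μ.real (Metric.ball ζ (r n)) with hβ
  have hnβ : Tendsto (fun n : ℕ => n * β n) atTop (𝓝 τ) := by
    have := (ENNReal.tendsto_toReal ENNReal.ofReal_ne_top).comp hlim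
    rw [ENNReal.toReal_ofReal hτ.le] at this
    refine this.congr fun n => ?_
    simp [hβ, Measure.real]
  have hbig : ∀ᶠ n : ℕ in atTop, τ / 2 ≤ n * β n := hnβ.eventually_const_le (half_lt_self hτ)
  have hpos : ∀ᶠ n in atTop, 0 < β n := by
    filter_upwards [hbig] with n hn
    have : 0 < n * β n := (half_pos hτ).trans_le hn
    exact pos_of_mul_pos_right this (Nat.cast_nonneg n)
  have hζs : ζ ∈ μ.support := by
    rw [Measure.mem_support_iff_forall]
    intro U hU
    obtain ⟨ε, hε, hεU⟩ := Metric.mem_nhds_iff.1 hU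
    obtain ⟨n, hn, hrn⟩ := (hpos.and (hr0.eventually (gt_mem_nhds hε))).exists
    refine lt_of_lt_of_le ?_ (measure_mono ((Metric.ball_subset_ball hrn.le).trans hεU))
    exact (ENNReal.toReal_pos_iff.1 hn).1
  obtain ⟨K, hK, r₀, hr₀, hball⟩ := S.exists_refMeasure_ball_le_measure hζs
  have hball' : ∀ᶠ n in atTop, (refMeasure a).real (Metric.ball ζ (r n)) ≤ K * β n := by
    filter_upwards [hr0.eventually (gt_mem_nhds hr₀)] with n hn using hball _ (hrpos n) hn.le
  obtain ⟨q, C, hq, hC, hvar⟩ := S.exists_varLE_map_restrict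
  have hs : Tendsto (fun n : ℕ => (1 : ℝ) / Nat.sqrt n) atTop (𝓝 0) :=
    tendsto_one_div_atTop_nhds_zero_nat.comp tendsto_natSqrt_atTop
  have hsβ : Tendsto (fun n : ℕ => Nat.sqrt n * β n) atTop (𝓝 0) := by
    have := hs.mul hnβ
    rw [zero_mul] at this
    refine squeeze_zero' (Eventually.of_forall fun n => by positivity) ?_ this
    filter_upwards [tendsto_natSqrt_atTop.eventually_ge_atTop 1] with n hn
    have h1 : (0 : ℝ) < Nat.sqrt n := by exact_mod_cast hn
    have h2 : (Nat.sqrt n : ℝ) * Nat.sqrt n ≤ n := by exact_mod_cast Nat.sqrt_le n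
    have h3 : (Nat.sqrt n : ℝ) ≤ 1 / Nat.sqrt n * n := by
      rw [one_div, ← div_eq_inv_mul, le_div_iff₀ h1]; exact h2
    rw [← mul_assoc]
    exact mul_le_mul_of_nonneg_right h3 measureReal_nonneg
  have h0 : Tendsto β atTop (𝓝 0) := by
    refine squeeze_zero' (Eventually.of_forall fun n => measureReal_nonneg) ?_ hsβ
    filter_upwards [tendsto_natSqrt_atTop.eventually_ge_atTop 1] with n hn
    exact le_mul_of_one_le_left measureReal_nonneg (by exact_mod_cast hn)
  have hk : Tendsto (fun n : ℕ => ((q * Nat.sqrt n : ℕ) : ℝ) * β n) atTop (𝓝 0) := by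
    have := hsβ.const_mul (q : ℝ)
    rw [mul_zero] at this
    refine this.congr fun n => ?_
    push_cast; ring
  have hrel : ∀ᶠ n : ℕ in atTop, (1 / 2 : ℝ) ^ Nat.sqrt n ≤ 8 / τ * β n := by
    filter_upwards [hbig] with n hn
    have h1 : (n : ℝ) ≤ 4 * 2 ^ Nat.sqrt n := by
      have := (Nat.lt_succ_sqrt' n).le.trans (succ_sq_le_two_pow _)
      exact_mod_cast this
    have h2 : (0 : ℝ) < 2 ^ Nat.sqrt n := by positivity
    have h3 : τ / 2 ≤ 4 * 2 ^ Nat.sqrt n * β n :=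
      hn.trans (mul_le_mul_of_nonneg_right h1 measureReal_nonneg)
    rw [div_pow, one_pow, div_le_iff₀ h2, div_mul_eq_mul_div, div_mul_eq_mul_div, le_div_iff₀ hτ]
    linarith
  refine convInDist_of_decorrelation S.mp (fun n => measurableSet_ball) hpos
    (fun n => q * Nat.sqrt n) h0 hk
    (S.tendsto_shortReturn hζnp hr0 hq hC hvar hK hball' hpos hk) ?_ hν
  intro R mR bR hinv
  have hmass : ∀ n, ((μ.restrict (Metric.ball ζ (r n))).map ((Ta a)^[q * Nat.sqrt n])).real univ =
      β n := fun n => MTSetting.measureReal_map_restrict_univ _ _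
  have := S.tendsto_integral_div_sub mR bR hinv
    (lam := fun n => (μ.restrict (Metric.ball ζ (r n))).map ((Ta a)^[q * Nat.sqrt n]))
    (fun n => inferInstance) (fun n => S.map_restrict_ac _ _) (V := C * (8 / τ + 1))
    (by simpa only [hmass] using hpos) (by
      filter_upwards [hrel] with n hn
      rw [hmass]
      refine (hvar _ (convex_ball ζ (r n)).ordConnected (Nat.sqrt n) 0 hq).mono ?_
      rw [mul_assoc, add_mul, one_mul]
      gcongr)
  refine this.congr fun n => ?_
  rw [hmass, integral_map (continuous_iterate_Ta _).measurable.aemeasurable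
    (mR n).aestronglyMeasurable]
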